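/- arXiv:2604.20827 — 4 statements merged into one kernel-verified Lean document; each statement's English description precedes it below -/
import Mathlib

section
/- There exist a closed subset X of the real line, a nonatomic Borel probability measure μ on X, and a continuous cost C : X × X → [0,∞) such that for every ε > 0 the entropic functional J_ε admits a unique minimiser P_ε ∈ Π(μ,μ), and the following hold: (i) P_ε converges in total variation, as ε ↓ 0, to an optimal transport plan P* (a minimiser of ∫ C dP over Π(μ,μ)) whose support Γ := supp(P*) is noncompact; (ii) there is a closed noncompact set F ⊆ X × X such that inf_F I_Γ > 0 but limsup_{ε↓0} ε log P_ε(F) > −inf_F I_Γ. -/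
open MeasureTheory Filter Set Topology
open scoped ENNReal NNReal Classical

noncomputable section

/-- Extended logarithm on `ℝ≥0∞` (with `log 0 = ⊥`, `log ⊤ = ⊤`). -/
def elog (x : ℝ≥0∞) : EReal :=
  if x = 0 then ⊥ else if x = ⊤ then ⊤ else ((Real.log x.toReal : ℝ) : EReal)

/-- `limsup_{ε ↓ 0} ε ⬝ log Q_ε(S)`. -/
def limsupLog {Z : Type*} [MeasurableSpace Z] (Q : ℝ → Measure Z) (S : Set Z) : EReal :=
  limsup (fun ε : ℝ => (ε : EReal) * elog (Q ε S)) (𝓝[>] (0 : ℝ))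

/-- Relative entropy (Kullback–Leibler divergence). -/
def KL {Ω : Type*} [MeasurableSpace Ω] (P Q : Measure Ω) : EReal :=
  if P ≪ Q ∧ Integrable (fun x => Real.log ((P.rnDeriv Q x).toReal)) P
  then ((∫ x, Real.log ((P.rnDeriv Q x).toReal) ∂P : ℝ) : EReal) else ⊤

/-- Couplings with prescribed marginals. -/
def couplings {X Y : Type*} [MeasurableSpace X] [MeasurableSpace Y]
    (μ : Measure X) (ν : Measure Y) : Set (Measure (X × Y)) :=
  {P | IsProbabilityMeasure P ∧ P.map Prod.fst = μ ∧ P.map Prod.snd = ν}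

/-- Entropic functional. -/
def Jfun {Z : Type*} [MeasurableSpace Z] (C : Z → ℝ) (R : Measure Z) (ε : ℝ)
    (P : Measure Z) : EReal :=
  ((∫⁻ z, ENNReal.ofReal (C z) ∂P : ℝ≥0∞) : EReal) + (ε : EReal) * KL P R

/-- The BGN candidate rate function `I_Γ`. -/
def BGNrate {X Y : Type*} (C : X × Y → ℝ) (Γ : Set (X × Y)) (p : X × Y) : EReal :=
  ⨆ (k : ℕ) (z : Fin (k + 2) → X × Y) (_ : z 0 = p)
    (_ : ∀ i, i ≠ 0 → z i ∈ Γ) (σ : Equiv.Perm (Fin (k + 2))),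
    ((∑ i, C (z i) - ∑ i, C ((z i).1, (z (σ i)).2) : ℝ) : EReal)

/-- Topological support of a measure. -/
def msupport {Z : Type*} [TopologicalSpace Z] [MeasurableSpace Z] (μ : Measure Z) : Set Z :=
  {x | ∀ U : Set Z, IsOpen U → x ∈ U → 0 < μ U}

/-- Total variation distance `‖P − Q‖_TV = sup_A |P(A) − Q(A)|`. -/
def TVdist {Ω : Type*} [MeasurableSpace Ω] (P Q : Measure Ω) : ℝ≥0∞ :=
  ⨆ (A : Set Ω) (_ : MeasurableSet A), max (P A - Q A) (Q A - P A)

open InformationTheory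

theorem mem_couplings_withDensity {Z : Type*} [MeasurableSpace Z] {μ : Measure Z}
    [IsProbabilityMeasure μ]
    {d : Z × Z → ℝ≥0∞} (hd : Measurable d) (h1 : ∀ x, ∫⁻ y, d (x, y) ∂μ = 1)
    (h2 : ∀ y, ∫⁻ x, d (x, y) ∂μ = 1) :
    (μ.prod μ).withDensity d ∈ couplings μ μ := by
  have hfst : ((μ.prod μ).withDensity d).map Prod.fst = μ := by
    ext A hA
    rw [Measure.map_apply measurable_fst hA, withDensity_apply _ (measurable_fst hA),
      ← Set.prod_univ, ← Measure.prod_restrict, Measure.restrict_univ,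
      lintegral_prod _ hd.aemeasurable]
    simp [h1]
  have hsnd : ((μ.prod μ).withDensity d).map Prod.snd = μ := by
    ext A hA
    rw [Measure.map_apply measurable_snd hA, withDensity_apply _ (measurable_snd hA),
      ← Set.univ_prod, ← Measure.prod_restrict, Measure.restrict_univ,
      lintegral_prod_symm _ hd.aemeasurable]
    simp [h2]
  refine ⟨⟨?_⟩, hfst, hsnd⟩
  rw [← Set.preimage_univ (f := Prod.fst), ← Measure.map_apply measurable_fst MeasurableSet.univ,
    hfst, measure_univ]

theorem TVdist_le_lintegral_sub {Ω : Type*} [MeasurableSpace Ω] {ν : Measure Ω}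
    {f g : Ω → ℝ≥0∞} (hf : Measurable f)
    [IsProbabilityMeasure (ν.withDensity f)] [IsProbabilityMeasure (ν.withDensity g)] :
    TVdist (ν.withDensity f) (ν.withDensity g) ≤ ∫⁻ x, (g x - f x) ∂ν := by
  have key : ∀ A, MeasurableSet A →
      ν.withDensity g A - ν.withDensity f A ≤ ∫⁻ x, (g x - f x) ∂ν := by
    intro A hA
    rw [withDensity_apply _ hA, withDensity_apply _ hA]
    exact (lintegral_sub_le f g hf).trans (setLIntegral_le_lintegral _ _)
  refine iSup₂_le fun A hA => max_le ?_ (key A hA)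
  refine le_trans (le_of_eq ?_) (key Aᶜ hA.compl)
  rw [prob_compl_eq_one_sub hA, prob_compl_eq_one_sub hA]
  generalize hb : ν.withDensity g A = b
  generalize ha : ν.withDensity f A = a
  have hb1 : b ≤ 1 := hb ▸ prob_le_one
  have ha1 : a ≤ 1 := ha ▸ prob_le_one
  lift a to ℝ≥0 using ne_top_of_le_ne_top ENNReal.one_ne_top ha1
  lift b to ℝ≥0 using ne_top_of_le_ne_top ENNReal.one_ne_top hb1
  norm_cast at *
  apply NNReal.eq
  rw [NNReal.coe_sub_def, NNReal.coe_sub_def, NNReal.coe_sub ha1, NNReal.coe_sub hb1]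
  congr 1
  push_cast
  ring

theorem Jfun_eq_klDiv_tilted {Z : Type*} [MeasurableSpace Z] {μ : Measure Z}
    [IsProbabilityMeasure μ] {C : Z × Z → ℝ} (hC : Measurable C) (hC0 : ∀ z, 0 ≤ C z)
    {B : ℝ} (hCB : ∀ z, C z ≤ B) {a : Z → ℝ} (ha : Measurable a) {A : ℝ} (haA : ∀ x, |a x| ≤ A)
    {ε : ℝ} (hε : 0 < ε)
    (hone : ∫ z, Real.exp (-C z / ε - a z.1) ∂(μ.prod μ) = 1)
    {Q : Measure (Z × Z)} (hQ : Q ∈ couplings μ μ) (hac : Q ≪ μ.prod μ)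
    (hint : Integrable (llr Q (μ.prod μ)) Q) :
    Jfun C (μ.prod μ) ε Q =
      ((ε * (klDiv Q ((μ.prod μ).tilted fun z => -C z / ε - a z.1)).toReal
        - ε * ∫ x, a x ∂μ : ℝ) : EReal) := by
  obtain ⟨hQp, hQ1, -⟩ := hQ
  have hexp : Integrable (fun z : Z × Z => Real.exp (-C z / ε - a z.1)) (μ.prod μ) := by
    by_contra h
    rw [integral_undef h] at hone
    exact zero_ne_one hone
  have hCi : Integrable C Q :=
    Integrable.of_bound hC.aestronglyMeasurable B
      (ae_of_all _ fun z => by rw [Real.norm_eq_abs, abs_of_nonneg (hC0 z)]; exact hCB z)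
  have hai : Integrable (fun z : Z × Z => a z.1) Q :=
    Integrable.of_bound (ha.comp measurable_fst).aestronglyMeasurable A
      (ae_of_all _ fun z => haA z.1)
  have hCi' : Integrable (fun z => -C z / ε) Q := hCi.neg.div_const ε
  have := isProbabilityMeasure_tilted hexp
  have hkl : (klDiv Q ((μ.prod μ).tilted fun z => -C z / ε - a z.1)).toReal =
      ∫ z, llr Q (μ.prod μ) z ∂Q + (∫ z, C z ∂Q) / ε + ∫ x, a x ∂μ := by
    rw [toReal_klDiv_of_measure_eq (hac.trans (absolutelyContinuous_tilted hexp)) (by simp),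
      integral_llr_tilted_right (f := fun z : Z × Z => -C z / ε - a z.1) hac (hCi'.sub hai)
        hexp hint, hone, Real.log_one, integral_sub hCi' hai, integral_div, integral_neg]
    have hfst : ∫ x, a x ∂μ = ∫ z, a z.1 ∂Q := by
      rw [← integral_map measurable_fst.aemeasurable ha.aestronglyMeasurable, hQ1]
    rw [hfst]
    ring
  have hKL : KL Q (μ.prod μ) = ((∫ z, llr Q (μ.prod μ) z ∂Q : ℝ) : EReal) :=
    if_pos ⟨hac, hint⟩
  rw [Jfun, hKL, hkl, ← ofReal_integral_eq_lintegral_ofReal hCi (ae_of_all _ hC0),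
    EReal.coe_ennreal_ofReal, max_eq_left (integral_nonneg hC0), ← EReal.coe_mul,
    ← EReal.coe_add]
  congr 1
  field_simp
  ring

theorem Jfun_eq_top {Z : Type*} [MeasurableSpace Z] {C : Z → ℝ} {R Q : Measure Z} {ε : ℝ}
    (hε : 0 < ε) (h : ¬ (Q ≪ R ∧ Integrable (llr Q R) Q)) : Jfun C R ε Q = ⊤ := by
  have hKL : KL Q R = ⊤ := if_neg h
  rw [Jfun, hKL, EReal.coe_mul_top_of_pos hε, EReal.add_top_of_ne_bot]
  exact EReal.coe_ennreal_ne_bot _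

theorem tilted_isUniqueMin_Jfun {Z : Type*} [MeasurableSpace Z] {μ : Measure Z}
    [IsProbabilityMeasure μ] {C : Z × Z → ℝ} (hC : Measurable C) (hC0 : ∀ z, 0 ≤ C z)
    {B : ℝ} (hCB : ∀ z, C z ≤ B) {a : Z → ℝ} (ha : Measurable a) {A : ℝ} (haA : ∀ x, |a x| ≤ A)
    {ε : ℝ} (hε : 0 < ε)
    (hone : ∫ z, Real.exp (-C z / ε - a z.1) ∂(μ.prod μ) = 1)
    {P : Measure (Z × Z)} (hP : P = (μ.prod μ).tilted fun z => -C z / ε - a z.1)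
    (hPc : P ∈ couplings μ μ) :
    (∀ Q ∈ couplings μ μ, Jfun C (μ.prod μ) ε P ≤ Jfun C (μ.prod μ) ε Q) ∧
      ∀ Q ∈ couplings μ μ,
        (∀ R ∈ couplings μ μ, Jfun C (μ.prod μ) ε Q ≤ Jfun C (μ.prod μ) ε R) → Q = P := by
  have hexp : Integrable (fun z : Z × Z => Real.exp (-C z / ε - a z.1)) (μ.prod μ) := by
    by_contra h
    rw [integral_undef h] at hone
    exact zero_ne_one hone
  have hac : P ≪ μ.prod μ := hP ▸ tilted_absolutelyContinuous _ _
  have := hPc.1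
  have hfm : Measurable fun z : Z × Z => -C z / ε - a z.1 :=
    (hC.neg.div_const ε).sub (ha.comp measurable_fst)
  have hint : Integrable (llr P (μ.prod μ)) P := by
    have h1 : llr P (μ.prod μ) =ᵐ[P] fun z => -C z / ε - a z.1 := by
      have h2 := hac.ae_le (hP ▸ log_rnDeriv_tilted_left_self hexp)
      filter_upwards [h2] with z hz
      rw [llr, hz, hone, Real.log_one, sub_zero]
    rw [integrable_congr h1]
    refine Integrable.of_bound hfm.aestronglyMeasurable (B / ε + A) (ae_of_all _ fun z => ?_)
    refine (norm_sub_le _ _).trans (add_le_add ?_ (haA z.1))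
    rw [Real.norm_eq_abs, neg_div, abs_neg, abs_of_nonneg (div_nonneg (hC0 z) hε.le)]
    gcongr
    exact hCB z
  have hJP : Jfun C (μ.prod μ) ε P = ((-(ε * ∫ x, a x ∂μ) : ℝ) : EReal) := by
    rw [Jfun_eq_klDiv_tilted hC hC0 hCB ha haA hε hone hPc hac hint, ← hP, klDiv_self]
    simp
  refine ⟨fun Q hQ => ?_, fun Q hQ hmin => ?_⟩
  · by_cases h : Q ≪ μ.prod μ ∧ Integrable (llr Q (μ.prod μ)) Q
    · rw [hJP, Jfun_eq_klDiv_tilted hC hC0 hCB ha haA hε hone hQ h.1 h.2, EReal.coe_le_coe_iff]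
      have : 0 ≤ ε * (klDiv Q ((μ.prod μ).tilted fun z => -C z / ε - a z.1)).toReal := by
        positivity
      linarith
    · rw [Jfun_eq_top hε h]
      exact le_top
  · have hle := hmin P hPc
    have h : Q ≪ μ.prod μ ∧ Integrable (llr Q (μ.prod μ)) Q := by
      by_contra h
      rw [Jfun_eq_top hε h, hJP, top_le_iff] at hle
      exact EReal.coe_ne_top _ hle
    have := hQ.1
    rw [hJP, Jfun_eq_klDiv_tilted hC hC0 hCB ha haA hε hone hQ h.1 h.2, EReal.coe_le_coe_iff,
      ← hP] at hle
    have h0 : (klDiv Q P).toReal = 0 := by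
      refine le_antisymm ?_ ENNReal.toReal_nonneg
      have : ε * (klDiv Q P).toReal ≤ 0 := by linarith
      exact nonpos_of_mul_nonpos_right this hε
    have hPR : μ.prod μ ≪ P := hP ▸ absolutelyContinuous_tilted hexp
    have hne : klDiv Q P ≠ ⊤ := by
      refine klDiv_ne_top (h.1.trans hPR) ?_
      rw [hP]
      refine integrable_llr_tilted_right h.1 ?_ h.2 hexp
      refine Integrable.of_bound hfm.aestronglyMeasurable (B / ε + A) (ae_of_all _ fun z => ?_)
      refine (norm_sub_le _ _).trans (add_le_add ?_ (haA z.1))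
      rw [Real.norm_eq_abs, neg_div, abs_neg, abs_of_nonneg (div_nonneg (hC0 z) hε.le)]
      gcongr
      exact hCB z
    exact klDiv_eq_zero_iff.1 (((ENNReal.toReal_eq_zero_iff _).1 h0).resolve_right hne)

instance isProbabilityMeasure_volume_unitAddCircle :
    IsProbabilityMeasure (volume : Measure UnitAddCircle) :=
  ⟨UnitAddCircle.measure_univ⟩

/-- The cost of a displacement `t` on the circle at level `n`: a ramp which vanishes for
`‖t‖ ≤ 4⁻ⁿ` and equals `1` for `2 * 4⁻ⁿ ≤ ‖t‖`. -/
def rampCost (p : ℕ × UnitAddCircle) : ℝ := max 0 (min 1 (‖p.2‖ * 4 ^ p.1 - 1))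

theorem continuous_rampCost : Continuous rampCost := by
  have h : Continuous fun p : ℕ × UnitAddCircle => (4 : ℝ) ^ p.1 :=
    (continuous_of_discreteTopology (f := fun n : ℕ => (4 : ℝ) ^ n)).comp continuous_fst
  unfold rampCost
  fun_prop

theorem rampCost_nonneg (p : ℕ × UnitAddCircle) : 0 ≤ rampCost p := le_max_left _ _

theorem rampCost_le_one (p : ℕ × UnitAddCircle) : rampCost p ≤ 1 :=
  max_le zero_le_one (min_le_left _ _)

theorem rampCost_zero_level (t : UnitAddCircle) : rampCost (0, t) = 0 := by
  have := AddCircle.norm_le_half_period 1 one_ne_zero (x := t)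
  norm_num at this
  refine max_eq_left ((min_le_right _ _).trans ?_)
  simp only [pow_zero, mul_one]
  linarith

theorem rampCost_eq_zero_of_norm_le {n : ℕ} {t : UnitAddCircle} (h : ‖t‖ ≤ (4 ^ n)⁻¹) :
    rampCost (n, t) = 0 := by
  refine max_eq_left ((min_le_right _ _).trans ?_)
  have := mul_le_mul_of_nonneg_right h (pow_nonneg (zero_le_four (α := ℝ)) n)
  rw [inv_mul_cancel₀ (by positivity)] at this
  simpa using this

theorem rampCost_eq_one_of_le_norm {n : ℕ} {t : UnitAddCircle} (h : 2 * (4 ^ n)⁻¹ ≤ ‖t‖) :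
    rampCost (n, t) = 1 := by
  have := mul_le_mul_of_nonneg_right h (pow_nonneg (zero_le_four (α := ℝ)) n)
  rw [mul_assoc, inv_mul_cancel₀ (by positivity)] at this
  have h1 : min 1 (‖t‖ * 4 ^ n - 1) = (1 : ℝ) := min_eq_left (by linarith)
  simp [rampCost, h1]

/-- The conditional mass of the weight `g` at level `n`. -/
def levelMass (g : ℕ × UnitAddCircle → ℝ) (n : ℕ) : ℝ := ∫ t : UnitAddCircle, g (n, t)

/-- The weight `g` normalised at each level. -/
def levelDensity (g : ℕ × UnitAddCircle → ℝ) (p : ℕ × UnitAddCircle) : ℝ≥0∞ :=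
  ENNReal.ofReal (g p / levelMass g p.1)

/-- The Gibbs weight at temperature `ε`. -/
def gibbsWeight (ε : ℝ) (p : ℕ × UnitAddCircle) : ℝ := Real.exp (-rampCost p / ε)

/-- The zero-temperature limit of the Gibbs weight. -/
def groundWeight (p : ℕ × UnitAddCircle) : ℝ := (rampCost ⁻¹' {0}).indicator 1 p

theorem measurable_levelDensity {g : ℕ × UnitAddCircle → ℝ} (hg : Measurable g) :
    Measurable (levelDensity g) :=
  (hg.div ((measurable_of_countable (levelMass g)).comp measurable_fst)).ennreal_ofReal

theorem lintegral_levelDensity {g : ℕ × UnitAddCircle → ℝ} (hg : Measurable g)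
    (hg0 : ∀ p, 0 ≤ g p) (hg1 : ∀ p, g p ≤ 1) {n : ℕ} (hpos : 0 < levelMass g n) :
    ∫⁻ t : UnitAddCircle, levelDensity g (n, t) = 1 := by
  have hint : Integrable fun t : UnitAddCircle => g (n, t) :=
    Integrable.of_bound (hg.comp measurable_prodMk_left).aestronglyMeasurable 1
      (ae_of_all _ fun t => by rw [Real.norm_eq_abs, abs_of_nonneg (hg0 _)]; exact hg1 _)
  unfold levelDensity
  rw [← ofReal_integral_eq_lintegral_ofReal (hint.div_const _)
    (ae_of_all _ fun t => div_nonneg (hg0 _) hpos.le), integral_div]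
  change ENNReal.ofReal (levelMass g n / levelMass g n) = 1
  rw [div_self hpos.ne', ENNReal.ofReal_one]

theorem measurable_gibbsWeight (ε : ℝ) : Measurable (gibbsWeight ε) :=
  (continuous_rampCost.measurable.neg.div_const ε).exp

theorem gibbsWeight_nonneg (ε : ℝ) (p : ℕ × UnitAddCircle) : 0 ≤ gibbsWeight ε p :=
  (Real.exp_pos _).le

theorem gibbsWeight_le_one {ε : ℝ} (hε : 0 < ε) (p : ℕ × UnitAddCircle) :
    gibbsWeight ε p ≤ 1 :=
  Real.exp_le_one_iff.2 (div_nonpos_of_nonpos_of_nonneg (neg_nonpos.2 (rampCost_nonneg p)) hε.le)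

theorem exp_le_gibbsWeight {ε : ℝ} (hε : 0 < ε) (p : ℕ × UnitAddCircle) :
    Real.exp (-1 / ε) ≤ gibbsWeight ε p := by
  unfold gibbsWeight
  gcongr
  exact rampCost_le_one p

theorem measurable_groundWeight : Measurable groundWeight :=
  measurable_one.indicator (continuous_rampCost.measurable (measurableSet_singleton 0))

theorem groundWeight_nonneg (p : ℕ × UnitAddCircle) : 0 ≤ groundWeight p :=
  indicator_nonneg (fun _ _ => zero_le_one) p

theorem groundWeight_le_one (p : ℕ × UnitAddCircle) : groundWeight p ≤ 1 :=
  indicator_apply_le' (fun _ => le_rfl) fun _ => zero_le_one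

theorem integrable_gibbsWeight {ε : ℝ} (hε : 0 < ε) (n : ℕ) :
    Integrable fun t : UnitAddCircle => gibbsWeight ε (n, t) :=
  Integrable.of_bound
    ((measurable_gibbsWeight ε).comp measurable_prodMk_left).aestronglyMeasurable 1
    (ae_of_all _ fun t => by
      rw [Real.norm_eq_abs, abs_of_nonneg (gibbsWeight_nonneg ε _)]
      exact gibbsWeight_le_one hε _)

theorem exp_le_levelMass_gibbsWeight {ε : ℝ} (hε : 0 < ε) (n : ℕ) :
    Real.exp (-1 / ε) ≤ levelMass (gibbsWeight ε) n := by
  have h := integral_mono (integrable_const (Real.exp (-1 / ε))) (integrable_gibbsWeight hε n)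
    (fun t => exp_le_gibbsWeight hε (n, t))
  simpa [levelMass] using h

theorem levelMass_gibbsWeight_pos {ε : ℝ} (hε : 0 < ε) (n : ℕ) :
    0 < levelMass (gibbsWeight ε) n :=
  (Real.exp_pos _).trans_le (exp_le_levelMass_gibbsWeight hε n)

theorem levelMass_gibbsWeight_le_one {ε : ℝ} (hε : 0 < ε) (n : ℕ) :
    levelMass (gibbsWeight ε) n ≤ 1 := by
  have h := integral_mono (integrable_gibbsWeight hε n) (integrable_const (1 : ℝ))
    (fun t => gibbsWeight_le_one hε (n, t))
  simpa [levelMass] using h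

theorem abs_log_levelMass_gibbsWeight_le {ε : ℝ} (hε : 0 < ε) (n : ℕ) :
    |Real.log (levelMass (gibbsWeight ε) n)| ≤ 1 / ε := by
  have hpos := levelMass_gibbsWeight_pos hε n
  rw [abs_of_nonpos (Real.log_nonpos hpos.le (levelMass_gibbsWeight_le_one hε n))]
  have := (Real.le_log_iff_exp_le hpos).2 (exp_le_levelMass_gibbsWeight hε n)
  rw [neg_div] at this
  linarith

theorem volume_real_closedBall_zero {r : ℝ} (hr : 0 ≤ r) :
    (volume : Measure UnitAddCircle).real (Metric.closedBall 0 r) = min 1 (2 * r) := by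
  rw [measureReal_def, AddCircle.volume_closedBall,
    ENNReal.toReal_ofReal (le_min zero_le_one (by positivity))]

theorem levelMass_groundWeight_pos (n : ℕ) : 0 < levelMass groundWeight n := by
  have hint : Integrable fun t : UnitAddCircle => groundWeight (n, t) :=
    Integrable.of_bound
      (measurable_groundWeight.comp measurable_prodMk_left).aestronglyMeasurable 1
      (ae_of_all _ fun t => by
        rw [Real.norm_eq_abs, abs_of_nonneg (groundWeight_nonneg _)]
        exact groundWeight_le_one _)
  have h := integral_mono ((integrable_const (1 : ℝ)).indicator
    (Metric.isClosed_closedBall (x := (0 : UnitAddCircle)) (ε := (4 ^ n)⁻¹)).measurableSet) hint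
    (fun t => by
      refine indicator_apply_le' (fun ht => ?_) fun _ => groundWeight_nonneg _
      rw [mem_closedBall_zero_iff] at ht
      simp [groundWeight, rampCost_eq_zero_of_norm_le ht])
  rw [integral_indicator_const _ Metric.isClosed_closedBall.measurableSet,
    volume_real_closedBall_zero (by positivity)] at h
  refine lt_of_lt_of_le ?_ h
  simp only [smul_eq_mul, mul_one]
  positivity

theorem tendsto_gibbsWeight (p : ℕ × UnitAddCircle) :
    Tendsto (fun ε => gibbsWeight ε p) (𝓝[>] 0) (𝓝 (groundWeight p)) := by
  rcases (rampCost_nonneg p).eq_or_lt with h | h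
  · simp [gibbsWeight, groundWeight, ← h]
  · have : groundWeight p = 0 := by simp [groundWeight, h.ne']
    rw [this]
    exact Real.tendsto_exp_atBot.comp
      (tendsto_inv_nhdsGT_zero.const_mul_atTop_of_neg (neg_lt_zero.2 h))

theorem tendsto_levelMass_gibbsWeight (n : ℕ) :
    Tendsto (fun ε => levelMass (gibbsWeight ε) n) (𝓝[>] 0) (𝓝 (levelMass groundWeight n)) := by
  refine tendsto_integral_filter_of_dominated_convergence (fun _ => 1) ?_ ?_
    (integrable_const _) (ae_of_all _ fun t => tendsto_gibbsWeight (n, t))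
  · exact Eventually.of_forall fun ε =>
      ((measurable_gibbsWeight ε).comp measurable_prodMk_left).aestronglyMeasurable
  · filter_upwards [self_mem_nhdsWithin] with ε hε
    refine ae_of_all _ fun t => ?_
    rw [Real.norm_eq_abs, abs_of_nonneg (gibbsWeight_nonneg ε _)]
    exact gibbsWeight_le_one hε _

theorem tendsto_levelDensity_gibbsWeight (p : ℕ × UnitAddCircle) :
    Tendsto (fun ε => levelDensity (gibbsWeight ε) p) (𝓝[>] 0)
      (𝓝 (levelDensity groundWeight p)) :=
  ENNReal.tendsto_ofReal ((tendsto_gibbsWeight p).div (tendsto_levelMass_gibbsWeight p.1)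
    (levelMass_groundWeight_pos p.1).ne')

theorem levelMass_gibbsWeight_le {ε : ℝ} (hε : 0 < ε) (n : ℕ) :
    levelMass (gibbsWeight ε) n ≤ Real.exp (-1 / ε) + 4 * (4 ^ n)⁻¹ := by
  have hball : MeasurableSet (Metric.closedBall (0 : UnitAddCircle) (2 * (4 ^ n)⁻¹)) :=
    Metric.isClosed_closedBall.measurableSet
  have h := integral_mono (integrable_gibbsWeight hε n)
    ((integrable_const (Real.exp (-1 / ε))).add ((integrable_const (1 : ℝ)).indicator hball))
    (fun t => by
      by_cases ht : t ∈ Metric.closedBall (0 : UnitAddCircle) (2 * (4 ^ n)⁻¹)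
      · simp only [Pi.add_apply, indicator_of_mem ht]
        linarith [gibbsWeight_le_one hε (n, t), Real.exp_pos (-1 / ε)]
      · simp only [Pi.add_apply, indicator_of_notMem ht, add_zero]
        rw [mem_closedBall_zero_iff, not_le] at ht
        rw [gibbsWeight, rampCost_eq_one_of_le_norm ht.le])
  rw [integral_add' (integrable_const _) ((integrable_const _).indicator hball),
    integral_indicator_const _ hball, volume_real_closedBall_zero (by positivity)] at h
  refine h.trans ?_
  simp only [integral_const, probReal_univ, smul_eq_mul, mul_one, one_mul]
  gcongr
  exact (min_le_right _ _).trans (by linarith)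

/-- Mass which the normalised Gibbs weight puts, at level `n`, on displacements of cost one. -/
theorem le_setLIntegral_levelDensity_gibbsWeight {ε : ℝ} (hε : 0 < ε) {n : ℕ} (hn : 2 ≤ n)
    (hexp : Real.exp (-1 / ε) = (4 ^ n)⁻¹) :
    ENNReal.ofReal (1 / 10) ≤
      ∫⁻ t in {t : UnitAddCircle | 1 ≤ rampCost (n, t)}, levelDensity (gibbsWeight ε) (n, t) := by
  have hball : MeasurableSet (Metric.closedBall (0 : UnitAddCircle) (2 * (4 ^ n)⁻¹)) :=
    Metric.isClosed_closedBall.measurableSet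
  have h4 : ((4 : ℝ) ^ n)⁻¹ ≤ 1 / 16 := by
    rw [one_div]
    gcongr
    calc (16 : ℝ) = 4 ^ 2 := by norm_num
      _ ≤ 4 ^ n := pow_le_pow_right₀ (by norm_num) hn
  have hpos4 : (0 : ℝ) < (4 ^ n)⁻¹ := by positivity
  have hsub : (Metric.closedBall (0 : UnitAddCircle) (2 * (4 ^ n)⁻¹))ᶜ ⊆
      {t : UnitAddCircle | 1 ≤ rampCost (n, t)} := by
    intro t ht
    rw [mem_compl_iff, mem_closedBall_zero_iff, not_le] at ht
    exact (rampCost_eq_one_of_le_norm ht.le).ge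
  refine le_trans ?_ (lintegral_mono_set hsub)
  have hlow : ∀ t : UnitAddCircle,
      ENNReal.ofReal (1 / 5) ≤ levelDensity (gibbsWeight ε) (n, t) := by
    intro t
    refine ENNReal.ofReal_le_ofReal ?_
    rw [le_div_iff₀ (levelMass_gibbsWeight_pos hε n)]
    have h1 := levelMass_gibbsWeight_le hε n
    have h2 := exp_le_gibbsWeight hε (n, t)
    rw [hexp] at h1 h2
    linarith
  have hvol : (volume : Measure UnitAddCircle) (Metric.closedBall 0 (2 * (4 ^ n)⁻¹))ᶜ =
      ENNReal.ofReal (1 - 4 * (4 ^ n)⁻¹) := by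
    rw [prob_compl_eq_one_sub hball, AddCircle.volume_closedBall, min_eq_right (by linarith),
      ENNReal.ofReal_sub _ (by positivity), ENNReal.ofReal_one]
    ring_nf
  calc ENNReal.ofReal (1 / 10)
      ≤ ENNReal.ofReal (1 / 5) * ENNReal.ofReal (1 - 4 * (4 ^ n)⁻¹) := by
        rw [← ENNReal.ofReal_mul (by norm_num)]
        exact ENNReal.ofReal_le_ofReal (by linarith)
    _ = ∫⁻ _ in (Metric.closedBall (0 : UnitAddCircle) (2 * (4 ^ n)⁻¹))ᶜ,
          ENNReal.ofReal (1 / 5) := by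
        rw [setLIntegral_const, hvol]
    _ ≤ _ := lintegral_mono fun t => hlow t

/-- The level of the first point of a pair, and the displacement between the two points. -/
def displacement {Z : Type*} (ψ : Z → ℕ × UnitAddCircle) (z : Z × Z) : ℕ × UnitAddCircle :=
  ((ψ z.1).1, (ψ z.1).2 - (ψ z.2).2)

/-- The plan whose density with respect to `μ ⊗ μ` is the normalised weight `g`, evaluated at the
displacement. -/
def levelPlan {Z : Type*} [MeasurableSpace Z] (μ : Measure Z) (ψ : Z → ℕ × UnitAddCircle)
    (g : ℕ × UnitAddCircle → ℝ) : Measure (Z × Z) :=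
  (μ.prod μ).withDensity fun z => levelDensity g (displacement ψ z)

section LevelPlan

variable {Z : Type*} [MeasurableSpace Z] {μ : Measure Z}
  {ψ : Z → ℕ × UnitAddCircle} {γ : Measure ℕ} [IsProbabilityMeasure γ]

theorem measurable_displacement (hψm : Measurable ψ) : Measurable (displacement ψ) := by
  unfold displacement
  fun_prop

theorem lintegral_displacement_right (hψm : Measurable ψ) (hψ : μ.map ψ = γ.prod volume)
    {h : ℕ × UnitAddCircle → ℝ≥0∞} (hh : Measurable h) (x : Z) :
    ∫⁻ y, h (displacement ψ (x, y)) ∂μ = ∫⁻ t : UnitAddCircle, h ((ψ x).1, t) := by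
  have hm : Measurable fun p : ℕ × UnitAddCircle => h ((ψ x).1, (ψ x).2 - p.2) := by fun_prop
  change ∫⁻ y, (fun p : ℕ × UnitAddCircle => h ((ψ x).1, (ψ x).2 - p.2)) (ψ y) ∂μ = _
  rw [← lintegral_map hm hψm, hψ, lintegral_prod _ hm.aemeasurable]
  simp only [lintegral_const, measure_univ, mul_one]
  exact lintegral_sub_left_eq_self (fun t => h ((ψ x).1, t)) _

theorem lintegral_displacement_left (hψm : Measurable ψ) (hψ : μ.map ψ = γ.prod volume)
    {h : ℕ × UnitAddCircle → ℝ≥0∞} (hh : Measurable h)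
    (h1 : ∀ n, ∫⁻ t : UnitAddCircle, h (n, t) = 1) (y : Z) :
    ∫⁻ x, h (displacement ψ (x, y)) ∂μ = 1 := by
  have hm : Measurable fun p : ℕ × UnitAddCircle => h (p.1, p.2 - (ψ y).2) := by fun_prop
  change ∫⁻ x, (fun p : ℕ × UnitAddCircle => h (p.1, p.2 - (ψ y).2)) (ψ x) ∂μ = _
  rw [← lintegral_map hm hψm, hψ, lintegral_prod _ hm.aemeasurable]
  have : ∀ n, ∫⁻ t : UnitAddCircle, h (n, t - (ψ y).2) = 1 := fun n =>
    (lintegral_sub_right_eq_self (fun t => h (n, t)) _).trans (h1 n)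
  simp [this]

theorem lintegral_rampCost_levelPlan_groundWeight (hψm : Measurable ψ) :
    ∫⁻ z, ENNReal.ofReal (rampCost (displacement ψ z)) ∂(levelPlan μ ψ groundWeight) = 0 := by
  have hd := measurable_displacement hψm
  have h1 : Measurable fun z : Z × Z => levelDensity groundWeight (displacement ψ z) :=
    (measurable_levelDensity measurable_groundWeight).comp hd
  have h2 : Measurable fun z : Z × Z => ENNReal.ofReal (rampCost (displacement ψ z)) :=
    (continuous_rampCost.measurable.comp hd).ennreal_ofReal
  rw [levelPlan, lintegral_withDensity_eq_lintegral_mul _ h1 h2]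
  refine (lintegral_congr fun z => ?_).trans lintegral_zero
  by_cases h : rampCost (displacement ψ z) = 0
  · simp [h]
  · simp [levelDensity, groundWeight, h]

variable [IsProbabilityMeasure μ]

theorem levelPlan_mem_couplings (hψm : Measurable ψ) (hψ : μ.map ψ = γ.prod volume)
    {g : ℕ × UnitAddCircle → ℝ} (hg : Measurable g) (hg0 : ∀ p, 0 ≤ g p) (hg1 : ∀ p, g p ≤ 1)
    (hpos : ∀ n, 0 < levelMass g n) : levelPlan μ ψ g ∈ couplings μ μ := by
  have hd := measurable_levelDensity hg
  refine mem_couplings_withDensity (hd.comp (measurable_displacement hψm)) (fun x => ?_)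
    fun y => ?_
  · rw [lintegral_displacement_right hψm hψ hd]
    exact lintegral_levelDensity hg hg0 hg1 (hpos _)
  · exact lintegral_displacement_left hψm hψ hd
      (fun n => lintegral_levelDensity hg hg0 hg1 (hpos n)) y

theorem levelPlan_gibbsWeight_mem_couplings (hψm : Measurable ψ)
    (hψ : μ.map ψ = γ.prod volume) {ε : ℝ} (hε : 0 < ε) :
    levelPlan μ ψ (gibbsWeight ε) ∈ couplings μ μ :=
  levelPlan_mem_couplings hψm hψ (measurable_gibbsWeight ε) (gibbsWeight_nonneg ε)
    (gibbsWeight_le_one hε) (levelMass_gibbsWeight_pos hε)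

theorem levelPlan_groundWeight_mem_couplings (hψm : Measurable ψ)
    (hψ : μ.map ψ = γ.prod volume) : levelPlan μ ψ groundWeight ∈ couplings μ μ :=
  levelPlan_mem_couplings hψm hψ measurable_groundWeight groundWeight_nonneg
    groundWeight_le_one levelMass_groundWeight_pos

theorem levelPlan_gibbsWeight_isUniqueMin (hψm : Measurable ψ)
    (hψ : μ.map ψ = γ.prod volume) {ε : ℝ} (hε : 0 < ε) :
    (∀ Q ∈ couplings μ μ,
      Jfun (fun z => rampCost (displacement ψ z)) (μ.prod μ) ε (levelPlan μ ψ (gibbsWeight ε)) ≤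
        Jfun (fun z => rampCost (displacement ψ z)) (μ.prod μ) ε Q) ∧
      ∀ Q ∈ couplings μ μ,
        (∀ R ∈ couplings μ μ,
          Jfun (fun z => rampCost (displacement ψ z)) (μ.prod μ) ε Q ≤
            Jfun (fun z => rampCost (displacement ψ z)) (μ.prod μ) ε R) →
        Q = levelPlan μ ψ (gibbsWeight ε) := by
  have hmem := levelPlan_gibbsWeight_mem_couplings hψm hψ hε
  have hC : Measurable fun z : Z × Z => rampCost (displacement ψ z) :=
    continuous_rampCost.measurable.comp (measurable_displacement hψm)
  have ha : Measurable fun x : Z => Real.log (levelMass (gibbsWeight ε) (ψ x).1) :=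
    (measurable_of_countable fun n => Real.log (levelMass (gibbsWeight ε) n)).comp
      (measurable_fst.comp hψm)
  have hexp : ∀ z : Z × Z, Real.exp (-rampCost (displacement ψ z) / ε -
      Real.log (levelMass (gibbsWeight ε) (ψ z.1).1)) =
      gibbsWeight ε (displacement ψ z) / levelMass (gibbsWeight ε) (displacement ψ z).1 := by
    intro z
    rw [Real.exp_sub, Real.exp_log (levelMass_gibbsWeight_pos hε _)]
    rfl
  have hone : ∫ z, Real.exp (-rampCost (displacement ψ z) / ε -
      Real.log (levelMass (gibbsWeight ε) (ψ z.1).1)) ∂(μ.prod μ) = 1 := by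
    have hm : Measurable fun z : Z × Z => Real.exp (-rampCost (displacement ψ z) / ε -
        Real.log (levelMass (gibbsWeight ε) (ψ z.1).1)) :=
      ((hC.neg.div_const ε).sub (ha.comp measurable_fst)).exp
    rw [integral_eq_lintegral_of_nonneg_ae (ae_of_all _ fun z => (Real.exp_pos _).le)
      hm.aestronglyMeasurable]
    simp only [hexp]
    have hu := hmem.1.measure_univ
    rw [levelPlan, withDensity_apply _ MeasurableSet.univ, Measure.restrict_univ] at hu
    simp only [levelDensity] at hu
    rw [hu, ENNReal.toReal_one]
  refine tilted_isUniqueMin_Jfun hC (fun z => rampCost_nonneg _) (fun z => rampCost_le_one _) ha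
    (fun x => abs_log_levelMass_gibbsWeight_le hε _) hε hone ?_ hmem
  rw [Measure.tilted, hone]
  simp only [hexp, div_one]
  rfl

theorem tendsto_TVdist_levelPlan (hψm : Measurable ψ) (hψ : μ.map ψ = γ.prod volume) :
    Tendsto (fun ε => TVdist (levelPlan μ ψ (gibbsWeight ε)) (levelPlan μ ψ groundWeight))
      (𝓝[>] 0) (𝓝 0) := by
  have hmem := levelPlan_groundWeight_mem_couplings hψm hψ
  have hm : ∀ {g : ℕ × UnitAddCircle → ℝ}, Measurable g →
      Measurable fun z : Z × Z => levelDensity g (displacement ψ z) := fun hg =>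
    (measurable_levelDensity hg).comp (measurable_displacement hψm)
  have hfin : ∫⁻ z, levelDensity groundWeight (displacement ψ z) ∂(μ.prod μ) = 1 := by
    have hu := hmem.1.measure_univ
    rwa [levelPlan, withDensity_apply _ MeasurableSet.univ, Measure.restrict_univ] at hu
  have hlim : Tendsto (fun ε => ∫⁻ z, (levelDensity groundWeight (displacement ψ z) -
      levelDensity (gibbsWeight ε) (displacement ψ z)) ∂(μ.prod μ)) (𝓝[>] 0)
      (𝓝 (∫⁻ _, 0 ∂(μ.prod μ))) := by
    refine tendsto_lintegral_filter_of_dominated_convergence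
      (fun z => levelDensity groundWeight (displacement ψ z))
      (Eventually.of_forall fun ε =>
        (hm measurable_groundWeight).sub (hm (measurable_gibbsWeight ε)))
      (Eventually.of_forall fun ε => ae_of_all _ fun z => tsub_le_self)
      (by rw [hfin]; exact ENNReal.one_ne_top) (ae_of_all _ fun z => ?_)
    have h := ENNReal.Tendsto.sub (tendsto_const_nhds (f := 𝓝[>] (0 : ℝ))
      (x := levelDensity groundWeight (displacement ψ z)))
      (tendsto_levelDensity_gibbsWeight (displacement ψ z)) (Or.inl ENNReal.ofReal_ne_top)
    rwa [tsub_self] at h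
  rw [lintegral_zero] at hlim
  refine tendsto_of_tendsto_of_tendsto_of_le_of_le' tendsto_const_nhds hlim
    (Eventually.of_forall fun ε => zero_le) ?_
  filter_upwards [self_mem_nhdsWithin] with ε hε
  have h1 : IsProbabilityMeasure ((μ.prod μ).withDensity fun z =>
      levelDensity groundWeight (displacement ψ z)) := hmem.1
  have h2 : IsProbabilityMeasure ((μ.prod μ).withDensity fun z =>
      levelDensity (gibbsWeight ε) (displacement ψ z)) :=
    (levelPlan_gibbsWeight_mem_couplings hψm hψ hε).1
  exact TVdist_le_lintegral_sub (hm (measurable_gibbsWeight ε))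

theorem le_levelPlan_gibbsWeight (hψm : Measurable ψ) (hψ : μ.map ψ = γ.prod volume)
    {ε : ℝ} (hε : 0 < ε) {n : ℕ} (hn : 2 ≤ n) (hexp : Real.exp (-1 / ε) = (4 ^ n)⁻¹) :
    ENNReal.ofReal (1 / 10) * γ {n} ≤
      levelPlan μ ψ (gibbsWeight ε) {z | 1 ≤ rampCost (displacement ψ z)} := by
  have hE : MeasurableSet {p : ℕ × UnitAddCircle | 1 ≤ rampCost p} :=
    measurableSet_le measurable_const continuous_rampCost.measurable
  set h : ℕ × UnitAddCircle → ℝ≥0∞ :=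
    {p | 1 ≤ rampCost p}.indicator (levelDensity (gibbsWeight ε))
  have hh : Measurable h := (measurable_levelDensity (measurable_gibbsWeight ε)).indicator hE
  have hF : MeasurableSet {z : Z × Z | 1 ≤ rampCost (displacement ψ z)} :=
    measurable_displacement hψm hE
  have hHm : Measurable fun p : ℕ × UnitAddCircle => ∫⁻ t : UnitAddCircle, h (p.1, t) :=
    (measurable_of_countable fun n => ∫⁻ t : UnitAddCircle, h (n, t)).comp measurable_fst
  have heq : levelPlan μ ψ (gibbsWeight ε) {z | 1 ≤ rampCost (displacement ψ z)} =
      ∫⁻ n, (∫⁻ t : UnitAddCircle, h (n, t)) ∂γ := by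
    rw [levelPlan, withDensity_apply _ hF, ← lintegral_indicator hF]
    change ∫⁻ z, h (displacement ψ z) ∂(μ.prod μ) = _
    have hm : Measurable fun z : Z × Z => h (displacement ψ z) :=
      hh.comp (measurable_displacement hψm)
    rw [lintegral_prod _ hm.aemeasurable]
    simp only [lintegral_displacement_right hψm hψ hh]
    rw [← lintegral_map hHm hψm, hψ, lintegral_prod _ hHm.aemeasurable]
    simp
  have hn' : ENNReal.ofReal (1 / 10) ≤ ∫⁻ t : UnitAddCircle, h (n, t) := by
    refine (le_setLIntegral_levelDensity_gibbsWeight hε hn hexp).trans (le_of_eq ?_)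
    have hEn : MeasurableSet {t : UnitAddCircle | 1 ≤ rampCost (n, t)} :=
      measurable_prodMk_left hE
    rw [← lintegral_indicator hEn]
    rfl
  rw [heq]
  calc ENNReal.ofReal (1 / 10) * γ {n}
      ≤ (∫⁻ t : UnitAddCircle, h (n, t)) * γ {n} := by gcongr
    _ = ∫⁻ m in {n}, (∫⁻ t : UnitAddCircle, h (m, t)) ∂γ := by rw [lintegral_singleton]
    _ ≤ _ := setLIntegral_le_lintegral _ _

theorem le_elog {x : ℝ≥0∞} (hx : x ≠ ⊤) {r : ℝ} (hr : 0 < r) (h : ENNReal.ofReal r ≤ x) :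
    ((Real.log r : ℝ) : EReal) ≤ elog x := by
  have hx0 : x ≠ 0 := ((ENNReal.ofReal_pos.2 hr).trans_le h).ne'
  rw [elog, if_neg hx0, if_neg hx, EReal.coe_le_coe_iff]
  exact Real.log_le_log hr ((ENNReal.ofReal_le_iff_le_toReal hx).1 h)

theorem le_limsupLog_levelPlan (hψm : Measurable ψ) (hψ : μ.map ψ = γ.prod volume)
    (hγ : ∀ n, γ {n} = ENNReal.ofReal ((1 / 2) ^ (n + 1))) :
    ((-(3 / 4) : ℝ) : EReal) ≤ limsupLog (fun ε => levelPlan μ ψ (gibbsWeight ε))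
      {z | 1 ≤ rampCost (displacement ψ z)} := by
  have hlog2 : 0 < Real.log 2 := Real.log_pos one_lt_two
  have hlim : Tendsto (fun N : ℕ => ((N : ℝ) * (2 * Real.log 2))⁻¹) atTop (𝓝[>] 0) :=
    tendsto_inv_atTop_nhdsGT_zero.comp
      (tendsto_natCast_atTop_atTop.atTop_mul_const (by positivity))
  refine le_limsup_of_frequently_le (hlim.frequently (Eventually.frequently ?_))
  filter_upwards [eventually_ge_atTop 10] with N hN
  have hN' : (10 : ℝ) ≤ N := by exact_mod_cast hN
  set ε : ℝ := ((N : ℝ) * (2 * Real.log 2))⁻¹ with hεdef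
  have hε : 0 < ε := by positivity
  have hexp : Real.exp (-1 / ε) = (4 ^ N)⁻¹ := by
    rw [hεdef, div_inv_eq_mul, neg_one_mul, Real.exp_neg, Real.exp_nat_mul, two_mul,
      Real.exp_add, Real.exp_log two_pos]
    norm_num
  have hmass := le_levelPlan_gibbsWeight hψm hψ hε (by omega) hexp
  rw [hγ, ← ENNReal.ofReal_mul (by norm_num)] at hmass
  have hprob := (levelPlan_gibbsWeight_mem_couplings hψm hψ hε).1
  have hlog := le_elog (measure_ne_top _ _) (by positivity) hmass
  refine le_trans ?_ (mul_le_mul_of_nonneg_left hlog (EReal.coe_nonneg.2 hε.le))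
  rw [← EReal.coe_mul, EReal.coe_le_coe_iff]
  have h20 : Real.log 20 ≤ 5 * Real.log 2 := by
    rw [← Real.log_rpow two_pos]
    exact Real.log_le_log (by norm_num) (by norm_num)
  have hval : Real.log (1 / 10 * (1 / 2) ^ (N + 1)) = -Real.log 20 - N * Real.log 2 := by
    have : (1 / 10 * (1 / 2) ^ (N + 1) : ℝ) = (20 * 2 ^ N)⁻¹ := by
      rw [one_div_pow]
      field_simp
      ring
    rw [this, Real.log_inv, Real.log_mul (by norm_num) (by positivity), Real.log_pow]
    ring
  rw [hval, hεdef, inv_mul_eq_div, le_div_iff₀ (by positivity)]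
  nlinarith

end LevelPlan

theorem not_isCompact_of_nat_image {W : Type*} [TopologicalSpace W] {K : Set W} {f : W → ℕ}
    (hf : Continuous f) (h : ∀ n, 1 ≤ n → ∃ w ∈ K, f w = n) : ¬ IsCompact K := by
  intro hK
  obtain ⟨b, hb⟩ := (isCompact_iff_finite.1 (hK.image hf)).bddAbove
  obtain ⟨w, hw, hwb⟩ := h (b + 1) (by omega)
  have := hb (mem_image_of_mem f hw)
  omega

theorem continuous_displacement {Z : Type*} [TopologicalSpace Z] {ψ : Z → ℕ × UnitAddCircle}
    (hψc : Continuous ψ) : Continuous (displacement ψ) := by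
  unfold displacement
  fun_prop

theorem mem_msupport_levelPlan_groundWeight {Z : Type*} [TopologicalSpace Z]
    [SecondCountableTopology Z] [MeasurableSpace Z] [BorelSpace Z] {μ : Measure Z}
    [IsProbabilityMeasure μ] [μ.IsOpenPosMeasure] {ψ : Z → ℕ × UnitAddCircle}
    (hψc : Continuous ψ) {z : Z × Z} (hz : (ψ z.1).1 = 0) :
    z ∈ msupport (levelPlan μ ψ groundWeight) := by
  intro U hU hzU
  have hV : IsOpen (U ∩ (fun w : Z × Z => (ψ w.1).1) ⁻¹' {0}) :=
    hU.inter ((isOpen_discrete {0}).preimage (by fun_prop))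
  have hVpos : 0 < μ.prod μ (U ∩ (fun w : Z × Z => (ψ w.1).1) ⁻¹' {0}) :=
    hV.measure_pos _ ⟨z, hzU, hz⟩
  refine lt_of_lt_of_le ?_ (measure_mono
    (inter_subset_left (t := (fun w : Z × Z => (ψ w.1).1) ⁻¹' {0})))
  rw [levelPlan, withDensity_apply _ hV.measurableSet]
  have hconst : ∀ w ∈ U ∩ (fun w : Z × Z => (ψ w.1).1) ⁻¹' {0},
      levelDensity groundWeight (displacement ψ w) =
        ENNReal.ofReal (1 / levelMass groundWeight 0) := by
    rintro w ⟨-, hw⟩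
    have hw' : (ψ w.1).1 = 0 := hw
    simp [levelDensity, displacement, hw', groundWeight, rampCost_zero_level]
  rw [setLIntegral_congr_fun hV.measurableSet hconst, setLIntegral_const]
  have := levelMass_groundWeight_pos 0
  exact ENNReal.mul_pos (ENNReal.ofReal_pos.2 (by positivity)).ne' hVpos.ne'

theorem one_le_BGNrate {Z : Type*} {ψ : Z → ℕ × UnitAddCircle} {Γ : Set (Z × Z)} {x₀ : Z}
    (hx₀ : (ψ x₀).1 = 0) (hΓ : ∀ y, (x₀, y) ∈ Γ) {p : Z × Z}
    (hp : 1 ≤ rampCost (displacement ψ p)) :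
    (1 : EReal) ≤ BGNrate (fun z => rampCost (displacement ψ z)) Γ p := by
  unfold BGNrate
  refine le_iSup_of_le 0 (le_iSup_of_le ![p, (x₀, p.1)] (le_iSup_of_le rfl
    (le_iSup_of_le ?_ (le_iSup_of_le (Equiv.swap 0 1) ?_))))
  · intro i hi
    fin_cases i
    · exact absurd rfl hi
    · exact hΓ p.1
  · have h0 : ∀ t, rampCost ((ψ x₀).1, t) = 0 := fun t => by rw [hx₀, rampCost_zero_level]
    have hd : rampCost ((ψ p.1).1, 0) = 0 :=
      rampCost_eq_zero_of_norm_le (by rw [norm_zero]; positivity)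
    rw [← EReal.coe_one, EReal.coe_le_coe_iff]
    simpa [displacement, h0, hd] using hp

/-- The embedding of countably many disjoint unit intervals in the real line. -/
def levelEmbedding (p : ℕ × unitInterval) : ℝ := 2 * (p.1 : ℝ) + p.2

theorem isClosedEmbedding_levelEmbedding : IsClosedEmbedding levelEmbedding := by
  have hanti : AntilipschitzWith 1 levelEmbedding := by
    refine AntilipschitzWith.of_le_mul_dist fun ⟨n, s, hs⟩ ⟨m, t, ht⟩ => ?_
    rw [Prod.dist_eq, Nat.dist_eq, Subtype.dist_eq, Real.dist_eq, Real.dist_eq, NNReal.coe_one,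
      one_mul]
    simp only [levelEmbedding]
    rcases lt_trichotomy n m with h | rfl | h
    · have h' : (n : ℝ) + 1 ≤ m := by exact_mod_cast h
      rw [abs_of_nonpos (by linarith : (n : ℝ) - m ≤ 0)]
      refine max_le ?_ ?_ <;> refine le_trans ?_ (neg_le_abs _)
      · linarith [hs.1, hs.2, ht.1, ht.2]
      · refine abs_le.2 ⟨?_, ?_⟩ <;> linarith [hs.1, hs.2, ht.1, ht.2]
    · simp
    · have h' : (m : ℝ) + 1 ≤ n := by exact_mod_cast h
      rw [abs_of_nonneg (by linarith : (0 : ℝ) ≤ n - m)]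
      refine max_le ?_ ?_ <;> refine le_trans ?_ (le_abs_self _)
      · linarith [hs.1, hs.2, ht.1, ht.2]
      · refine abs_le.2 ⟨?_, ?_⟩ <;> linarith [hs.1, hs.2, ht.1, ht.2]
  refine hanti.isClosedEmbedding ?_
  have hcast : UniformContinuous fun n : ℕ => 2 * (n : ℝ) :=
    DiscreteUniformity.uniformContinuous _ _
  exact (hcast.comp uniformContinuous_fst).add
    (uniformContinuous_subtype_val.comp uniformContinuous_snd)

instance isOpenPosMeasure_volume_unitInterval :
    (volume : Measure unitInterval).IsOpenPosMeasure := by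
  refine ⟨fun U hU hne => ?_⟩
  obtain ⟨a, b, hab, hsub⟩ := hU.exists_Ioo_subset hne
  have : 0 < volume (Ioo a b) := by
    rw [unitInterval.volume_Ioo]
    exact ENNReal.ofReal_pos.2 (sub_pos.2 hab)
  exact (this.trans_le (measure_mono hsub)).ne'

theorem measurePreserving_coe_unitInterval :
    MeasurePreserving (fun t : unitInterval => ((t : ℝ) : UnitAddCircle)) volume volume := by
  have h := UnitAddCircle.measurePreserving_mk 0
  rw [zero_add, restrict_Ioc_eq_restrict_Icc] at h
  exact h.comp unitInterval.measurePreserving_coe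

theorem exists_geometric_levels : ∃ γ : Measure ℕ, IsProbabilityMeasure γ ∧
    ∀ n, γ {n} = ENNReal.ofReal ((1 / 2) ^ (n + 1)) := by
  have hp : (⟨1 / 2, by norm_num, by norm_num⟩ : unitInterval) ≠ 0 := by
    simp [Subtype.ext_iff]
  refine ⟨ProbabilityTheory.geometricMeasure ⟨1 / 2, by norm_num, by norm_num⟩, inferInstance,
    fun n => ?_⟩
  rw [ProbabilityTheory.geometricMeasure_singleton hp, pow_succ]
  norm_num

/-- A closed set of reals, with a nonatomic measure of full support, which is a model of countably
many circles carrying geometrically decaying masses. -/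
theorem exists_levels : ∃ S : Set ℝ, IsClosed S ∧ ∃ (μ : Measure S) (ψ : S → ℕ × UnitAddCircle)
    (γ : Measure ℕ), IsProbabilityMeasure μ ∧ (∀ x, μ {x} = 0) ∧ μ.IsOpenPosMeasure ∧
      Continuous ψ ∧ (∀ n, ∃ x, ψ x = (n, 0)) ∧
      (∀ n, ∃ x, ψ x = (n, ((1 / 2 : ℝ) : UnitAddCircle))) ∧ IsProbabilityMeasure γ ∧
      μ.map ψ = γ.prod volume ∧ ∀ n, γ {n} = ENNReal.ofReal ((1 / 2) ^ (n + 1)) := by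
  obtain ⟨γ, hγp, hγ⟩ := exists_geometric_levels
  have hγo : γ.IsOpenPosMeasure := by
    refine ⟨fun U _ ⟨n, hn⟩ => ?_⟩
    have : 0 < γ {n} := by
      rw [hγ]
      exact ENNReal.ofReal_pos.2 (by positivity)
    exact (this.trans_le (measure_mono (singleton_subset_iff.2 hn))).ne'
  let e : ℕ × unitInterval ≃ₜ range levelEmbedding :=
    isClosedEmbedding_levelEmbedding.isEmbedding.toHomeomorph
  have hem : Measurable e := e.continuous.measurable
  have hq : MeasurePreserving
      (Prod.map id fun t : unitInterval => ((t : ℝ) : UnitAddCircle))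
      (γ.prod volume) (γ.prod volume) :=
    (MeasurePreserving.id γ).prod measurePreserving_coe_unitInterval
  have hqc : Continuous
      (Prod.map (id : ℕ → ℕ) fun t : unitInterval => ((t : ℝ) : UnitAddCircle)) :=
    continuous_id.prodMap ((AddCircle.continuous_mk' 1).comp continuous_subtype_val)
  have hψc := hqc.comp e.symm.continuous
  refine ⟨range levelEmbedding, isClosedEmbedding_levelEmbedding.isClosed_range,
    (γ.prod volume).map e, _, γ, Measure.isProbabilityMeasure_map hem.aemeasurable,
    fun x => ?_, e.continuous.isOpenPosMeasure_map e.surjective, hψc, fun n => ⟨e (n, 0), ?_⟩,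
    fun n => ⟨e (n, ⟨1 / 2, by norm_num, by norm_num⟩), ?_⟩, hγp, ?_, hγ⟩
  · rw [Measure.map_apply hem (measurableSet_singleton x)]
    have : e ⁻¹' {x} = {e.symm x} := by
      ext p
      simp [Homeomorph.eq_symm_apply]
    rw [this, measure_singleton]
  · simp
  · simp
  · rw [Measure.map_map hψc.measurable hem]
    convert hq.map_eq using 2
    ext1 p
    simp

/-- **A nonatomic counterexample to the closed-set upper bound** (Theorem 1.1): there exist
a closed set `X ⊆ ℝ`, a nonatomic Borel probability measure `μ` on `X`, and a continuous
nonnegative cost `C : X × X → [0,∞)` such that for every `ε > 0` the entropic functional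
`J_ε` has a unique minimiser `P_ε ∈ Π(μ,μ)`, and: (i) `P_ε → P^*` in total variation for an
optimal transport plan `P^*` with noncompact support `Γ = supp(P^*)`; (ii) there is a
closed noncompact `F ⊆ X × X` with `inf_F I_Γ > 0` but
`limsup_{ε↓0} ε log P_ε(F) > −inf_F I_Γ`. -/
theorem nonatomic_counterexample_to_closed_set_upper_bound :
    ∃ S : Set ℝ, IsClosed S ∧
    ∃ (μ : Measure S) (C : S × S → ℝ) (P : ℝ → Measure (S × S))
      (Pstar : Measure (S × S)),
      IsProbabilityMeasure μ ∧ (∀ x : S, μ {x} = 0) ∧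
      Continuous C ∧ (∀ p, 0 ≤ C p) ∧
      (∀ ε : ℝ, 0 < ε →
        P ε ∈ couplings μ μ ∧
        (∀ Q ∈ couplings μ μ,
          Jfun C (μ.prod μ) ε (P ε) ≤ Jfun C (μ.prod μ) ε Q) ∧
        (∀ Q ∈ couplings μ μ,
          (∀ R ∈ couplings μ μ,
            Jfun C (μ.prod μ) ε Q ≤ Jfun C (μ.prod μ) ε R) → Q = P ε)) ∧
      -- (i) total variation convergence to an optimal plan with noncompact support
      Pstar ∈ couplings μ μ ∧
      (∀ Q ∈ couplings μ μ,
        (∫⁻ p, ENNReal.ofReal (C p) ∂Pstar) ≤ ∫⁻ p, ENNReal.ofReal (C p) ∂Q) ∧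
      Tendsto (fun ε : ℝ => TVdist (P ε) Pstar) (𝓝[>] (0 : ℝ)) (𝓝 0) ∧
      ¬ IsCompact (msupport Pstar) ∧
      -- (ii) failure of the closed-set upper bound on a closed noncompact set
      ∃ F : Set (S × S), IsClosed F ∧ ¬ IsCompact F ∧
        (0 : EReal) < (⨅ p ∈ F, BGNrate C (msupport Pstar) p) ∧
        -(⨅ p ∈ F, BGNrate C (msupport Pstar) p) < limsupLog P F := by
  obtain ⟨S, hS, μ, ψ, γ, hμ, hatom, hopen, hψc, hzero, hhalf, hγp, hψ, hγ⟩ := exists_levels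
  have hψm := hψc.measurable
  have hC : Continuous fun z : S × S => rampCost (displacement ψ z) :=
    continuous_rampCost.comp (continuous_displacement hψc)
  obtain ⟨x₀, hx₀⟩ := hzero 0
  have hΓ : ∀ y, (x₀, y) ∈ msupport (levelPlan μ ψ groundWeight) := fun y =>
    mem_msupport_levelPlan_groundWeight hψc (by rw [hx₀])
  refine ⟨S, hS, μ, fun z => rampCost (displacement ψ z),
    fun ε => levelPlan μ ψ (gibbsWeight ε), levelPlan μ ψ groundWeight, hμ, hatom, hC,
    fun z => rampCost_nonneg _,
    fun ε hε => ⟨levelPlan_gibbsWeight_mem_couplings hψm hψ hε,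
      levelPlan_gibbsWeight_isUniqueMin hψm hψ hε⟩,
    levelPlan_groundWeight_mem_couplings hψm hψ, fun Q _ => ?_,
    tendsto_TVdist_levelPlan hψm hψ, ?_, {z | 1 ≤ rampCost (displacement ψ z)},
    isClosed_le continuous_const hC, ?_, ?_⟩
  · rw [lintegral_rampCost_levelPlan_groundWeight hψm]
    exact zero_le
  · refine not_isCompact_of_nat_image (f := fun z : S × S => (ψ z.2).1) (by fun_prop)
      fun n _ => ?_
    obtain ⟨y, hy⟩ := hzero n
    exact ⟨(x₀, y), hΓ y, by simp only [hy]⟩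
  · refine not_isCompact_of_nat_image (f := fun z : S × S => (ψ z.1).1) (by fun_prop)
      fun n hn => ?_
    obtain ⟨x, hx⟩ := hhalf n
    obtain ⟨y, hy⟩ := hzero n
    refine ⟨(x, y), ?_, by simp only [hx]⟩
    have h4 : ((4 : ℝ) ^ n)⁻¹ ≤ 4⁻¹ := by
      gcongr
      exact le_self_pow₀ (by norm_num) (by omega)
    have hnorm : ‖((1 / 2 : ℝ) : UnitAddCircle)‖ = 1 / 2 := by
      simpa using AddCircle.norm_half_period_eq 1
    change 1 ≤ rampCost (displacement ψ (x, y))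
    simp only [displacement, hx, hy, sub_zero]
    exact (rampCost_eq_one_of_le_norm (by rw [hnorm]; linarith)).ge
  · have hI : (1 : EReal) ≤ ⨅ p ∈ {z | 1 ≤ rampCost (displacement ψ z)},
        BGNrate (fun z => rampCost (displacement ψ z))
          (msupport (levelPlan μ ψ groundWeight)) p :=
      le_iInf₂ fun p hp => one_le_BGNrate (by rw [hx₀]) hΓ hp
    refine ⟨zero_lt_one.trans_le hI, (EReal.neg_le_neg_iff.2 hI).trans_lt
      (lt_of_lt_of_le ?_ (le_limsupLog_levelPlan hψm hψ hγ))⟩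
    rw [← EReal.coe_one, ← EReal.coe_neg, EReal.coe_lt_coe_iff]
    norm_num

end
end

section
/- There exist a closed subset X of the real line, a nonatomic Borel probability measure μ on X, and a continuous cost C : X × X → [0,∞) such that for every ε > 0 the entropic functional J_ε admits a unique minimiser P_ε ∈ Π(μ,μ), P_ε converges in total variation to an optimal transport plan with noncompact support, and there exists NO lower semicontinuous function I : X × X → [0,∞] such that (P_ε)_{ε>0} satisfies a full large deviation principle on X × X at speed 1/ε with rate I, i.e., such that limsup_{ε↓0} ε log P_ε(C') ≤ −inf_{C'} I for every closed set C' ⊆ X × X and liminf_{ε↓0} ε log P_ε(O) ≥ −inf_O I for every open set O ⊆ X × X. -/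
open MeasureTheory Filter Set Topology
open scoped ENNReal NNReal Classical

noncomputable section

/-- `liminf_{ε ↓ 0} ε ⬝ log Q_ε(S)`. -/
def liminfLog {Z : Type*} [MeasurableSpace Z] (Q : ℝ → Measure Z) (S : Set Z) : EReal :=
  liminf (fun ε : ℝ => (ε : EReal) * elog (Q ε S)) (𝓝[>] (0 : ℝ))

/-- Slowly decaying probability weights on `ℕ`. -/
lemma exists_weights : ∃ w : ℕ → ℝ, (∀ n, 0 < w n) ∧ HasSum w 1 ∧
    ∃ c : ℝ, 0 < c ∧ ∀ M n : ℕ, n < M ^ 8 → c ^ 2 ≤ w n * (M : ℝ) ^ 10 := by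
  have hs : Summable fun n : ℕ => 1 / ((n + 1 : ℕ) : ℝ) ^ (5 / 4 : ℝ) :=
    (summable_nat_add_iff 1).2 (Real.summable_one_div_nat_rpow.2 (by norm_num))
  set Z := ∑' n : ℕ, 1 / ((n + 1 : ℕ) : ℝ) ^ (5 / 4 : ℝ) with hZ
  have hpos : ∀ n : ℕ, 0 < 1 / ((n + 1 : ℕ) : ℝ) ^ (5 / 4 : ℝ) := fun n => by positivity
  have hZpos : 0 < Z := hs.tsum_pos (fun n => (hpos n).le) 0 (hpos 0)
  refine ⟨fun n => 1 / ((n + 1 : ℕ) : ℝ) ^ (5 / 4 : ℝ) / Z, fun n => div_pos (hpos n) hZpos, ?_,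
    √(1 / Z), by positivity, fun M n hn => ?_⟩
  · have := hs.hasSum.div_const Z
    rwa [← hZ, div_self hZpos.ne'] at this
  · have h1 : ((n + 1 : ℕ) : ℝ) ^ (5 / 4 : ℝ) ≤ (M : ℝ) ^ 10 := by
      have h2 : ((n + 1 : ℕ) : ℝ) ≤ (M : ℝ) ^ (8 : ℝ) := by
        have : n + 1 ≤ M ^ 8 := hn
        have : ((n + 1 : ℕ) : ℝ) ≤ ((M ^ 8 : ℕ) : ℝ) := by exact_mod_cast this
        refine this.trans (le_of_eq ?_)
        rw [show (8 : ℝ) = ((8 : ℕ) : ℝ) by norm_num, Real.rpow_natCast]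
        push_cast; rfl
      calc ((n + 1 : ℕ) : ℝ) ^ (5 / 4 : ℝ) ≤ ((M : ℝ) ^ (8 : ℝ)) ^ (5 / 4 : ℝ) := by gcongr
        _ = (M : ℝ) ^ 10 := by
          rw [← Real.rpow_mul (by positivity), ← Real.rpow_natCast]
          norm_num
    rw [Real.sq_sqrt (by positivity)]
    change 1 / Z ≤ 1 / ((n + 1 : ℕ) : ℝ) ^ (5 / 4 : ℝ) / Z * (M : ℝ) ^ 10
    rw [div_mul_eq_mul_div]
    gcongr
    rw [div_mul_eq_mul_div, one_mul, le_div_iff₀ (by positivity)]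
    linarith

/-- The Schrödinger system for the cost `1_{n ≠ m}` on `ℕ`, with `δ = exp (-1 / ε)`. -/
lemma exists_schrodinger_solution {w : ℕ → ℝ} (hw : ∀ n, 0 < w n) (hsum : HasSum w 1) {δ : ℝ}
    (h0 : 0 < δ) (h1 : δ < 1) : ∃ (A : ℝ) (u : ℕ → ℝ), 0 < A ∧ (∀ n, 0 < u n) ∧ HasSum u A ∧
      ∀ n, (1 - δ) * u n ^ 2 + δ * A * u n = w n := by
  set v : ℕ → ℝ → ℝ := fun n a => 2 * w n / (δ * a + √((δ * a) ^ 2 + 4 * (1 - δ) * w n)) with hv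
  have hδ : 0 < 1 - δ := by linarith
  have hvpos : ∀ n a, 0 < a → 0 < v n a := fun n a ha => by
    have := hw n
    simp only [hv]; positivity
  have hroot : ∀ n a, 0 < a → (1 - δ) * v n a ^ 2 + δ * a * v n a = w n := fun n a ha => by
    have hwn := hw n
    simp only [hv]
    set s := √((δ * a) ^ 2 + 4 * (1 - δ) * w n) with hs
    have hs2 : s ^ 2 = (δ * a) ^ 2 + 4 * (1 - δ) * w n := Real.sq_sqrt (by positivity)
    have : 0 < δ * a + s := by positivity
    field_simp
    linear_combination (-1) * hs2
  have hle : ∀ n a, 0 < a → v n a ≤ w n / (δ * a) := fun n a ha => by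
    have h2 := hroot n a ha
    rw [le_div_iff₀ (by positivity)]
    nlinarith [sq_nonneg (v n a)]
  have hw1 : w 0 ≤ 1 := le_hasSum hsum 0 fun n _ => (hw n).le
  set a₀ := √(w 0) with ha₀
  have ha₀pos : 0 < a₀ := Real.sqrt_pos.2 (hw 0)
  have ha₀sq : a₀ ^ 2 = w 0 := Real.sq_sqrt (hw 0).le
  set a₁ := √(1 / δ) with ha₁
  have ha₁pos : 0 < a₁ := by positivity
  have ha₁sq : a₁ ^ 2 = 1 / δ := Real.sq_sqrt (by positivity)
  have h01 : a₀ ≤ a₁ := Real.sqrt_le_sqrt (hw1.trans (by rw [le_div_iff₀ h0]; linarith))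
  have hsv : ∀ a, 0 < a → Summable fun n => v n a := fun a ha =>
    Summable.of_nonneg_of_le (fun n => (hvpos n a ha).le) (fun n => hle n a ha)
      (hsum.summable.div_const _)
  have hcont : ContinuousOn (fun a => (∑' n, v n a) - a) (Icc a₀ a₁) := by
    refine ContinuousOn.sub ?_ continuousOn_id
    refine continuousOn_tsum (u := fun n => w n / (δ * a₀)) (fun n => ?_)
      (hsum.summable.div_const _) (fun n a ha => ?_)
    · refine ContinuousOn.div continuousOn_const (by fun_prop) fun a ha => ?_
      have : 0 < a := ha₀pos.trans_le ha.1
      positivity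
    · have hapos : 0 < a := ha₀pos.trans_le ha.1
      rw [Real.norm_of_nonneg (hvpos n a hapos).le]
      have hwn := (hw n).le
      refine (hle n a hapos).trans ?_
      have := ha.1
      gcongr
  have hlow : 0 ≤ (∑' n, v n a₀) - a₀ := by
    have h2 : v 0 a₀ ≤ ∑' n, v n a₀ :=
      (hsv a₀ ha₀pos).le_tsum 0 fun n _ => (hvpos n a₀ ha₀pos).le
    have h3 : a₀ ≤ v 0 a₀ := by
      by_contra! h
      have h4 := hroot 0 a₀ ha₀pos
      have h5 := hvpos 0 a₀ ha₀pos
      have h6 : v 0 a₀ ^ 2 < a₀ ^ 2 := by gcongr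
      have h7 : δ * a₀ * v 0 a₀ < δ * a₀ * a₀ := by gcongr
      nlinarith
    linarith
  have hhigh : (∑' n, v n a₁) - a₁ ≤ 0 := by
    have h2 : ∑' n, v n a₁ ≤ 1 / (δ * a₁) :=
      (hsv a₁ ha₁pos).tsum_le_of_sum_le (fun s => ?_)
    · have : 1 / (δ * a₁) = a₁ := by
        rw [div_eq_iff (by positivity), show a₁ * (δ * a₁) = δ * a₁ ^ 2 by ring, ha₁sq]
        field_simp
      linarith
    · refine (Finset.sum_le_sum fun n _ => hle n a₁ ha₁pos).trans ?_
      exact sum_le_hasSum s (fun n _ => (div_pos (hw n) (by positivity)).le)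
        (hsum.div_const (δ * a₁))
  obtain ⟨A, hA, hAeq⟩ := intermediate_value_Icc' h01 hcont ⟨hhigh, hlow⟩
  have hApos : 0 < A := ha₀pos.trans_le hA.1
  refine ⟨A, fun n => v n A, hApos, fun n => hvpos n A hApos, ?_, fun n => hroot n A hApos⟩
  have h := (hsv A hApos).hasSum
  have h2 : ∑' n, v n A = A := sub_eq_zero.1 hAeq
  rwa [h2] at h

section SchrodingerBounds

variable {w u : ℕ → ℝ} {δ A : ℝ}

lemma schrodinger_le_mass (hu : ∀ n, 0 < u n) (hA : HasSum u A) (n : ℕ) : u n ≤ A :=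
  le_hasSum hA n fun m _ => (hu m).le

lemma schrodinger_sq_le (h0 : 0 < δ) (hu : ∀ n, 0 < u n) (hA : HasSum u A)
    (h : ∀ n, (1 - δ) * u n ^ 2 + δ * A * u n = w n) (n : ℕ) : u n ^ 2 ≤ w n := by
  have h1 := schrodinger_le_mass hu hA n
  have h2 : δ * u n * u n ≤ δ * u n * A :=
    mul_le_mul_of_nonneg_left h1 (mul_pos h0 (hu n)).le
  nlinarith [h n]

lemma schrodinger_summable_sq (h0 : 0 < δ) (hsum : HasSum w 1) (hu : ∀ n, 0 < u n)
    (hA : HasSum u A) (h : ∀ n, (1 - δ) * u n ^ 2 + δ * A * u n = w n) :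
    Summable fun n => u n ^ 2 :=
  Summable.of_nonneg_of_le (fun _ => sq_nonneg _) (schrodinger_sq_le h0 hu hA h) hsum.summable

lemma schrodinger_total (h0 : 0 < δ) (hsum : HasSum w 1) (hu : ∀ n, 0 < u n)
    (hA : HasSum u A) (h : ∀ n, (1 - δ) * u n ^ 2 + δ * A * u n = w n) :
    (1 - δ) * ∑' n, u n ^ 2 + δ * A * A = 1 := by
  have h1 := (schrodinger_summable_sq h0 hsum hu hA h).hasSum.mul_left (1 - δ)
  have h2 := h1.add (hA.mul_left (δ * A))
  simp only [h] at h2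
  exact h2.unique hsum

lemma schrodinger_mass_sq_le (h0 : 0 < δ) (h1 : δ < 1) (hsum : HasSum w 1) (hu : ∀ n, 0 < u n)
    (hA : HasSum u A) (h : ∀ n, (1 - δ) * u n ^ 2 + δ * A * u n = w n) : δ * A ^ 2 ≤ 1 := by
  have h2 := schrodinger_total h0 hsum hu hA h
  have h3 : 0 ≤ ∑' n, u n ^ 2 := tsum_nonneg fun n => sq_nonneg _
  nlinarith

lemma schrodinger_sub_sq_le (h0 : 0 < δ) (h1 : δ < 1) (hsum : HasSum w 1) (hu : ∀ n, 0 < u n)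
    (hA : HasSum u A) (h : ∀ n, (1 - δ) * u n ^ 2 + δ * A * u n = w n) (n : ℕ) :
    w n - u n ^ 2 ≤ √δ := by
  have h2 := schrodinger_mass_sq_le h0 h1 hsum hu hA h
  have hApos : 0 < A := (hu 0).trans_le (schrodinger_le_mass hu hA 0)
  have hs : √δ ^ 2 = δ := Real.sq_sqrt h0.le
  have hs0 : 0 < √δ := Real.sqrt_pos.2 h0
  have h3 : √δ * A ≤ 1 := by
    rw [← abs_of_pos (mul_pos hs0 hApos), ← sq_le_one_iff_abs_le_one, mul_pow, hs]
    exact h2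
  have hw : w n ≤ 1 := by
    refine le_hasSum hsum n fun m _ => ?_
    exact (sq_nonneg _).trans (schrodinger_sq_le h0 hu hA h m)
  have hun : u n ≤ 1 := by
    have := (schrodinger_sq_le h0 hu hA h n).trans hw
    rw [sq_le_one_iff_abs_le_one] at this
    exact (le_abs_self _).trans this
  have h4 : δ * A ≤ √δ := by
    calc δ * A = √δ * (√δ * A) := by rw [← mul_assoc, ← sq, hs]
      _ ≤ √δ * 1 := by gcongr
      _ = √δ := mul_one _
  have h5 : w n - u n ^ 2 = δ * A * u n - δ * u n ^ 2 := by rw [← h n]; ring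
  have h6 : δ * A * u n ≤ √δ * 1 := mul_le_mul h4 hun (hu n).le hs0.le
  have h7 : 0 ≤ δ * u n ^ 2 := by positivity
  linarith

lemma schrodinger_log_bounded (h0 : 0 < δ) (h1 : δ < 1) (hw : ∀ n, 0 < w n) (hsum : HasSum w 1)
    (hu : ∀ n, 0 < u n) (hA : HasSum u A)
    (h : ∀ n, (1 - δ) * u n ^ 2 + δ * A * u n = w n) :
    ∃ B, ∀ n, |Real.log (u n / w n)| ≤ B := by
  have hApos : 0 < A := (hu 0).trans_le (schrodinger_le_mass hu hA 0)
  have hδA : 0 < δ * A := mul_pos h0 hApos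
  refine ⟨max (Real.log (1 / (δ * A))) (-Real.log (1 / (δ * A + 1))), fun n => ?_⟩
  have hun : u n ≤ 1 := by
    have := (schrodinger_sq_le h0 hu hA h n).trans (le_hasSum hsum n fun m _ => (hw m).le)
    rw [sq_le_one_iff_abs_le_one] at this
    exact (le_abs_self _).trans this
  have hunpos := hu n
  have hwn := hw n
  have hup : u n / w n ≤ 1 / (δ * A) := by
    rw [div_le_div_iff₀ hwn hδA]
    nlinarith [h n, mul_pos hunpos hunpos]
  have hlo : 1 / (δ * A + 1) ≤ u n / w n := by
    rw [div_le_div_iff₀ (by positivity) hwn]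
    nlinarith [h n, mul_pos hunpos hunpos]
  rw [abs_le]
  constructor
  · have := Real.log_le_log (by positivity) hlo
    have h3 := le_max_right (Real.log (1 / (δ * A))) (-Real.log (1 / (δ * A + 1)))
    linarith
  · exact (Real.log_le_log (by positivity) hup).trans (le_max_left _ _)

/-- At `δ = M⁻⁸` the off-diagonal mass `1 - ∑ u²` is larger than `√δ`. -/
lemma schrodinger_offDiag_mass_gt {c : ℝ} (hc : 0 < c) {M : ℕ} (hM : 4 / c < M)
    (hwM : ∀ n < M ^ 8, c ^ 2 ≤ w n * (M : ℝ) ^ 10) (hδ : δ = ((M : ℝ) ^ 8)⁻¹)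
    (hsum : HasSum w 1) (hu : ∀ n, 0 < u n) (hA : HasSum u A)
    (h : ∀ n, (1 - δ) * u n ^ 2 + δ * A * u n = w n) (hM1 : 1 < M) :
    ((M : ℝ) ^ 4)⁻¹ < 1 - ∑' n, u n ^ 2 := by
  have hm : (1 : ℝ) < M := by exact_mod_cast hM1
  set m : ℝ := (M : ℝ)
  have hm0 : 0 < m := by linarith
  have h0 : 0 < δ := by rw [hδ]; positivity
  have hApos : 0 < A := (hu 0).trans_le (schrodinger_le_mass hu hA 0)
  have hδm : δ * m ^ 8 = 1 := by rw [hδ]; field_simp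
  have hcm : 4 < c * m := by rw [div_lt_iff₀ hc] at hM; linarith
  by_contra! hcon
  have htot := schrodinger_total h0 hsum hu hA h
  have hsq : ∑' n, u n ^ 2 ≤ 1 := by
    rw [← hsum.tsum_eq]
    exact (schrodinger_summable_sq h0 hsum hu hA h).tsum_le_tsum (schrodinger_sq_le h0 hu hA h)
      hsum.summable
  have hA2 : A ≤ 2 * m ^ 2 := by
    have h3 : δ * A ^ 2 ≤ (m ^ 4)⁻¹ + δ := by nlinarith
    have h4 : A ^ 2 ≤ m ^ 4 + 1 := by
      have h5 : (δ * A ^ 2) * m ^ 8 ≤ ((m ^ 4)⁻¹ + δ) * m ^ 8 := by gcongr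
      have h6 : (m ^ 4)⁻¹ * m ^ 8 = m ^ 4 := by field_simp
      nlinarith
    have h7 : (1 : ℝ) ≤ m ^ 4 := one_le_pow₀ hm.le
    refine le_of_sq_le_sq ?_ (by positivity)
    nlinarith
  have hlow : ∀ n < M ^ 8, c / (2 * m ^ 5) ≤ u n := fun n hn => by
    by_contra! hlt
    have hun := hu n
    have h3 := h n
    set x := u n * m ^ 5 with hx
    have hxpos : 0 < x := by positivity
    have hxc : x < c / 2 := by
      rw [lt_div_iff₀ (by positivity)] at hlt
      linarith
    have h4 : w n * m ^ 10 = (1 - δ) * x ^ 2 + δ * A * m ^ 5 * x := by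
      rw [← h3, hx]; ring
    have h5 : δ * A * m ^ 6 ≤ 2 := by
      calc δ * A * m ^ 6 ≤ δ * (2 * m ^ 2) * m ^ 6 := by gcongr
        _ = 2 * (δ * m ^ 8) := by ring
        _ = 2 := by rw [hδm, mul_one]
    have h6 : δ * A * m ^ 5 ≤ c / 2 := by
      have : δ * A * m ^ 5 * m ≤ c / 2 * m := by nlinarith
      exact le_of_mul_le_mul_right this hm0
    have h7 := hwM n hn
    have h8 : x ^ 2 ≤ (c / 2) ^ 2 := by gcongr
    have h9 : δ * A * m ^ 5 * x ≤ c / 2 * (c / 2) := by gcongr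
    have h10 : 0 ≤ δ * x ^ 2 := by positivity
    nlinarith
  have hge : m ^ 8 * (c / (2 * m ^ 5)) ≤ A := by
    have h3 := sum_le_hasSum (Finset.range (M ^ 8)) (fun n _ => (hu n).le) hA
    have h4 := Finset.card_nsmul_le_sum (Finset.range (M ^ 8)) u _
      fun n hn => hlow n (Finset.mem_range.1 hn)
    rw [Finset.card_range, nsmul_eq_mul] at h4
    push_cast at h4
    exact h4.trans h3
  have h3 : m ^ 8 * (c / (2 * m ^ 5)) = c * m / 2 * m ^ 2 := by field_simp
  have h4 : 0 < m ^ 2 := by positivity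
  nlinarith

end SchrodingerBounds

section Gibbs

variable {X : Type*} [MeasurableSpace X] {μ : Measure X}

lemma KL_eq_integral {Ω : Type*} [MeasurableSpace Ω] {Q R : Measure Ω} (h : Q ≪ R)
    (hi : Integrable (llr Q R) Q) : KL Q R = ((∫ x, llr Q R x ∂Q : ℝ) : EReal) :=
  if_pos ⟨h, hi⟩

lemma Jfun_eq_coe {Ω : Type*} [MeasurableSpace Ω] {C : Ω → ℝ} {Q R : Measure Ω} {ε : ℝ}
    (h : Q ≪ R) (hi : Integrable (llr Q R) Q) (hC : Integrable C Q) (hC0 : ∀ p, 0 ≤ C p) :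
    Jfun C R ε Q = ((∫ p, C p ∂Q + ε * ∫ p, llr Q R p ∂Q : ℝ) : EReal) := by
  rw [Jfun, KL_eq_integral h hi, ← ofReal_integral_eq_lintegral_ofReal hC (ae_of_all _ hC0),
    EReal.coe_ennreal_ofReal, max_eq_left (integral_nonneg hC0)]
  push_cast; rfl

lemma integrable_of_abs_le {Ω : Type*} [MeasurableSpace Ω] {Q : Measure Ω} [IsFiniteMeasure Q]
    {f : Ω → ℝ} (hf : Measurable f) {B : ℝ} (hB : ∀ x, |f x| ≤ B) : Integrable f Q :=
  Integrable.of_bound hf.aestronglyMeasurable B (ae_of_all _ hB)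

lemma integral_potential_of_mem_couplings {Q : Measure (X × X)} (hQ : Q ∈ couplings μ μ)
    {l : X → ℝ} (hl : Measurable l) {B : ℝ} (hB : ∀ x, |l x| ≤ B) :
    ∫ p, (l p.1 + l p.2) ∂Q = 2 * ∫ x, l x ∂μ := by
  obtain ⟨_, h1, h2⟩ := hQ
  have i1 : Integrable (fun p : X × X => l p.1) Q :=
    integrable_of_abs_le (hl.comp measurable_fst) fun p => hB p.1
  have i2 : Integrable (fun p : X × X => l p.2) Q :=
    integrable_of_abs_le (hl.comp measurable_snd) fun p => hB p.2
  rw [integral_add i1 i2]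
  have e1 : ∫ p, l p.1 ∂Q = ∫ x, l x ∂μ := by
    rw [← h1, integral_map measurable_fst.aemeasurable hl.aestronglyMeasurable]
  have e2 : ∫ p, l p.2 ∂Q = ∫ x, l x ∂μ := by
    rw [← h2, integral_map measurable_snd.aemeasurable hl.aestronglyMeasurable]
  rw [e1, e2]; ring

/-- The entropic functional is, up to a constant, the relative entropy with respect to a
coupling of Gibbs form. -/
lemma Jfun_eq_klDiv [IsProbabilityMeasure μ] {C : X × X → ℝ} (hC : Measurable C)
    (hC0 : ∀ p, 0 ≤ C p) (hC1 : ∀ p, C p ≤ 1) {l : X → ℝ} (hl : Measurable l) {B : ℝ}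
    (hB : ∀ x, |l x| ≤ B) {ε : ℝ} (hε : 0 < ε) {P Q : Measure (X × X)}
    (hP : P = (μ.prod μ).withDensity
      fun p => ENNReal.ofReal (Real.exp (l p.1 + l p.2 - C p / ε)))
    (hPc : P ∈ couplings μ μ) (hQ : Q ∈ couplings μ μ) (hac : Q ≪ μ.prod μ)
    (hint : Integrable (llr Q (μ.prod μ)) Q) :
    Q ≪ P ∧ Integrable (llr Q P) Q ∧ Jfun C (μ.prod μ) ε Q =
      ((2 * ε * ∫ x, l x ∂μ + ε * (InformationTheory.klDiv Q P).toReal : ℝ) : EReal) := by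
  have hPp := hPc.1
  have hQp := hQ.1
  set ρ := μ.prod μ
  set f : X × X → ℝ := fun p => l p.1 + l p.2 - C p / ε with hf
  have hlm : Measurable fun p : X × X => l p.1 + l p.2 := by fun_prop
  have hlb : ∀ p : X × X, |l p.1 + l p.2| ≤ B + B := fun p =>
    (abs_add_le _ _).trans (add_le_add (hB _) (hB _))
  have hCb : ∀ p, |C p| ≤ 1 := fun p => by rw [abs_of_nonneg (hC0 p)]; exact hC1 p
  have hfm : Measurable f := hlm.sub (hC.div_const ε)
  have hfQ : Integrable f Q :=
    (integrable_of_abs_le hlm hlb).sub ((integrable_of_abs_le hC hCb).div_const ε)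
  have hfexp : Integrable (fun p => Real.exp (f p)) ρ := by
    refine integrable_of_abs_le (B := Real.exp (B + B)) (Real.measurable_exp.comp hfm) fun p => ?_
    rw [Real.abs_exp, Real.exp_le_exp]
    have h1 := (abs_le.1 (hlb p)).2
    have h2 : 0 ≤ C p / ε := div_nonneg (hC0 p) hε.le
    simp only [hf]; linarith
  have hone : ∫ p, Real.exp (f p) ∂ρ = 1 := by
    have h1 : P univ = 1 := measure_univ
    rw [hP, withDensity_apply _ MeasurableSet.univ, Measure.restrict_univ,
      ← ofReal_integral_eq_lintegral_ofReal hfexp (ae_of_all _ fun p => (Real.exp_pos _).le),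
      ENNReal.ofReal_eq_one] at h1
    exact h1
  have hPt : P = ρ.tilted f := by
    rw [hP, Measure.tilted, hone]
    simp only [div_one, hf]
  have hacP : Q ≪ P := by
    rw [hPt]; exact hac.trans (absolutelyContinuous_tilted hfexp)
  refine ⟨hacP, by rw [hPt]; exact integrable_llr_tilted_right hac hfQ hint hfexp, ?_⟩
  rw [Jfun_eq_coe hac hint (integrable_of_abs_le hC hCb) hC0,
    InformationTheory.toReal_klDiv_of_measure_eq hacP (by simp), hPt,
    integral_llr_tilted_right hac hfQ hfexp hint, hone, Real.log_one]
  have h2 : ∫ p, f p ∂Q = 2 * ∫ x, l x ∂μ - (∫ p, C p ∂Q) / ε := by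
    rw [← integral_potential_of_mem_couplings hQ hl hB, ← integral_div]
    exact integral_sub (integrable_of_abs_le hlm hlb)
      ((integrable_of_abs_le hC hCb).div_const ε)
  rw [h2]
  congr 1
  field_simp
  ring

/-- A coupling of Gibbs form is the unique minimiser of the entropic functional. -/
theorem gibbs_coupling_unique_minimiser [IsProbabilityMeasure μ] {C : X × X → ℝ}
    (hC : Measurable C) (hC0 : ∀ p, 0 ≤ C p) (hC1 : ∀ p, C p ≤ 1) {l : X → ℝ}
    (hl : Measurable l) {B : ℝ} (hB : ∀ x, |l x| ≤ B) {ε : ℝ} (hε : 0 < ε)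
    {P : Measure (X × X)} (hP : P = (μ.prod μ).withDensity
      fun p => ENNReal.ofReal (Real.exp (l p.1 + l p.2 - C p / ε)))
    (hPc : P ∈ couplings μ μ) :
    (∀ Q ∈ couplings μ μ, Jfun C (μ.prod μ) ε P ≤ Jfun C (μ.prod μ) ε Q) ∧
      ∀ Q ∈ couplings μ μ,
        (∀ R ∈ couplings μ μ, Jfun C (μ.prod μ) ε Q ≤ Jfun C (μ.prod μ) ε R) → Q = P := by
  have hPp := hPc.1
  have hfm : Measurable fun p : X × X => l p.1 + l p.2 - C p / ε := by fun_prop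
  have hacP : P ≪ μ.prod μ := by rw [hP]; exact withDensity_absolutelyContinuous _ _
  have hllr : llr P (μ.prod μ) =ᵐ[P] fun p => l p.1 + l p.2 - C p / ε := by
    refine hacP.ae_le ?_
    rw [hP]
    filter_upwards [Measure.rnDeriv_withDensity (μ.prod μ)
      (Real.measurable_exp.comp hfm).ennreal_ofReal] with p hp
    rw [llr]
    simp only [Function.comp_def] at hp
    rw [hp, ENNReal.toReal_ofReal (Real.exp_pos _).le, Real.log_exp]
  have hintP : Integrable (llr P (μ.prod μ)) P := by
    refine Integrable.congr ?_ hllr.symm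
    refine Integrable.sub (integrable_of_abs_le (B := B + B) (by fun_prop) fun p =>
      (abs_add_le _ _).trans (add_le_add (hB _) (hB _))) (Integrable.div_const ?_ ε)
    refine integrable_of_abs_le (B := 1) hC fun p => ?_
    rw [abs_of_nonneg (hC0 p)]; exact hC1 p
  have hJP := (Jfun_eq_klDiv hC hC0 hC1 hl hB hε hP hPc hPc hacP hintP).2.2
  rw [InformationTheory.klDiv_self, ENNReal.toReal_zero, mul_zero, add_zero] at hJP
  have htop : ∀ Q : Measure (X × X), ¬ (Q ≪ μ.prod μ ∧ Integrable (llr Q (μ.prod μ)) Q) →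
      Jfun C (μ.prod μ) ε Q = ⊤ := fun Q h => by
    have h' : KL Q (μ.prod μ) = ⊤ := if_neg h
    rw [Jfun, h', EReal.coe_mul_top_of_pos hε]
    exact EReal.add_top_of_ne_bot (EReal.coe_ennreal_ne_bot _)
  refine ⟨fun Q hQ => ?_, fun Q hQ hmin => ?_⟩
  · by_cases h : Q ≪ μ.prod μ ∧ Integrable (llr Q (μ.prod μ)) Q
    · rw [(Jfun_eq_klDiv hC hC0 hC1 hl hB hε hP hPc hQ h.1 h.2).2.2, hJP, EReal.coe_le_coe_iff]
      have : 0 ≤ ε * (InformationTheory.klDiv Q P).toReal := by positivity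
      linarith
    · rw [htop Q h]; exact le_top
  · have hQp := hQ.1
    have h1 := hmin P hPc
    by_cases h : Q ≪ μ.prod μ ∧ Integrable (llr Q (μ.prod μ)) Q
    · obtain ⟨h2, h3, h4⟩ := Jfun_eq_klDiv hC hC0 hC1 hl hB hε hP hPc hQ h.1 h.2
      rw [h4, hJP, EReal.coe_le_coe_iff] at h1
      have h5 : (InformationTheory.klDiv Q P).toReal = 0 := by
        have : 0 ≤ (InformationTheory.klDiv Q P).toReal := ENNReal.toReal_nonneg
        nlinarith
      rw [ENNReal.toReal_eq_zero_iff] at h5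
      exact InformationTheory.klDiv_eq_zero_iff.1
        (h5.resolve_right (InformationTheory.klDiv_ne_top h2 h3))
    · rw [htop Q h, hJP, top_le_iff] at h1
      exact absurd h1 (EReal.coe_ne_top _)

end Gibbs

section Blocks

variable {X : Type*} [MeasurableSpace X] {μ : Measure X} {idx : X → ℕ} {w : ℕ → ℝ}

lemma lintegral_comp_block (hidx : Measurable idx)
    (hblock : ∀ n, μ (idx ⁻¹' {n}) = ENNReal.ofReal (w n)) (f : ℕ → ℝ≥0∞) :
    ∫⁻ x, f (idx x) ∂μ = ∑' n, f n * ENNReal.ofReal (w n) := by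
  rw [← lintegral_map (measurable_of_countable f) hidx, lintegral_countable']
  refine tsum_congr fun n => ?_
  rw [Measure.map_apply hidx (measurableSet_singleton n), hblock]

/-- The measure on the product whose density is constant equal to `k n m` on the block
`(n, m)`. -/
def blockMeasure (μ : Measure X) (idx : X → ℕ) (k : ℕ → ℕ → ℝ≥0∞) : Measure (X × X) :=
  (μ.prod μ).withDensity fun p => k (idx p.1) (idx p.2)

lemma measurable_block_density (hidx : Measurable idx) (k : ℕ → ℕ → ℝ≥0∞) :
    Measurable fun p : X × X => k (idx p.1) (idx p.2) :=
  (measurable_of_countable fun q : ℕ × ℕ => k q.1 q.2).comp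
    ((hidx.comp measurable_fst).prodMk (hidx.comp measurable_snd))

lemma lintegral_blockMeasure [SFinite μ] (hidx : Measurable idx)
    (hblock : ∀ n, μ (idx ⁻¹' {n}) = ENNReal.ofReal (w n)) (k : ℕ → ℕ → ℝ≥0∞)
    (g : ℕ → ℕ → ℝ≥0∞) :
    ∫⁻ p, g (idx p.1) (idx p.2) ∂(blockMeasure μ idx k) =
      ∑' n, (∑' m, k n m * g n m * ENNReal.ofReal (w m)) * ENNReal.ofReal (w n) := by
  rw [blockMeasure, lintegral_withDensity_eq_lintegral_mul _ (measurable_block_density hidx k)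
    (measurable_block_density hidx g)]
  have hm : Measurable fun p : X × X => k (idx p.1) (idx p.2) * g (idx p.1) (idx p.2) :=
    (measurable_block_density hidx k).mul (measurable_block_density hidx g)
  simp only [Pi.mul_apply]
  rw [lintegral_prod _ hm.aemeasurable, ← lintegral_comp_block hidx hblock]
  refine lintegral_congr fun x => ?_
  exact lintegral_comp_block hidx hblock fun m => k (idx x) m * g (idx x) m

lemma blockMeasure_apply [SFinite μ] (hidx : Measurable idx)
    (hblock : ∀ n, μ (idx ⁻¹' {n}) = ENNReal.ofReal (w n)) (k : ℕ → ℕ → ℝ≥0∞)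
    (r : ℕ → ℕ → Prop) :
    blockMeasure μ idx k {p | r (idx p.1) (idx p.2)} =
      ∑' n, (∑' m, k n m * (if r n m then 1 else 0) * ENNReal.ofReal (w m)) *
        ENNReal.ofReal (w n) := by
  rw [← lintegral_blockMeasure hidx hblock k fun n m => if r n m then 1 else 0]
  have hs : MeasurableSet {p : X × X | r (idx p.1) (idx p.2)} :=
    (((hidx.comp measurable_fst).prodMk (hidx.comp measurable_snd)))
      (MeasurableSet.of_discrete (s := {q : ℕ × ℕ | r q.1 q.2}))
  rw [← lintegral_indicator_one hs]
  rfl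

lemma blockMeasure_mem_couplings [IsProbabilityMeasure μ] (hidx : Measurable idx)
    (hblock : ∀ n, μ (idx ⁻¹' {n}) = ENNReal.ofReal (w n)) {k : ℕ → ℕ → ℝ≥0∞}
    (hsymm : ∀ n m, k n m = k m n)
    (hmarg : ∀ n, ∑' m, k n m * ENNReal.ofReal (w m) = 1) :
    blockMeasure μ idx k ∈ couplings μ μ := by
  have hk := measurable_block_density hidx k
  have hinner : ∀ x, ∫⁻ y, k (idx x) (idx y) ∂μ = 1 := fun x => by
    rw [lintegral_comp_block hidx hblock fun m => k (idx x) m, hmarg]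
  have hinner' : ∀ y, ∫⁻ x, k (idx x) (idx y) ∂μ = 1 := fun y => by
    rw [← hinner y]
    exact lintegral_congr fun x => hsymm _ _
  have hfst : (blockMeasure μ idx k).map Prod.fst = μ := by
    ext s hs
    rw [Measure.map_apply measurable_fst hs, blockMeasure,
      withDensity_apply _ (measurable_fst hs), ← prod_univ, ← Measure.prod_restrict,
      Measure.restrict_univ, lintegral_prod _ hk.aemeasurable]
    simp [hinner]
  have hsnd : (blockMeasure μ idx k).map Prod.snd = μ := by
    ext s hs
    rw [Measure.map_apply measurable_snd hs, blockMeasure,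
      withDensity_apply _ (measurable_snd hs), ← univ_prod, ← Measure.prod_restrict,
      Measure.restrict_univ, lintegral_prod_symm _ hk.aemeasurable]
    simp [hinner']
  refine ⟨⟨?_⟩, hfst, hsnd⟩
  rw [← preimage_univ (f := Prod.fst), ← Measure.map_apply measurable_fst MeasurableSet.univ,
    hfst, measure_univ]

end Blocks

section GibbsBlocks

/-- The density of the entropic minimiser on the block `(n, m)`. -/
def gibbsDensity (ε : ℝ) (w u : ℕ → ℝ) (n m : ℕ) : ℝ≥0∞ :=
  ENNReal.ofReal (Real.exp (Real.log (u n / w n) + Real.log (u m / w m) -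
    (if n = m then 0 else 1) / ε))

variable {w u : ℕ → ℝ} {ε A : ℝ}

lemma gibbsDensity_symm (ε : ℝ) (w u : ℕ → ℝ) (n m : ℕ) :
    gibbsDensity ε w u n m = gibbsDensity ε w u m n := by
  simp only [gibbsDensity, eq_comm (a := n) (b := m), add_comm (Real.log (u n / w n))]

lemma gibbsDensity_eq (hw : ∀ n, 0 < w n) (hu : ∀ n, 0 < u n) (n m : ℕ) :
    gibbsDensity ε w u n m =
      ENNReal.ofReal (u n / w n * (u m / w m) * if n = m then 1 else Real.exp (-1 / ε)) := by
  have h1 := div_pos (hu n) (hw n)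
  have h2 := div_pos (hu m) (hw m)
  rw [gibbsDensity, sub_eq_add_neg, Real.exp_add, Real.exp_add, Real.exp_log h1, Real.exp_log h2]
  split_ifs <;> simp [neg_div]

lemma gibbsDensity_mul_weight (hw : ∀ n, 0 < w n) (hu : ∀ n, 0 < u n) (n m : ℕ) :
    gibbsDensity ε w u n m * ENNReal.ofReal (w m) =
      ENNReal.ofReal (u n / w n * u m * if n = m then 1 else Real.exp (-1 / ε)) := by
  have h1 := div_pos (hu n) (hw n)
  rw [gibbsDensity_eq hw hu, ← ENNReal.ofReal_mul' (hw m).le]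
  congr 1
  have := (hw m).ne'
  field_simp

lemma gibbsDensity_marginal (hw : ∀ n, 0 < w n) (hu : ∀ n, 0 < u n) (hA : HasSum u A)
    (h : ∀ n, (1 - Real.exp (-1 / ε)) * u n ^ 2 + Real.exp (-1 / ε) * A * u n = w n) (n : ℕ) :
    ∑' m, gibbsDensity ε w u n m * ENNReal.ofReal (w m) = 1 := by
  set δ := Real.exp (-1 / ε) with hδ
  have hδ0 : 0 < δ := Real.exp_pos _
  have h1 : HasSum (fun m => u n / w n * u m * if n = m then 1 else δ) 1 := by
    have h2 := (hA.mul_left (u n / w n * δ)).add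
      (hasSum_ite_eq n (u n / w n * u n * (1 - δ)))
    have h3 : u n / w n * δ * A + u n / w n * u n * (1 - δ) = 1 := by
      rw [show u n / w n * δ * A + u n / w n * u n * (1 - δ) =
        ((1 - δ) * u n ^ 2 + δ * A * u n) / w n by ring, h n, div_self (hw n).ne']
    rw [h3] at h2
    refine (congrArg (HasSum · 1) (funext fun m => ?_)).mpr h2
    split_ifs with h4 h5 h5
    · subst h4; ring
    · exact absurd h4.symm h5
    · exact absurd h5.symm h4
    · ring
  have h3 : ∀ m, 0 ≤ u n / w n * u m * if n = m then 1 else δ := fun m => by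
    have := (div_pos (hu n) (hw n)).le
    have := (hu m).le
    split_ifs <;> positivity
  simp only [gibbsDensity_mul_weight hw hu, ← hδ]
  rw [← ENNReal.ofReal_tsum_of_nonneg h3 h1.summable, h1.tsum_eq, ENNReal.ofReal_one]

variable {X : Type*} [MeasurableSpace X] {μ : Measure X} {idx : X → ℕ}

lemma gibbs_diag_mass [SFinite μ] (hidx : Measurable idx)
    (hblock : ∀ n, μ (idx ⁻¹' {n}) = ENNReal.ofReal (w n)) (hw : ∀ n, 0 < w n)
    (hu : ∀ n, 0 < u n) (hsq : Summable fun n => u n ^ 2) :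
    blockMeasure μ idx (gibbsDensity ε w u) {p | idx p.1 = idx p.2} =
      ENNReal.ofReal (∑' n, u n ^ 2) := by
  rw [blockMeasure_apply hidx hblock _ fun n m => n = m,
    ENNReal.ofReal_tsum_of_nonneg (fun n => sq_nonneg _) hsq]
  refine tsum_congr fun n => ?_
  rw [tsum_eq_single n fun m hm => by simp [hm.symm], if_pos rfl, mul_one,
    gibbsDensity_mul_weight hw hu, if_pos rfl, mul_one, ← ENNReal.ofReal_mul' (hw n).le]
  congr 1
  have := (hw n).ne'
  field_simp

lemma gibbs_offDiag_mass [SFinite μ] (hidx : Measurable idx)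
    (hblock : ∀ n, μ (idx ⁻¹' {n}) = ENNReal.ofReal (w n)) (hw : ∀ n, 0 < w n)
    (hu : ∀ n, 0 < u n) (hsq : Summable fun n => u n ^ 2)
    [IsProbabilityMeasure (blockMeasure μ idx (gibbsDensity ε w u))] :
    blockMeasure μ idx (gibbsDensity ε w u) {p | idx p.1 ≠ idx p.2} =
      ENNReal.ofReal (1 - ∑' n, u n ^ 2) := by
  have hD : MeasurableSet {p : X × X | idx p.1 = idx p.2} :=
    measurableSet_eq_fun (hidx.comp measurable_fst) (hidx.comp measurable_snd)
  rw [show {p : X × X | idx p.1 ≠ idx p.2} = {p | idx p.1 = idx p.2}ᶜ from rfl,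
    prob_compl_eq_one_sub hD, gibbs_diag_mass hidx hblock hw hu hsq,
    ENNReal.ofReal_sub _ (tsum_nonneg fun n => sq_nonneg _), ENNReal.ofReal_one]

lemma gibbs_block_mass_le [SFinite μ] (hidx : Measurable idx)
    (hblock : ∀ n, μ (idx ⁻¹' {n}) = ENNReal.ofReal (w n)) (hw : ∀ n, 0 < w n)
    (hu : ∀ n, 0 < u n) (hu1 : ∀ n, u n ≤ 1) {n m : ℕ} (hnm : n ≠ m) :
    blockMeasure μ idx (gibbsDensity ε w u) {p | idx p.1 = n ∧ idx p.2 = m} ≤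
      ENNReal.ofReal (Real.exp (-1 / ε)) := by
  rw [blockMeasure_apply hidx hblock _ fun a b => a = n ∧ b = m,
    tsum_eq_single n fun a ha => by simp [ha], tsum_eq_single m fun b hb => by simp [hb],
    if_pos ⟨rfl, rfl⟩, mul_one, gibbsDensity_mul_weight hw hu, if_neg hnm,
    ← ENNReal.ofReal_mul' (hw n).le]
  refine ENNReal.ofReal_le_ofReal ?_
  have h1 := (hw n).ne'
  have h2 : u n / w n * u m * Real.exp (-1 / ε) * w n = u n * u m * Real.exp (-1 / ε) := by
    field_simp
  rw [h2]
  exact mul_le_of_le_one_left (Real.exp_pos _).le (mul_le_one₀ (hu1 n) (hu m).le (hu1 m))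

/-- The density of the limit plan on the block `(n, m)`. -/
def diagDensity (w : ℕ → ℝ) (n m : ℕ) : ℝ≥0∞ := if n = m then ENNReal.ofReal (1 / w n) else 0

lemma diagDensity_symm (w : ℕ → ℝ) (n m : ℕ) : diagDensity w n m = diagDensity w m n := by
  by_cases h : n = m
  · rw [h]
  · simp [diagDensity, h, Ne.symm h]

lemma diagDensity_marginal (hw : ∀ n, 0 < w n) (n : ℕ) :
    ∑' m, diagDensity w n m * ENNReal.ofReal (w m) = 1 := by
  rw [tsum_eq_single n fun m hm => by simp [diagDensity, hm.symm], diagDensity, if_pos rfl,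
    ← ENNReal.ofReal_mul' (hw n).le, one_div, inv_mul_cancel₀ (hw n).ne', ENNReal.ofReal_one]

lemma gibbs_inter_diag_le (hidx : Measurable idx) (hw : ∀ n, 0 < w n) (hu : ∀ n, 0 < u n)
    (hle : ∀ n, u n ^ 2 ≤ w n) {s : Set (X × X)} (hs : MeasurableSet s) :
    blockMeasure μ idx (gibbsDensity ε w u) (s ∩ {p | idx p.1 = idx p.2}) ≤
      blockMeasure μ idx (diagDensity w) s := by
  have hD : MeasurableSet {p : X × X | idx p.1 = idx p.2} :=
    measurableSet_eq_fun (hidx.comp measurable_fst) (hidx.comp measurable_snd)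
  refine le_trans ?_ (measure_mono (inter_subset_left (t := {p | idx p.1 = idx p.2})))
  rw [blockMeasure, blockMeasure, withDensity_apply _ (hs.inter hD),
    withDensity_apply _ (hs.inter hD)]
  refine setLIntegral_mono' (hs.inter hD) fun p hp => ?_
  have hp2 : idx p.1 = idx p.2 := hp.2
  rw [gibbsDensity_eq hw hu, diagDensity, ← hp2, if_pos rfl, if_pos rfl, mul_one]
  refine ENNReal.ofReal_le_ofReal ?_
  have h1 := hw (idx p.1)
  rw [div_mul_div_comm, div_le_div_iff₀ (by positivity) h1]
  nlinarith [hle (idx p.1)]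

lemma TVdist_le_compl {Ω : Type*} [MeasurableSpace Ω] {P Q : Measure Ω}
    [IsProbabilityMeasure P] [IsProbabilityMeasure Q] {D : Set Ω}
    (h : ∀ s, MeasurableSet s → P (s ∩ D) ≤ Q s) : TVdist P Q ≤ P Dᶜ := by
  have h1 : ∀ s, MeasurableSet s → P s ≤ Q s + P Dᶜ := fun s hs => by
    refine (measure_le_inter_add_sdiff P s D).trans (add_le_add (h s hs) (measure_mono ?_))
    exact fun x hx => hx.2
  refine iSup₂_le fun s hs => max_le ?_ ?_
  · exact tsub_le_iff_left.2 (h1 s hs)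
  · have h2 := h1 sᶜ hs.compl
    rw [tsub_le_iff_left]
    have h3 : Q s + Q sᶜ = 1 := by rw [measure_add_measure_compl hs, measure_univ]
    have h4 : P s + P sᶜ = 1 := by rw [measure_add_measure_compl hs, measure_univ]
    have h5 : Q s + Q sᶜ ≤ P s + P Dᶜ + Q sᶜ := by
      rw [h3, ← h4, add_assoc, add_comm (P Dᶜ)]
      gcongr
    exact (ENNReal.add_le_add_iff_right (measure_ne_top Q sᶜ)).1 h5

end GibbsBlocks

section LargeDeviations

lemma elog_le_of_le_exp {x : ℝ≥0∞} {r : ℝ} (h : x ≤ ENNReal.ofReal (Real.exp r)) :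
    elog x ≤ r := by
  have hx : x ≠ ⊤ := ne_top_of_le_ne_top ENNReal.ofReal_ne_top h
  rw [elog]
  split_ifs with h0
  · exact bot_le
  · rw [EReal.coe_le_coe_iff, Real.log_le_iff_le_exp (ENNReal.toReal_pos h0 hx)]
    exact ENNReal.toReal_le_of_le_ofReal (Real.exp_pos _).le h

lemma le_elog_of_exp_le {x : ℝ≥0∞} {r : ℝ} (h : ENNReal.ofReal (Real.exp r) ≤ x) :
    r ≤ elog x := by
  have h0 : x ≠ 0 := (lt_of_lt_of_le (ENNReal.ofReal_pos.2 (Real.exp_pos r)) h).ne'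
  rw [elog, if_neg h0]
  split_ifs with hx
  · exact le_top
  · rw [EReal.coe_le_coe_iff, Real.le_log_iff_exp_le (ENNReal.toReal_pos h0 hx)]
    exact (ENNReal.ofReal_le_iff_le_toReal hx).1 h

/-- If a closed set is a union of open sets, each of mass at most `exp (-1 / ε)`, but itself has
mass at least `exp (-1 / (2 ε))` along a sequence `ε ↓ 0`, there is no full LDP. -/
lemma not_LDP_of_nonuniform {Z ι : Type*} [TopologicalSpace Z] [MeasurableSpace Z]
    {P : ℝ → Measure Z} {O : ι → Set Z} (hO : ∀ i, IsOpen (O i))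
    (hsmall : ∀ i, ∀ ε : ℝ, 0 < ε → P ε (O i) ≤ ENNReal.ofReal (Real.exp (-1 / ε)))
    (hF : IsClosed (⋃ i, O i))
    (hlarge : ∃ᶠ ε in 𝓝[>] (0 : ℝ),
      ENNReal.ofReal (Real.exp (-1 / (2 * ε))) ≤ P ε (⋃ i, O i)) (I : Z → ℝ≥0∞)
    (hup : ∀ Cl : Set Z, IsClosed Cl → limsupLog P Cl ≤ -(((⨅ p ∈ Cl, I p : ℝ≥0∞)) : EReal))
    (hlo : ∀ U : Set Z, IsOpen U → -(((⨅ p ∈ U, I p : ℝ≥0∞)) : EReal) ≤ liminfLog P U) :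
    False := by
  have hrate : ∀ i, (1 : ℝ≥0∞) ≤ ⨅ p ∈ O i, I p := fun i => by
    have h1 : liminfLog P (O i) ≤ ((-1 : ℝ) : EReal) := by
      refine liminf_le_of_frequently_le' (Eventually.frequently ?_)
      filter_upwards [self_mem_nhdsWithin] with ε hε
      have hε' : 0 < ε := hε
      calc (ε : EReal) * elog (P ε (O i)) ≤ (ε : EReal) * ((-1 / ε : ℝ) : EReal) :=
            mul_le_mul_of_nonneg_left (elog_le_of_le_exp (hsmall i ε hε'))
              (EReal.coe_nonneg.2 hε'.le)
        _ = ((-1 : ℝ) : EReal) := by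
            rw [← EReal.coe_mul]; congr 1; field_simp
    have h2 := (hlo _ (hO i)).trans h1
    rw [EReal.coe_neg, EReal.neg_le_neg_iff, EReal.coe_one, ← EReal.coe_ennreal_one] at h2
    exact EReal.coe_ennreal_le_coe_ennreal_iff.1 h2
  have hinf : (1 : ℝ≥0∞) ≤ ⨅ p ∈ ⋃ i, O i, I p := by
    refine le_iInf₂ fun p hp => ?_
    obtain ⟨i, hi⟩ := mem_iUnion.1 hp
    exact (hrate i).trans (iInf₂_le p hi)
  have h1 : ((-(1 / 2) : ℝ) : EReal) ≤ limsupLog P (⋃ i, O i) := by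
    refine le_limsup_of_frequently_le' ?_
    refine (hlarge.and_eventually self_mem_nhdsWithin).mono fun ε ⟨h, hε⟩ => ?_
    have hε' : 0 < ε := hε
    calc ((-(1 / 2) : ℝ) : EReal) = (ε : EReal) * ((-1 / (2 * ε) : ℝ) : EReal) := by
          rw [← EReal.coe_mul]; congr 1; field_simp
      _ ≤ _ := mul_le_mul_of_nonneg_left (le_elog_of_exp_le h) (EReal.coe_nonneg.2 hε'.le)
  have h2 : (-(((⨅ p ∈ ⋃ i, O i, I p : ℝ≥0∞)) : EReal)) ≤ -((1 : ℝ≥0∞) : EReal) :=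
    EReal.neg_le_neg_iff.2 (EReal.coe_ennreal_le_coe_ennreal_iff.2 hinf)
  have h3 := (h1.trans (hup _ hF)).trans h2
  rw [EReal.coe_ennreal_one, ← EReal.coe_one, ← EReal.coe_neg, EReal.coe_le_coe_iff] at h3
  norm_num at h3

end LargeDeviations

section BlockSpace

lemma not_isCompact_msupport {X : Type*} [TopologicalSpace X] [SecondCountableTopology X]
    [MeasurableSpace X] {P : Measure (X × X)} {idx : X → ℕ} (hidx : Continuous idx)
    (h : ∀ N, P {p | N < idx p.1} ≠ 0) : ¬ IsCompact (msupport P) := fun hK => by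
  obtain ⟨N, hN⟩ := (hK.image (hidx.comp continuous_fst)).bddAbove
  refine h N (measure_null_of_locally_null _ fun p hp => ?_)
  have hps : p ∉ msupport P := fun hp' => (hN ⟨p, hp', rfl⟩).not_gt hp
  simp only [msupport, mem_ofPred_eq, not_forall, not_lt, nonpos_iff_eq_zero] at hps
  obtain ⟨U, hU, hpU, h0⟩ := hps
  exact ⟨U, mem_nhdsWithin_of_mem_nhds (hU.mem_nhds hpU), h0⟩

/-- A disjoint union of intervals in `ℝ` carrying prescribed masses. -/
lemma exists_block_space {w : ℕ → ℝ} (hw : ∀ n, 0 < w n) (hsum : HasSum w 1) :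
    ∃ S : Set ℝ, IsClosed S ∧ ∃ (μ : Measure S) (idx : S → ℕ), IsProbabilityMeasure μ ∧
      (∀ x, μ {x} = 0) ∧ Continuous idx ∧ ∀ n, μ (idx ⁻¹' {n}) = ENNReal.ofReal (w n) := by
  set S : Set ℝ := {x | 0 ≤ x ∧ Int.fract x ≤ 1 / 2} with hS
  have hsub : ∀ n : ℕ, Icc (n : ℝ) (n + 1 / 2) ⊆ S := fun n x ⟨h1, h2⟩ => by
    have h0 : (0 : ℝ) ≤ n := n.cast_nonneg
    refine ⟨h0.trans h1, ?_⟩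
    have h3 : ⌊x⌋ = (n : ℤ) := by
      rw [Int.floor_eq_iff]
      push_cast
      constructor <;> linarith
    rw [Int.fract, h3]
    push_cast
    linarith
  have hfloor : ∀ (x : S) (n : ℕ), ⌊(x : ℝ)⌋₊ = n ↔ (x : ℝ) ∈ Icc (n : ℝ) (n + 1 / 2) := by
    rintro ⟨x, hx0, hx1⟩ n
    simp only [mem_Icc, Nat.floor_eq_iff hx0]
    constructor
    · rintro ⟨h1, h2⟩
      refine ⟨h1, ?_⟩
      have h3 : ⌊x⌋ = (n : ℤ) := by
        rw [Int.floor_eq_iff]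
        push_cast
        exact ⟨h1, h2⟩
      rw [Int.fract, h3] at hx1
      push_cast at hx1
      linarith
    · rintro ⟨h1, h2⟩
      exact ⟨h1, by linarith⟩
  have hpre : ∀ n : ℕ, (fun x : S => ⌊(x : ℝ)⌋₊) ⁻¹' {n} =
      (fun x : S => (x : ℝ)) ⁻¹' Icc (n : ℝ) (n + 1 / 2) := fun n => by
    ext x
    exact hfloor x n
  have hclosed : IsClosed S := by
    have : S = Ici 0 ∩ (⋃ n : ℤ, Ioo ((n : ℝ) + 1 / 2) (n + 1))ᶜ := by
      ext x
      simp only [hS, mem_ofPred_eq, mem_inter_iff, mem_Ici, mem_compl_iff, mem_iUnion, mem_Ioo,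
        not_exists]
      refine and_congr_right fun _ => ⟨fun h n hn => ?_, fun h => ?_⟩
      · have h3 : ⌊x⌋ = n := by
          rw [Int.floor_eq_iff]
          constructor <;> linarith [hn.1, hn.2]
        rw [Int.fract, h3] at h
        linarith [hn.1]
      · by_contra! h1
        refine h ⌊x⌋ ⟨?_, Int.lt_floor_add_one x⟩
        have := Int.floor_add_fract x
        linarith
    rw [this]
    exact isClosed_Ici.inter (isOpen_iUnion fun _ => isOpen_Ioo).isClosed_compl
  set idx : S → ℕ := fun x => ⌊(x : ℝ)⌋₊
  have hcont : Continuous idx := by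
    refine continuous_discrete_rng.2 fun n => ?_
    have : idx ⁻¹' {n} = (fun x : S => (x : ℝ)) ⁻¹' Ioo ((n : ℝ) - 1 / 2) (n + 1) := by
      ext x
      rw [hpre, mem_preimage, mem_preimage]
      refine ⟨fun h => ⟨by linarith [h.1], by linarith [h.2]⟩, fun h => ?_⟩
      rw [← hfloor, Nat.floor_eq_iff x.2.1]
      refine ⟨?_, h.2⟩
      by_contra! hlt
      have h1 : (0 : ℝ) ≤ x := x.2.1
      have h2 := x.2.2
      have h3 : ⌊(x : ℝ)⌋ = (n : ℤ) - 1 := by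
        rw [Int.floor_eq_iff]
        push_cast
        constructor <;> linarith [h.1]
      rw [Int.fract, h3] at h2
      push_cast at h2
      linarith [h.1]
    rw [this]
    exact isOpen_Ioo.preimage continuous_subtype_val
  have hmeas : Measurable idx := hcont.measurable
  set ν : Measure S := (volume : Measure ℝ).comap Subtype.val
  have hvol : ∀ n, ν (idx ⁻¹' {n}) = ENNReal.ofReal (1 / 2) := fun n => by
    rw [hpre, comap_subtype_coe_apply hclosed.measurableSet, Subtype.image_preimage_coe,
      inter_eq_right.2 (hsub n), Real.volume_Icc]
    congr 1; ring
  have hblock : ∀ n, ν.withDensity (fun x => ENNReal.ofReal (2 * w (idx x)))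
      (idx ⁻¹' {n}) = ENNReal.ofReal (w n) := fun n => by
    have hm : MeasurableSet (idx ⁻¹' {n}) := hmeas (measurableSet_singleton n)
    rw [withDensity_apply _ hm, setLIntegral_congr_fun (g := fun _ => ENNReal.ofReal (2 * w n)) hm
      fun x hx => by rw [show idx x = n from hx], setLIntegral_const, hvol,
      ← ENNReal.ofReal_mul' (by norm_num)]
    congr 1; ring
  refine ⟨S, hclosed, _, idx, ⟨?_⟩, fun x => ?_, hcont, hblock⟩
  · rw [← preimage_univ (f := idx), ← Measure.map_apply hmeas MeasurableSet.univ,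
      ← Measure.tsum_indicator_apply_singleton _ _ MeasurableSet.univ]
    simp only [indicator_univ, Measure.map_apply hmeas (measurableSet_singleton _), hblock]
    rw [← ENNReal.ofReal_tsum_of_nonneg (fun n => (hw n).le) hsum.summable, hsum.tsum_eq,
      ENNReal.ofReal_one]
  · refine withDensity_absolutelyContinuous _ _ ?_
    rw [comap_subtype_coe_apply hclosed.measurableSet, image_singleton, measure_singleton]

end BlockSpace

/-- **No full LDP on `X × X`** (Theorem 1.2): there exist a closed set `X ⊆ ℝ`, a
nonatomic Borel probability measure `μ` on `X`, and a continuous nonnegative cost `C` such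
that for every `ε > 0` the entropic functional has a unique minimiser `P_ε ∈ Π(μ,μ)`,
`P_ε` converges in total variation to an optimal transport plan with noncompact support,
and there is NO lower semicontinuous rate function `I : X × X → [0,∞]` for which `(P_ε)`
satisfies a full large deviation principle on `X × X` at speed `1/ε`. -/
theorem no_full_LDP_on_ambient_space :
    ∃ S : Set ℝ, IsClosed S ∧
    ∃ (μ : Measure S) (C : S × S → ℝ) (P : ℝ → Measure (S × S))
      (Pstar : Measure (S × S)),
      IsProbabilityMeasure μ ∧ (∀ x : S, μ {x} = 0) ∧
      Continuous C ∧ (∀ p, 0 ≤ C p) ∧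
      (∀ ε : ℝ, 0 < ε →
        P ε ∈ couplings μ μ ∧
        (∀ Q ∈ couplings μ μ,
          Jfun C (μ.prod μ) ε (P ε) ≤ Jfun C (μ.prod μ) ε Q) ∧
        (∀ Q ∈ couplings μ μ,
          (∀ R ∈ couplings μ μ,
            Jfun C (μ.prod μ) ε Q ≤ Jfun C (μ.prod μ) ε R) → Q = P ε)) ∧
      Pstar ∈ couplings μ μ ∧
      (∀ Q ∈ couplings μ μ,
        (∫⁻ p, ENNReal.ofReal (C p) ∂Pstar) ≤ ∫⁻ p, ENNReal.ofReal (C p) ∂Q) ∧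
      Tendsto (fun ε : ℝ => TVdist (P ε) Pstar) (𝓝[>] (0 : ℝ)) (𝓝 0) ∧
      ¬ IsCompact (msupport Pstar) ∧
      -- there is no lower semicontinuous ambient rate function giving a full LDP
      ¬ ∃ I : S × S → ℝ≥0∞, LowerSemicontinuous I ∧
          (∀ Cl : Set (S × S), IsClosed Cl →
            limsupLog P Cl ≤ -(((⨅ p ∈ Cl, I p : ℝ≥0∞)) : EReal)) ∧
          (∀ O : Set (S × S), IsOpen O →
            -(((⨅ p ∈ O, I p : ℝ≥0∞)) : EReal) ≤ liminfLog P O) := by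
  obtain ⟨w, hw, hsum, c, hc, hwM⟩ := exists_weights
  obtain ⟨S, hS, μ, idx, hμ, hatom, hidxc, hblock⟩ := exists_block_space hw hsum
  have hidx : Measurable idx := hidxc.measurable
  have hδ1 : ∀ ε : ℝ, 0 < ε → Real.exp (-1 / ε) < 1 := fun ε hε => by
    rw [Real.exp_lt_one_iff]
    exact div_neg_of_neg_of_pos (by norm_num) hε
  have hex : ∀ ε : ℝ, ∃ (A : ℝ) (u : ℕ → ℝ), 0 < ε → (∀ n, 0 < u n) ∧ HasSum u A ∧
      ∀ n, (1 - Real.exp (-1 / ε)) * u n ^ 2 + Real.exp (-1 / ε) * A * u n = w n := fun ε => by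
    by_cases hε : 0 < ε
    · obtain ⟨A, u, -, h⟩ := exists_schrodinger_solution hw hsum (Real.exp_pos _) (hδ1 ε hε)
      exact ⟨A, u, fun _ => h⟩
    · exact ⟨0, 0, fun h => absurd h hε⟩
  choose A u hAu using hex
  have hsq : ∀ ε : ℝ, 0 < ε → ∀ n, u ε n ^ 2 ≤ w n := fun ε hε => by
    obtain ⟨hu, hA, h⟩ := hAu ε hε
    exact schrodinger_sq_le (Real.exp_pos _) hu hA h
  have hsqs : ∀ ε : ℝ, 0 < ε → Summable fun n => u ε n ^ 2 := fun ε hε =>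
    Summable.of_nonneg_of_le (fun _ => sq_nonneg _) (hsq ε hε) hsum.summable
  have hu1 : ∀ ε : ℝ, 0 < ε → ∀ n, u ε n ≤ 1 := fun ε hε n => by
    have h1 := (hsq ε hε n).trans (le_hasSum hsum n fun m _ => (hw m).le)
    rw [sq_le_one_iff_abs_le_one] at h1
    exact (le_abs_self _).trans h1
  set C : S × S → ℝ := fun p => if idx p.1 = idx p.2 then 0 else 1 with hC
  have hCc : Continuous C :=
    (continuous_of_discreteTopology (f := fun q : ℕ × ℕ => if q.1 = q.2 then (0 : ℝ) else 1)).comp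
      ((hidxc.comp continuous_fst).prodMk (hidxc.comp continuous_snd))
  have hC0 : ∀ p, 0 ≤ C p := fun p => by simp only [hC]; split_ifs <;> norm_num
  have hC1 : ∀ p, C p ≤ 1 := fun p => by simp only [hC]; split_ifs <;> norm_num
  set P : ℝ → Measure (S × S) := fun ε => blockMeasure μ idx (gibbsDensity ε w (u ε)) with hP
  have hPc : ∀ ε, 0 < ε → P ε ∈ couplings μ μ := fun ε hε => by
    obtain ⟨hu, hA, h⟩ := hAu ε hε
    exact blockMeasure_mem_couplings hidx hblock (gibbsDensity_symm ε w (u ε))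
      (gibbsDensity_marginal hw hu hA h)
  have hPstar : blockMeasure μ idx (diagDensity w) ∈ couplings μ μ :=
    blockMeasure_mem_couplings hidx hblock (diagDensity_symm w) (diagDensity_marginal hw)
  have hoff : ∀ ε, 0 < ε → P ε {p | idx p.1 ≠ idx p.2} = ENNReal.ofReal (1 - ∑' n, u ε n ^ 2) :=
    fun ε hε => by
      have := (hPc ε hε).1
      exact gibbs_offDiag_mass hidx hblock hw (hAu ε hε).1 (hsqs ε hε)
  have hlim : Tendsto (fun ε : ℝ => 1 - ∑' n, u ε n ^ 2) (𝓝[>] 0) (𝓝 0) := by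
    have h1 : Tendsto (fun ε : ℝ => ∑' n, u ε n ^ 2) (𝓝[>] 0) (𝓝 (∑' n, w n)) := by
      refine tendsto_tsum_of_dominated_convergence hsum.summable (fun n => ?_) ?_
      · have h2 : Tendsto (fun ε : ℝ => w n - √(Real.exp (-1 / ε))) (𝓝[>] 0) (𝓝 (w n)) := by
          have h3 : Tendsto (fun ε : ℝ => Real.exp (-1 / ε)) (𝓝[>] 0) (𝓝 0) := by
            refine Real.tendsto_exp_atBot.comp ?_
            refine Tendsto.congr (fun ε => by simp [neg_div]) (
              tendsto_neg_atTop_atBot.comp (tendsto_inv_nhdsGT_zero (𝕜 := ℝ)))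
          simpa using tendsto_const_nhds.sub h3.sqrt
        refine tendsto_of_tendsto_of_tendsto_of_le_of_le' h2 tendsto_const_nhds ?_ ?_
        · filter_upwards [self_mem_nhdsWithin] with ε hε
          obtain ⟨hu, hA, h⟩ := hAu ε hε
          have := schrodinger_sub_sq_le (Real.exp_pos _) (hδ1 ε hε) hsum hu hA h n
          linarith
        · filter_upwards [self_mem_nhdsWithin] with ε hε
          exact hsq ε hε n
      · filter_upwards [self_mem_nhdsWithin] with ε hε n
        rw [Real.norm_of_nonneg (sq_nonneg _)]
        exact hsq ε hε n
    rw [hsum.tsum_eq] at h1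
    simpa using (tendsto_const_nhds (x := (1 : ℝ))).sub h1
  refine ⟨S, hS, μ, C, P, blockMeasure μ idx (diagDensity w), hμ, hatom, hCc, hC0,
    fun ε hε => ⟨hPc ε hε, ?_⟩, hPstar, fun Q _ => ?_, ?_, ?_, ?_⟩
  · obtain ⟨hu, hA, h⟩ := hAu ε hε
    obtain ⟨B, hB⟩ := schrodinger_log_bounded (Real.exp_pos _) (hδ1 ε hε) hw hsum hu hA h
    exact gibbs_coupling_unique_minimiser hCc.measurable hC0 hC1
      (l := fun x => Real.log (u ε (idx x) / w (idx x)))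
      ((measurable_of_countable fun n => Real.log (u ε n / w n)).comp hidx)
      (fun x => hB (idx x)) hε rfl (hPc ε hε)
  · have h1 : ∫⁻ p, ENNReal.ofReal (C p) ∂blockMeasure μ idx (diagDensity w) = 0 := by
      refine (lintegral_blockMeasure hidx hblock (diagDensity w)
        fun n m => ENNReal.ofReal (if n = m then 0 else 1)).trans ?_
      simp only [ENNReal.tsum_eq_zero, mul_eq_zero]
      refine fun n => Or.inl fun m => Or.inl ?_
      by_cases h : n = m <;> simp [diagDensity, h]
    rw [h1]
    exact zero_le
  · have h1 : Tendsto (fun ε : ℝ => ENNReal.ofReal (1 - ∑' n, u ε n ^ 2)) (𝓝[>] 0) (𝓝 0) := by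
      simpa using ENNReal.tendsto_ofReal hlim
    refine tendsto_of_tendsto_of_tendsto_of_le_of_le' tendsto_const_nhds h1
      (Eventually.of_forall fun _ => zero_le) ?_
    filter_upwards [self_mem_nhdsWithin] with ε hε
    have := (hPc ε hε).1
    have := hPstar.1
    rw [← hoff ε hε]
    exact TVdist_le_compl (P := P ε) (Q := blockMeasure μ idx (diagDensity w))
      (D := {p | idx p.1 = idx p.2}) fun s hs =>
      gibbs_inter_diag_le hidx hw (hAu ε hε).1 (hsq ε hε) hs
  · refine not_isCompact_msupport hidxc fun N h0 => ?_
    have h1 : μ (idx ⁻¹' {N + 1}) = 0 := by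
      rw [← hPstar.2.1, Measure.map_apply measurable_fst (hidx (measurableSet_singleton _))]
      refine measure_mono_null (fun p hp => ?_) h0
      have : idx p.1 = N + 1 := hp
      change N < idx p.1
      omega
    rw [hblock, ENNReal.ofReal_eq_zero] at h1
    exact (hw (N + 1)).not_ge h1
  · rintro ⟨I, -, hup, hlo⟩
    have hU : {p : S × S | idx p.1 ≠ idx p.2} =
        ⋃ i : {q : ℕ × ℕ // q.1 ≠ q.2}, {p : S × S | idx p.1 = i.1.1 ∧ idx p.2 = i.1.2} := by
      ext p
      simp only [mem_iUnion]
      refine ⟨fun h => ⟨⟨(idx p.1, idx p.2), h⟩, rfl, rfl⟩, ?_⟩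
      rintro ⟨⟨q, hq⟩, h1, h2⟩ h3
      exact hq (h1.symm.trans (Eq.trans h3 h2))
    have hpair : Continuous fun p : S × S => (idx p.1, idx p.2) :=
      (hidxc.comp continuous_fst).prodMk (hidxc.comp continuous_snd)
    refine not_LDP_of_nonuniform (P := P)
      (O := fun i : {q : ℕ × ℕ // q.1 ≠ q.2} =>
        {p : S × S | idx p.1 = i.1.1 ∧ idx p.2 = i.1.2}) (fun i => ?_) (fun i ε hε => ?_) ?_ ?_
      I hup hlo
    · exact (isOpen_discrete {q : ℕ × ℕ | q.1 = i.1.1 ∧ q.2 = i.1.2}).preimage hpair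
    · exact gibbs_block_mass_le hidx hblock hw (hAu ε hε).1 (hu1 ε hε) i.2
    · rw [← hU]
      exact (isClosed_discrete {q : ℕ × ℕ | q.1 ≠ q.2}).preimage hpair
    · rw [← hU]
      have ht : Tendsto (fun M : ℕ => (8 * Real.log M)⁻¹) atTop (𝓝[>] 0) :=
        tendsto_inv_atTop_nhdsGT_zero.comp
          ((Real.tendsto_log_atTop.comp tendsto_natCast_atTop_atTop).const_mul_atTop
            (by norm_num))
      refine ht.frequently (Eventually.frequently ?_)
      filter_upwards [eventually_gt_atTop 1,
        tendsto_natCast_atTop_atTop.eventually_gt_atTop (4 / c)] with M hM1 hM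
      have hm : (1 : ℝ) < M := by exact_mod_cast hM1
      have hm0 : (0 : ℝ) < M := by linarith
      have hlog : 0 < Real.log M := Real.log_pos hm
      have hε : 0 < (8 * Real.log M)⁻¹ := by positivity
      obtain ⟨hu, hA, h⟩ := hAu _ hε
      have e1 : Real.exp (-1 / (8 * Real.log M)⁻¹) = ((M : ℝ) ^ 8)⁻¹ := by
        rw [div_inv_eq_mul, neg_one_mul, Real.exp_neg, mul_comm, Real.exp_mul, Real.exp_log hm0]
        norm_cast
      have e2 : Real.exp (-1 / (2 * (8 * Real.log M)⁻¹)) = ((M : ℝ) ^ 4)⁻¹ := by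
        rw [show -1 / (2 * (8 * Real.log M)⁻¹) = -(Real.log M * 4) by field_simp; norm_num,
          Real.exp_neg, Real.exp_mul, Real.exp_log hm0]
        norm_cast
      rw [hoff _ hε, e2]
      exact ENNReal.ofReal_le_ofReal
        (schrodinger_offDiag_mass_gt hc hM (fun n hn => hwM M n hn) e1 hsum hu hA h hM1).le

end
end

section
/- Let X, Y be Polish spaces, μ a Borel probability measure on X and ν a Borel probability measure on Y, and let (Q_ε)_{ε>0} ⊆ Π(μ,ν). If the support of μ is noncompact or the support of ν is noncompact, then limsup_{ε↓0} ε log Q_ε(K^c) = 0 for every compact K ⊆ X × Y; in particular, (Q_ε)_{ε>0} is not exponentially tight at speed 1/ε. -/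
open MeasureTheory Filter Set Topology
open scoped ENNReal NNReal Classical

noncomputable section

theorem msupport_eq_support {Z : Type*} [TopologicalSpace Z] [MeasurableSpace Z]
    (μ : Measure Z) : msupport μ = μ.support := by
  ext x
  rw [Measure.mem_support_iff_forall]
  refine ⟨fun h U hU => ?_, fun h U hU hx => h U (hU.mem_nhds hx)⟩
  obtain ⟨V, hVU, hV, hx⟩ := mem_nhds_iff.mp hU
  exact (h V hV hx).trans_le (measure_mono hVU)

theorem measure_compl_pos_of_not_isCompact_msupport {Z : Type*} [TopologicalSpace Z] [T2Space Z]
    [MeasurableSpace Z] {μ : Measure Z} (hμ : ¬ IsCompact (msupport μ)) {A : Set Z}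
    (hA : IsCompact A) : 0 < μ Aᶜ := by
  by_contra h
  refine hμ (hA.of_isClosed_subset ?_ fun x hx => ?_)
  · rw [msupport_eq_support]
    exact Measure.isClosed_support
  · by_contra hxA
    exact h (hx Aᶜ hA.isClosed.isOpen_compl hxA)

theorem limsupLog_eq_zero_of_le {Z : Type*} [MeasurableSpace Z] {Q : ℝ → Measure Z} {S : Set Z}
    {c : ℝ≥0∞} (hc : 0 < c) (hQ : ∀ ε : ℝ, 0 < ε → c ≤ Q ε S ∧ Q ε S ≤ 1) :
    limsupLog Q S = 0 := by
  have hc1 : c ≤ 1 := (hQ 1 one_pos).1.trans (hQ 1 one_pos).2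
  have hcr : 0 < c.toReal := ENNReal.toReal_pos hc.ne' (hc1.trans_lt ENNReal.one_lt_top).ne
  have hlow : Tendsto (fun ε : ℝ => ε * Real.log c.toReal) (𝓝[>] (0 : ℝ)) (𝓝 0) := by
    have : Tendsto (fun ε : ℝ => ε * Real.log c.toReal) (𝓝 0) (𝓝 (0 * Real.log c.toReal)) :=
      tendsto_id.mul_const _
    rw [zero_mul] at this
    exact this.mono_left nhdsWithin_le_nhds
  have hreal : Tendsto (fun ε : ℝ => ε * Real.log (Q ε S).toReal) (𝓝[>] (0 : ℝ)) (𝓝 0) := by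
    refine tendsto_of_tendsto_of_tendsto_of_le_of_le' hlow tendsto_const_nhds ?_ ?_
    · filter_upwards [self_mem_nhdsWithin] with ε hε
      obtain ⟨h1, h2⟩ := hQ ε hε
      exact mul_le_mul_of_nonneg_left (Real.log_le_log hcr
        (ENNReal.toReal_mono (h2.trans_lt ENNReal.one_lt_top).ne h1)) (le_of_lt hε)
    · filter_upwards [self_mem_nhdsWithin] with ε hε
      have h2 := ENNReal.toReal_mono ENNReal.one_ne_top (hQ ε hε).2
      exact mul_nonpos_of_nonneg_of_nonpos (le_of_lt hε)
        (Real.log_nonpos ENNReal.toReal_nonneg (by simpa using h2))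
  have hE : Tendsto (fun ε : ℝ => (ε : EReal) * elog (Q ε S)) (𝓝[>] (0 : ℝ)) (𝓝 0) := by
    refine ((continuous_coe_real_ereal.tendsto 0).comp hreal).congr' ?_
    filter_upwards [self_mem_nhdsWithin] with ε hε
    obtain ⟨h1, h2⟩ := hQ ε hε
    simp [elog, (hc.trans_le h1).ne', (h2.trans_lt ENNReal.one_lt_top).ne]
  exact hE.limsup_eq

theorem le_measure_compl_of_map_eq {Z W : Type*} [MeasurableSpace Z] [TopologicalSpace W]
    [T2Space W] [MeasurableSpace W] [OpensMeasurableSpace W] {P : Measure Z} {μ : Measure W}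
    {f : Z → W} (hf : Measurable f) (hP : P.map f = μ) {K : Set Z} (hK : IsCompact (f '' K)) :
    μ (f '' K)ᶜ ≤ P Kᶜ := by
  rw [← hP, Measure.map_apply hf hK.measurableSet.compl]
  exact measure_mono fun z hz hzK => hz (mem_image_of_mem f hzK)

/-- **Fixed noncompact marginals and exponential tightness** (Proposition 2.6): if
`(Q_ε) ⊆ Π(μ,ν)` and `supp μ` or `supp ν` is noncompact, then
`limsup_{ε↓0} ε log Q_ε(Kᶜ) = 0` for every compact `K ⊆ X × Y`; in particular `(Q_ε)` is
not exponentially tight at speed `1/ε`. -/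
theorem no_exponential_tightness_for_fixed_noncompact_marginals
    {X Y : Type*} [MetricSpace X] [PolishSpace X] [MeasurableSpace X] [BorelSpace X]
    [MetricSpace Y] [PolishSpace Y] [MeasurableSpace Y] [BorelSpace Y]
    (μ : Measure X) (ν : Measure Y)
    (hμ : IsProbabilityMeasure μ) (hν : IsProbabilityMeasure ν)
    (Q : ℝ → Measure (X × Y)) (hQ : ∀ ε : ℝ, 0 < ε → Q ε ∈ couplings μ ν)
    (hsupp : ¬ IsCompact (msupport μ) ∨ ¬ IsCompact (msupport ν)) :
    (∀ K : Set (X × Y), IsCompact K → limsupLog Q Kᶜ = 0) ∧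
    ¬ (∀ M : ℝ, ∃ K : Set (X × Y), IsCompact K ∧ limsupLog Q Kᶜ ≤ ((-M : ℝ) : EReal)) := by
  have hzero : ∀ K : Set (X × Y), IsCompact K → limsupLog Q Kᶜ = 0 := by
    intro K hK
    have hle : ∀ ε : ℝ, 0 < ε → Q ε Kᶜ ≤ 1 := fun ε hε =>
      have := (hQ ε hε).1
      prob_le_one
    rcases hsupp with h | h
    · have hA := hK.image continuous_fst
      exact limsupLog_eq_zero_of_le (measure_compl_pos_of_not_isCompact_msupport h hA)
        fun ε hε => ⟨le_measure_compl_of_map_eq measurable_fst (hQ ε hε).2.1 hA, hle ε hε⟩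
    · have hA := hK.image continuous_snd
      exact limsupLog_eq_zero_of_le (measure_compl_pos_of_not_isCompact_msupport h hA)
        fun ε hε => ⟨le_measure_compl_of_map_eq measurable_snd (hQ ε hε).2.2 hA, hle ε hε⟩
  refine ⟨hzero, fun h => ?_⟩
  obtain ⟨K, hK, hle⟩ := h 1
  rw [hzero K hK, ← EReal.coe_zero, EReal.coe_le_coe_iff] at hle
  linarith

end
end

section
/- For the discrete block model with ε_n := 1/n, let P_n^d be the unique minimiser of J_{ε_n}^d over Π(μ^d,μ^d), and set Δ_n := P_n^d(B_n × B_n^c), d_n := P_n^d((n,1),(n,1)), o_n := P_n^d((n,1),(n,2)), and F_n := {((n,i),(n,j)) : 1 ≤ i ≠ j ≤ m_n}. Then: (a) Δ_n ≤ ε_n·H(μ^d)/(2 L_n) for all n; (b) d_n ≥ (1/4)·w_n/(m_n+1) for all sufficiently large n; (c) P_n^d(F_n) = m_n(m_n−1)·o_n ≥ (w_n/16)·e^{−(b−κ)n} for all sufficiently large n. -/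
open MeasureTheory Filter Set Topology
open scoped ENNReal NNReal Classical

noncomputable section

/-- `m_n := max{2, ⌊e^{κ n}⌋}`. -/
def mseq (κ : ℝ) (n : ℕ) : ℕ := max 2 ⌊Real.exp (κ * n)⌋₊

/-- `L_n := n ^ 4`. -/
def Lseq (n : ℕ) : ℕ := n ^ 4

/-- `ζ(3) = ∑_{n ≥ 1} n⁻³`. -/
def zeta3 : ℝ := ∑' k : ℕ, (((k : ℝ) + 1) ^ 3)⁻¹

/-- `w_n := (1/ζ(3)) n⁻³`. -/
def wseq (n : ℕ) : ℝ := (1 / zeta3) * ((n : ℝ) ^ 3)⁻¹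

/-- The discrete state space `X^d = {(n,i) : n ≥ 1, 0 ≤ i ≤ m_n}` (a countable discrete
Polish space, as a subtype of `ℕ × ℕ`). -/
abbrev XdT (κ : ℝ) := {p : ℕ × ℕ // 1 ≤ p.1 ∧ p.2 ≤ mseq κ p.1}

lemma one_le_mseq (κ : ℝ) (n : ℕ) : 1 ≤ mseq κ n :=
  le_trans one_le_two (le_max_left _ _)

lemma two_le_mseq (κ : ℝ) (n : ℕ) : 2 ≤ mseq κ n := le_max_left _ _

/-- The measure `μ^d` with `μ^d({(n,i)}) = w_n / (m_n + 1)`. -/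
def mud (κ : ℝ) : Measure (XdT κ) :=
  Measure.sum (fun x : XdT κ =>
    ENNReal.ofReal (wseq x.1.1 / ((mseq κ x.1.1 : ℝ) + 1)) • Measure.dirac x)

/-- The block cost `C^d`. -/
def CdBlock (a b κ : ℝ) (p : XdT κ × XdT κ) : ℝ :=
  if p.1.1.1 = p.2.1.1 then
    (if p.1.1.2 = p.2.1.2 then 0
     else if p.1.1.2 = 0 ∨ p.2.1.2 = 0 then a
     else b)
  else ((Lseq p.1.1.1 : ℝ) + (Lseq p.2.1.1 : ℝ))

/-- The diagonal coupling `P^d_*(x,y) = μ^d(x) 1_{x=y}`. -/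
def Pdstar (κ : ℝ) : Measure (XdT κ × XdT κ) := (mud κ).map (fun x => (x, x))

/-- The entropy `H(μ^d) = ∑_x μ^d(x) log(1/μ^d(x))`. -/
def Hd (κ : ℝ) : ℝ :=
  ∑' x : XdT κ, ((mud κ) {x}).toReal * Real.log (1 / ((mud κ) {x}).toReal)

/-- The block `B_n = {(n,i) : 0 ≤ i ≤ m_n}`. -/
def Bset (κ : ℝ) (n : ℕ) : Set (XdT κ) := {x | x.1.1 = n}

/-- The within-block off-diagonal set
`F_n = {((n,i),(n,j)) : 1 ≤ i ≠ j ≤ m_n}`. -/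
def FnSet (κ : ℝ) (n : ℕ) : Set (XdT κ × XdT κ) :=
  {p | p.1.1.1 = n ∧ p.2.1.1 = n ∧ 1 ≤ p.1.1.2 ∧ 1 ≤ p.2.1.2 ∧ p.1.1.2 ≠ p.2.1.2}

lemma absolutelyContinuous_of_singleton_ne_zero {Z : Type*} [MeasurableSpace Z] {P R : Measure Z}
    (hR : ∀ z, R {z} ≠ 0) : P ≪ R := by
  intro s hs
  have : s = ∅ := by
    by_contra hne
    obtain ⟨z, hz⟩ := Set.nonempty_iff_ne_empty.2 hne
    exact hR z (measure_mono_null (Set.singleton_subset_iff.2 hz) hs)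
  simp [this]

lemma KL_nonneg {Z : Type*} [MeasurableSpace Z] {P R : Measure Z}
    [IsProbabilityMeasure P] [IsProbabilityMeasure R] : 0 ≤ KL P R := by
  rw [KL]
  split_ifs with h
  · have := InformationTheory.integral_llr_add_sub_measure_univ_nonneg h.1 h.2
    simp only [probReal_univ, add_sub_cancel_right] at this
    exact_mod_cast this
  · exact le_top

section CountableRelativeEntropy

variable {Z : Type*} [MeasurableSpace Z] [Countable Z] [MeasurableSingletonClass Z]

/-- On a countable space, integrability is absolute summability against the point masses. -/
lemma integrable_iff_summable_real_singleton (P : Measure Z) [IsFiniteMeasure P] (f : Z → ℝ) :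
    Integrable f P ↔ Summable fun z => P.real {z} * f z := by
  have h := integrable_sum_dirac_iff (X := Z) (f := f) (x := fun z : Z => z)
    (c := fun z => P {z}) (fun z => measure_ne_top P _)
  rw [Measure.sum_smul_dirac] at h
  rw [h, ← summable_abs_iff (f := fun z => P.real {z} * f z)]
  simp [abs_mul, measureReal_def]

lemma toReal_rnDeriv_eq_div {P R : Measure Z} [IsFiniteMeasure P] [IsFiniteMeasure R]
    (hR : ∀ z, R {z} ≠ 0) (z : Z) :
    (P.rnDeriv R z).toReal = P.real {z} / R.real {z} := by
  have h := congrArg (fun ν : Measure Z => ν {z})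
    (Measure.withDensity_rnDeriv_eq P R (absolutelyContinuous_of_singleton_ne_zero hR))
  simp only [withDensity_apply _ (measurableSet_singleton z), Measure.restrict_singleton,
    lintegral_smul_measure, lintegral_dirac, smul_eq_mul] at h
  have hz : R.real {z} ≠ 0 := by
    simp [measureReal_def, ENNReal.toReal_eq_zero_iff, hR z]
  rw [eq_div_iff hz, measureReal_def, measureReal_def, ← h, ENNReal.toReal_mul, mul_comm]

/-- The summand of the relative entropy on a countable space. -/
def entropyTerm (P R : Measure Z) (z : Z) : ℝ :=
  P.real {z} * Real.log (P.real {z} / R.real {z})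

lemma KL_eq_of_summable {P R : Measure Z} [IsFiniteMeasure P] [IsFiniteMeasure R]
    (hR : ∀ z, R {z} ≠ 0) (h : Summable (entropyTerm P R)) :
    KL P R = ((∑' z, entropyTerm P R z : ℝ) : EReal) := by
  have hi : Integrable (fun x => Real.log ((P.rnDeriv R x).toReal)) P := by
    rw [integrable_iff_summable_real_singleton]
    simp only [toReal_rnDeriv_eq_div hR]
    exact h
  rw [KL, if_pos ⟨absolutelyContinuous_of_singleton_ne_zero hR, hi⟩, integral_countable hi]
  simp only [toReal_rnDeriv_eq_div hR, smul_eq_mul, entropyTerm]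

lemma KL_eq_top_of_not_summable {P R : Measure Z} [IsFiniteMeasure P] [IsFiniteMeasure R]
    (hR : ∀ z, R {z} ≠ 0) (h : ¬ Summable (entropyTerm P R)) : KL P R = ⊤ := by
  rw [KL, if_neg]
  rintro ⟨-, hi⟩
  rw [integrable_iff_summable_real_singleton] at hi
  simp only [toReal_rnDeriv_eq_div hR] at hi
  exact h hi

/-- The summand of the entropic functional on a countable space. -/
def entropicTerm (C : Z → ℝ) (R : Measure Z) (ε : ℝ) (P : Measure Z) (z : Z) : ℝ :=
  C z * P.real {z} + ε * entropyTerm P R z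

lemma lintegral_ofReal_eq_tsum {C : Z → ℝ} (hC : ∀ z, 0 ≤ C z) (P : Measure Z)
    [IsFiniteMeasure P] :
    ∫⁻ z, ENNReal.ofReal (C z) ∂P = ∑' z, ENNReal.ofReal (C z * P.real {z}) := by
  rw [lintegral_countable']
  refine tsum_congr fun z => ?_
  rw [ENNReal.ofReal_mul (hC z), ofReal_measureReal]

lemma Jfun_eq_of_summable {C : Z → ℝ} (hC : ∀ z, 0 ≤ C z) {P R : Measure Z} [IsFiniteMeasure P]
    [IsFiniteMeasure R] (hR : ∀ z, R {z} ≠ 0) (ε : ℝ)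
    (hcost : Summable fun z => C z * P.real {z}) (hent : Summable (entropyTerm P R)) :
    Jfun C R ε P = ((∑' z, entropicTerm C R ε P z : ℝ) : EReal) := by
  have hnn : ∀ z, 0 ≤ C z * P.real {z} := fun z => mul_nonneg (hC z) measureReal_nonneg
  rw [Jfun, KL_eq_of_summable hR hent, lintegral_ofReal_eq_tsum hC,
    ← ENNReal.ofReal_tsum_of_nonneg hnn hcost, EReal.coe_ennreal_ofReal,
    max_eq_left (tsum_nonneg hnn)]
  unfold entropicTerm
  rw [hcost.tsum_add (hent.mul_left ε), tsum_mul_left]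
  push_cast
  rfl

lemma summable_of_Jfun_ne_top {C : Z → ℝ} (hC : ∀ z, 0 ≤ C z) {P R : Measure Z}
    [IsProbabilityMeasure P] [IsProbabilityMeasure R] (hR : ∀ z, R {z} ≠ 0) {ε : ℝ} (hε : 0 < ε)
    (h : Jfun C R ε P ≠ ⊤) :
    (Summable fun z => C z * P.real {z}) ∧ Summable (entropyTerm P R) := by
  have hent : Summable (entropyTerm P R) := by
    by_contra hns
    refine h ?_
    rw [Jfun, KL_eq_top_of_not_summable hR hns, EReal.coe_mul_top_of_pos hε,
      EReal.add_top_of_ne_bot]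
    exact EReal.coe_ennreal_ne_bot _
  refine ⟨?_, hent⟩
  by_contra hns
  refine h ?_
  have hnn : ∀ z, 0 ≤ C z * P.real {z} := fun z => mul_nonneg (hC z) measureReal_nonneg
  have htop : ∫⁻ z, ENNReal.ofReal (C z) ∂P = ⊤ := by
    rw [lintegral_ofReal_eq_tsum hC]
    by_contra hne
    refine hns ?_
    have := ENNReal.summable_toReal hne
    simpa only [ENNReal.toReal_ofReal (hnn _)] using this
  rw [Jfun, htop, KL_eq_of_summable hR hent, ← EReal.coe_mul]
  exact EReal.top_add_coe _

/-- The entropic functional is invariant under a relabelling which preserves the cost and the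
reference measure. -/
lemma Jfun_map_equiv {C : Z → ℝ} {P R : Measure Z} [IsFiniteMeasure P]
    [IsFiniteMeasure R] (hR : ∀ z, R {z} ≠ 0) (ε : ℝ) (e : Z ≃ Z) (hCe : ∀ z, C (e z) = C z)
    (hRe : ∀ z, R {e z} = R {z}) :
    Jfun C R ε (P.map e) = Jfun C R ε P := by
  have hsingle : ∀ z, P.map e {e z} = P {z} := fun z => by
    rw [Measure.map_apply (measurable_of_countable e) (measurableSet_singleton _)]
    congr 1
    ext y
    simp
  have hfin : IsFiniteMeasure (P.map e) := Measure.isFiniteMeasure_map P e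
  have hterm : ∀ z, entropyTerm (P.map e) R (e z) = entropyTerm P R z := fun z => by
    simp only [entropyTerm, measureReal_def, hsingle, hRe]
  have hKL : KL (P.map e) R = KL P R := by
    by_cases h : Summable (entropyTerm P R)
    · have h' : Summable (entropyTerm (P.map e) R) := by
        rw [← e.summable_iff]
        exact h.congr fun z => (hterm z).symm
      rw [KL_eq_of_summable hR h, KL_eq_of_summable hR h',
        ← e.tsum_eq (entropyTerm (P.map e) R)]
      simp only [hterm]
    · have h' : ¬ Summable (entropyTerm (P.map e) R) := by
        rw [← e.summable_iff]
        exact fun hs => h (hs.congr hterm)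
      rw [KL_eq_top_of_not_summable hR h, KL_eq_top_of_not_summable hR h']
  rw [Jfun, Jfun, hKL, lintegral_map (measurable_of_countable _) (measurable_of_countable _)]
  simp only [hCe]

/-- Comparison of the entropic functional at a minimiser with a measure differing from it only
at finitely many points reduces to those points. -/
lemma sum_entropicTerm_le_of_Jfun_le {C : Z → ℝ} (hC : ∀ z, 0 ≤ C z) {P P' R : Measure Z}
    [IsProbabilityMeasure P] [IsFiniteMeasure P'] [IsProbabilityMeasure R]
    (hR : ∀ z, R {z} ≠ 0) {ε : ℝ} (hε : 0 < ε) (hP : Jfun C R ε P ≠ ⊤) (S : Finset Z)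
    (hS : ∀ z ∉ S, P' {z} = P {z}) (hle : Jfun C R ε P ≤ Jfun C R ε P') :
    ∑ z ∈ S, entropicTerm C R ε P z ≤ ∑ z ∈ S, entropicTerm C R ε P' z := by
  obtain ⟨hcost, hent⟩ := summable_of_Jfun_ne_top hC hR hε hP
  have hcof : ∀ᶠ z in Filter.cofinite, z ∉ S := S.finite_toSet.eventually_cofinite_notMem
  have hcost' : Summable fun z => C z * P'.real {z} := by
    refine (summable_congr_cofinite ?_).1 hcost
    filter_upwards [hcof] with z hz
    simp only [measureReal_def, hS z hz]
  have hent' : Summable (entropyTerm P' R) := by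
    refine (summable_congr_cofinite ?_).1 hent
    filter_upwards [hcof] with z hz
    simp only [entropyTerm, measureReal_def, hS z hz]
  rw [Jfun_eq_of_summable hC hR ε hcost hent, Jfun_eq_of_summable hC hR ε hcost' hent',
    EReal.coe_le_coe_iff] at hle
  have hs : Summable (entropicTerm C R ε P) := hcost.add (hent.mul_left ε)
  have hs' : Summable (entropicTerm C R ε P') := hcost'.add (hent'.mul_left ε)
  have hdiff : ∑' z, (entropicTerm C R ε P' z - entropicTerm C R ε P z) =
      ∑ z ∈ S, (entropicTerm C R ε P' z - entropicTerm C R ε P z) := by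
    refine tsum_eq_sum fun z hz => ?_
    simp only [entropicTerm, entropyTerm, measureReal_def, hS z hz, sub_self]
  rw [hs'.tsum_sub hs, Finset.sum_sub_distrib] at hdiff
  linarith

end CountableRelativeEntropy

/-- Among all splittings of a given mass into `o + d`, the one minimising
`β o + o log (o / q) + d log (d / q)` satisfies `o = exp (-β) d`. -/
lemma eq_exp_neg_mul_of_split_minimal {o d q β : ℝ} (ho : 0 ≤ o) (hd : 0 ≤ d) (hq : 0 < q)
    (hmin : ∀ o' d' : ℝ, 0 ≤ o' → 0 ≤ d' → o' + d' = o + d →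
      β * o + o * Real.log (o / q) + d * Real.log (d / q) ≤
        β * o' + o' * Real.log (o' / q) + d' * Real.log (d' / q)) :
    o = Real.exp (-β) * d := by
  set r := Real.exp (-β) with hr
  have hr0 : 0 < r := Real.exp_pos _
  rcases (add_nonneg ho hd).eq_or_lt with hs | hs
  · have h1 : o = 0 := by linarith
    have h2 : d = 0 := by linarith
    simp [h1, h2]
  set D := (o + d) / (1 + r) with hD
  have hD0 : 0 < D := by positivity
  have hsum : r * D + D = o + d := by rw [hD]; field_simp; ring
  have h := hmin (r * D) D (by positivity) hD0.le hsum
  have hlog : Real.log (r * D / q) = Real.log (D / q) - β := by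
    rw [mul_div_assoc, Real.log_mul hr0.ne' (by positivity), hr, Real.log_exp]; ring
  have ho' : o * Real.log (o / q) =
      o * Real.log (o / (r * D)) + o * (Real.log (D / q) - β) := by
    rcases ho.eq_or_lt with h0 | h0
    · simp [← h0]
    · rw [← hlog, ← mul_add, ← Real.log_mul (by positivity) (by positivity)]
      congr 2; field_simp
  have hd' : d * Real.log (d / q) = d * Real.log (d / D) + d * Real.log (D / q) := by
    rcases hd.eq_or_lt with h0 | h0
    · simp [← h0]
    · rw [← mul_add, ← Real.log_mul (by positivity) (by positivity)]
      congr 2; field_simp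
  have ek : ∀ x y : ℝ, 0 < y →
      y * InformationTheory.klFun (x / y) = x * Real.log (x / y) + y - x := fun x y hy => by
    rw [InformationTheory.klFun]; field_simp
  have e1 := ek o (r * D) (by positivity)
  have e2 := ek d D hD0
  have k1 : 0 ≤ InformationTheory.klFun (o / (r * D)) :=
    InformationTheory.klFun_nonneg (by positivity)
  have k2 : 0 ≤ InformationTheory.klFun (d / D) :=
    InformationTheory.klFun_nonneg (by positivity)
  have hs2 : (r * D + D) * Real.log (D / q) = (o + d) * Real.log (D / q) := by rw [hsum]
  have m1 : 0 ≤ r * D * InformationTheory.klFun (o / (r * D)) := by positivity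
  have m2 : 0 ≤ D * InformationTheory.klFun (d / D) := by positivity
  rw [hlog, ho', hd'] at h
  have hz1 : D * InformationTheory.klFun (d / D) = 0 := by nlinarith
  have hdD : d / D = 1 := by
    rw [← InformationTheory.klFun_eq_zero_iff (by positivity)]
    exact (mul_eq_zero.1 hz1).resolve_left hD0.ne'
  have : d = D := by rwa [div_eq_one_iff_eq hD0.ne'] at hdD
  rw [this] at hsum ⊢
  linarith

/-- The measure giving mass `d` to `(x, x)`, `(y, y)` and mass `o` to `(x, y)`, `(y, x)`. -/
def squareMeasure {X : Type*} [MeasurableSpace X] (x y : X) (d o : ℝ≥0∞) : Measure (X × X) :=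
  d • Measure.dirac (x, x) + d • Measure.dirac (y, y) +
    (o • Measure.dirac (x, y) + o • Measure.dirac (y, x))

lemma squareMeasure_map_fst {X : Type*} [MeasurableSpace X] (x y : X) (d o : ℝ≥0∞) :
    (squareMeasure x y d o).map Prod.fst =
      (d + o) • Measure.dirac x + (d + o) • Measure.dirac y := by
  simp only [squareMeasure, Measure.map_add _ _ measurable_fst, Measure.map_smul,
    Measure.map_dirac' measurable_fst, add_smul]
  abel

lemma squareMeasure_map_snd {X : Type*} [MeasurableSpace X] (x y : X) (d o : ℝ≥0∞) :
    (squareMeasure x y d o).map Prod.snd =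
      (d + o) • Measure.dirac x + (d + o) • Measure.dirac y := by
  simp only [squareMeasure, Measure.map_add _ _ measurable_snd, Measure.map_smul,
    Measure.map_dirac' measurable_snd, add_smul]
  abel

/-- The corners of the square spanned by `x` and `y`. -/
def squareFinset {X : Type*} (x y : X) : Finset (X × X) := {(x, x), (y, y), (x, y), (y, x)}

lemma sum_squareFinset {X : Type*} {x y : X} (hxy : x ≠ y) (f : X × X → ℝ) :
    ∑ z ∈ squareFinset x y, f z = f (x, x) + (f (y, y) + (f (x, y) + f (y, x))) := by
  rw [squareFinset, Finset.sum_insert, Finset.sum_insert, Finset.sum_insert,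
    Finset.sum_singleton] <;> simp [hxy, hxy.symm]

lemma prod_self_singleton {X : Type*} [MeasurableSpace X] {μ : Measure X} [SFinite μ] (x y : X) :
    (μ.prod μ) {(x, y)} = μ {x} * μ {y} := by
  rw [← Set.singleton_prod_singleton, Measure.prod_prod]

section CouplingModification

variable {X : Type*} [MeasurableSpace X] [Countable X] [MeasurableSingletonClass X]

/-- In a coupling that is symmetric on the square spanned by two points, the mass of the square
may be redistributed symmetrically without changing the marginals. -/
lemma exists_coupling_modify {μ ν : Measure X} {P : Measure (X × X)} (hP : P ∈ couplings μ ν)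
    {x y : X} (hxy : x ≠ y) (hd : P {(y, y)} = P {(x, x)}) (ho : P {(y, x)} = P {(x, y)})
    {d o : ℝ≥0∞} (hsum : d + o = P {(x, x)} + P {(x, y)}) :
    ∃ P' ∈ couplings μ ν, (∀ z ∉ squareFinset x y, P' {z} = P {z}) ∧
      P' {(x, x)} = d ∧ P' {(y, y)} = d ∧ P' {(x, y)} = o ∧ P' {(y, x)} = o := by
  set S : Set (X × X) := ↑(squareFinset x y) with hS
  have hmem : ∀ z, z ∈ S ↔ z = (x, x) ∨ z = (y, y) ∨ z = (x, y) ∨ z = (y, x) := fun z => by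
    simp [hS, squareFinset]
  have hSm : MeasurableSet Sᶜ := S.to_countable.measurableSet.compl
  have hout : ∀ (d o : ℝ≥0∞) (z : X × X), z ∉ S →
      (P.restrict Sᶜ + squareMeasure x y d o) {z} = P {z} := by
    intro d o z hz
    have hz' := hz
    simp only [hmem, not_or] at hz'
    obtain ⟨h1, h2, h3, h4⟩ := hz'
    have h0 : P.restrict Sᶜ {z} = P {z} := by
      rw [Measure.restrict_apply (measurableSet_singleton z),
        Set.inter_eq_left.2 (Set.singleton_subset_iff.2 hz)]
    simp [squareMeasure, h0, Ne.symm h1, Ne.symm h2, Ne.symm h3, Ne.symm h4]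
  have hin : ∀ (d o : ℝ≥0∞) (z : X × X), z ∈ S →
      (P.restrict Sᶜ + squareMeasure x y d o) {z} = squareMeasure x y d o {z} := by
    intro d o z hz
    have h0 : P.restrict Sᶜ {z} = 0 := by
      rw [Measure.restrict_apply (measurableSet_singleton z),
        Set.singleton_inter_eq_empty.2 (by simpa using hz), measure_empty]
    rw [Measure.add_apply, h0, zero_add]
  have hc : ∀ d o : ℝ≥0∞, squareMeasure x y d o {(x, x)} = d ∧
      squareMeasure x y d o {(y, y)} = d ∧ squareMeasure x y d o {(x, y)} = o ∧
      squareMeasure x y d o {(y, x)} = o := by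
    intro d o
    simp [squareMeasure, hxy, hxy.symm]
  have m1 : (x, x) ∈ S := by simp [hmem]
  have m2 : (y, y) ∈ S := by simp [hmem]
  have m3 : (x, y) ∈ S := by simp [hmem]
  have m4 : (y, x) ∈ S := by simp [hmem]
  have hPeq : P = P.restrict Sᶜ + squareMeasure x y (P {(x, x)}) (P {(x, y)}) := by
    refine Measure.ext_of_singleton fun z => ?_
    by_cases hz : z ∈ S
    · obtain ⟨c1, c2, c3, c4⟩ := hc (P {(x, x)}) (P {(x, y)})
      rw [hin _ _ z hz]
      rcases (hmem z).1 hz with rfl | rfl | rfl | rfl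
      · rw [c1]
      · rw [c2, hd]
      · rw [c3]
      · rw [c4, ho]
    · rw [hout _ _ z hz]
  obtain ⟨hprob, hfst, hsnd⟩ := hP
  have hfst' : (P.restrict Sᶜ + squareMeasure x y d o).map Prod.fst = μ := by
    rw [← hfst]
    conv_rhs => rw [hPeq]
    rw [Measure.map_add _ _ measurable_fst, Measure.map_add _ _ measurable_fst,
      squareMeasure_map_fst, squareMeasure_map_fst, hsum]
  have hsnd' : (P.restrict Sᶜ + squareMeasure x y d o).map Prod.snd = ν := by
    rw [← hsnd]
    conv_rhs => rw [hPeq]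
    rw [Measure.map_add _ _ measurable_snd, Measure.map_add _ _ measurable_snd,
      squareMeasure_map_snd, squareMeasure_map_snd, hsum]
  have hprob' : IsProbabilityMeasure (P.restrict Sᶜ + squareMeasure x y d o) := by
    constructor
    rw [← Set.preimage_univ (f := Prod.fst), ← Measure.map_apply measurable_fst .univ, hfst',
      ← hfst, Measure.map_apply measurable_fst .univ, Set.preimage_univ, measure_univ]
  obtain ⟨c1, c2, c3, c4⟩ := hc d o
  exact ⟨_, ⟨hprob', hfst', hsnd'⟩, fun z hz => hout d o z hz, by rw [hin _ _ _ m1, c1],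
    by rw [hin _ _ _ m2, c2], by rw [hin _ _ _ m3, c3], by rw [hin _ _ _ m4, c4]⟩

/-- First-order optimality of an entropic optimal coupling on a symmetric square. -/
lemma real_offDiag_eq_exp_mul_real_diag {C : X × X → ℝ} (hC : ∀ z, 0 ≤ C z) {μ : Measure X}
    [IsProbabilityMeasure μ] (hμ : ∀ x, μ {x} ≠ 0) {ε : ℝ} (hε : 0 < ε) {P : Measure (X × X)}
    (hP : P ∈ couplings μ μ) (hmin : ∀ Q ∈ couplings μ μ, Jfun C (μ.prod μ) ε P ≤
      Jfun C (μ.prod μ) ε Q) (hfin : Jfun C (μ.prod μ) ε P ≠ ⊤)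
    {x y : X} (hxy : x ≠ y) (hμxy : μ {y} = μ {x}) {c : ℝ} (hCxx : C (x, x) = 0)
    (hCyy : C (y, y) = 0) (hCxy : C (x, y) = c) (hCyx : C (y, x) = c)
    (hd : P {(y, y)} = P {(x, x)}) (ho : P {(y, x)} = P {(x, y)}) :
    P.real {(x, y)} = Real.exp (-(c / ε)) * P.real {(x, x)} := by
  have hprob : IsProbabilityMeasure P := hP.1
  have hR : ∀ z, (μ.prod μ) {z} ≠ 0 := fun z => by
    rw [prod_self_singleton z.1 z.2]
    exact mul_ne_zero (hμ _) (hμ _)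
  set q : ℝ := (μ.prod μ).real {(x, x)} with hq
  have hq0 : 0 < q := by
    refine lt_of_le_of_ne measureReal_nonneg (Ne.symm ?_)
    simp [hq, measureReal_def, ENNReal.toReal_eq_zero_iff, hR]
  have hqyy : (μ.prod μ).real {(y, y)} = q := by
    simp only [hq, measureReal_def, prod_self_singleton, hμxy]
  have hqxy : (μ.prod μ).real {(x, y)} = q := by
    simp only [hq, measureReal_def, prod_self_singleton, hμxy]
  have hqyx : (μ.prod μ).real {(y, x)} = q := by
    simp only [hq, measureReal_def, prod_self_singleton, hμxy]
  refine eq_exp_neg_mul_of_split_minimal measureReal_nonneg measureReal_nonneg hq0 ?_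
  intro o' d' ho' hd' hsum
  have hsum' : ENNReal.ofReal d' + ENNReal.ofReal o' = P {(x, x)} + P {(x, y)} := by
    rw [← ENNReal.ofReal_add hd' ho', add_comm, hsum,
      ENNReal.ofReal_add measureReal_nonneg measureReal_nonneg, ofReal_measureReal,
      ofReal_measureReal, add_comm]
  obtain ⟨P', hP', hout, h1, h2, h3, h4⟩ := exists_coupling_modify hP hxy hd ho hsum'
  have hprob' : IsProbabilityMeasure P' := hP'.1
  have key := sum_entropicTerm_le_of_Jfun_le hC hR hε hfin (squareFinset x y) hout (hmin P' hP')
  have hdr : P.real {(y, y)} = P.real {(x, x)} := by simp only [measureReal_def, hd]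
  have hor : P.real {(y, x)} = P.real {(x, y)} := by simp only [measureReal_def, ho]
  have r1 : P'.real {(x, x)} = d' := by rw [measureReal_def, h1, ENNReal.toReal_ofReal hd']
  have r2 : P'.real {(y, y)} = d' := by rw [measureReal_def, h2, ENNReal.toReal_ofReal hd']
  have r3 : P'.real {(x, y)} = o' := by rw [measureReal_def, h3, ENNReal.toReal_ofReal ho']
  have r4 : P'.real {(y, x)} = o' := by rw [measureReal_def, h4, ENNReal.toReal_ofReal ho']
  rw [sum_squareFinset hxy, sum_squareFinset hxy] at key
  simp only [entropicTerm, entropyTerm, r1, r2, r3, r4, hdr, hor, hCxx, hCyy, hCxy, hCyx, hqyy,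
    hqxy, hqyx, ← hq] at key
  refine le_of_mul_le_mul_left ?_ hε
  have hcε : ∀ t : ℝ, ε * (c / ε * t) = c * t := fun t => by field_simp
  simp only [mul_add, hcε]
  linarith

/-- A relabelling preserving the marginal transports couplings to couplings. -/
lemma map_prodCongr_mem_couplings {μ : Measure X} (e : X ≃ X) (hμe : μ.map e = μ)
    {P : Measure (X × X)} (hP : P ∈ couplings μ μ) :
    P.map (e.prodCongr e) ∈ couplings μ μ := by
  obtain ⟨hprob, hfst, hsnd⟩ := hP
  have hm : Measurable (e.prodCongr e) := measurable_of_countable _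
  have he : Measurable e := measurable_of_countable _
  refine ⟨Measure.isProbabilityMeasure_map hm.aemeasurable, ?_, ?_⟩
  · rw [Measure.map_map measurable_fst hm]
    change P.map (e ∘ Prod.fst) = μ
    rw [← Measure.map_map he measurable_fst, hfst, hμe]
  · rw [Measure.map_map measurable_snd hm]
    change P.map (e ∘ Prod.snd) = μ
    rw [← Measure.map_map he measurable_snd, hsnd, hμe]

/-- A unique entropic minimiser inherits the symmetries of the cost and of the marginal. -/
lemma minimiser_map_eq {C : X × X → ℝ} {μ : Measure X}
    [IsProbabilityMeasure μ] (hμ : ∀ x, μ {x} ≠ 0) {ε : ℝ} {P : Measure (X × X)}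
    (hP : P ∈ couplings μ μ) (hmin : ∀ Q ∈ couplings μ μ, Jfun C (μ.prod μ) ε P ≤
      Jfun C (μ.prod μ) ε Q)
    (huniq : ∀ Q ∈ couplings μ μ, (∀ R ∈ couplings μ μ, Jfun C (μ.prod μ) ε Q ≤
      Jfun C (μ.prod μ) ε R) → Q = P)
    (e : X ≃ X) (hμe : ∀ x, μ {e x} = μ {x}) (hCe : ∀ x y, C (e x, e y) = C (x, y)) :
    P.map (e.prodCongr e) = P := by
  have hprob : IsProbabilityMeasure P := hP.1
  have hR : ∀ z, (μ.prod μ) {z} ≠ 0 := fun z => by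
    rw [prod_self_singleton z.1 z.2]
    exact mul_ne_zero (hμ _) (hμ _)
  have hmap : μ.map e = μ := by
    refine Measure.ext_of_singleton fun u => ?_
    rw [Measure.map_apply (measurable_of_countable e) (measurableSet_singleton _),
      show e ⁻¹' {u} = {e.symm u} by ext v; simp [Equiv.eq_symm_apply], ← hμe (e.symm u),
      e.apply_symm_apply]
  have hJ := Jfun_map_equiv (P := P) hR ε (e.prodCongr e) (fun z => hCe z.1 z.2) (fun z => by
    change (μ.prod μ) {(e z.1, e z.2)} = (μ.prod μ) {(z.1, z.2)}
    rw [prod_self_singleton, prod_self_singleton, hμe, hμe])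
  exact huniq _ (map_prodCongr_mem_couplings e hmap hP) fun R hRc => hJ.trans_le (hmin R hRc)

end CouplingModification

section BlockModel

lemma zeta3_pos : 0 < zeta3 := by
  have hs : Summable fun k : ℕ => (((k : ℝ) + 1) ^ 3)⁻¹ := by
    have := (summable_nat_add_iff 1).2 (Real.summable_nat_pow_inv (p := 3).2 (by norm_num))
    simpa using this
  exact hs.tsum_pos (fun k => by positivity) 0 (by norm_num)

lemma wseq_pos {n : ℕ} (hn : 1 ≤ n) : 0 < wseq n := by
  have h := zeta3_pos
  have hn' : (0 : ℝ) < n := by exact_mod_cast hn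
  unfold wseq
  positivity

lemma mud_singleton (κ : ℝ) (x : XdT κ) :
    mud κ {x} = ENNReal.ofReal (wseq x.1.1 / ((mseq κ x.1.1 : ℝ) + 1)) :=
  Measure.sum_smul_dirac_singleton

lemma mass_pos (κ : ℝ) (x : XdT κ) : 0 < wseq x.1.1 / ((mseq κ x.1.1 : ℝ) + 1) :=
  div_pos (wseq_pos x.2.1) (by positivity)

lemma mud_singleton_ne_zero (κ : ℝ) (x : XdT κ) : mud κ {x} ≠ 0 := by
  rw [mud_singleton]
  exact (ENNReal.ofReal_pos.2 (mass_pos κ x)).ne'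

lemma toReal_mud_singleton (κ : ℝ) (x : XdT κ) :
    (mud κ {x}).toReal = wseq x.1.1 / ((mseq κ x.1.1 : ℝ) + 1) := by
  rw [mud_singleton, ENNReal.toReal_ofReal (mass_pos κ x).le]

lemma mud_singleton_congr {κ : ℝ} {x y : XdT κ} (h : x.1.1 = y.1.1) :
    mud κ {x} = mud κ {y} := by
  rw [mud_singleton, mud_singleton, h]

lemma CdBlock_nonneg {a b : ℝ} (ha : 0 ≤ a) (hb : 0 ≤ b) (κ : ℝ) (p : XdT κ × XdT κ) :
    0 ≤ CdBlock a b κ p := by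
  unfold CdBlock
  split_ifs <;> positivity

lemma CdBlock_self (a b κ : ℝ) (x : XdT κ) : CdBlock a b κ (x, x) = 0 := by
  simp [CdBlock]

lemma CdBlock_of_ne {a b κ : ℝ} {x y : XdT κ} (hxy : x ≠ y) (h : x.1.1 = y.1.1)
    (hx : 1 ≤ x.1.2) (hy : 1 ≤ y.1.2) : CdBlock a b κ (x, y) = b := by
  have h2 : x.1.2 ≠ y.1.2 := fun h' => hxy (Subtype.ext (Prod.ext h h'))
  have hx0 : x.1.2 ≠ 0 := by omega
  have hy0 : y.1.2 ≠ 0 := by omega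
  simp [CdBlock, h, h2, hx0, hy0]

lemma Lseq_le_CdBlock_of_block_ne (a b κ : ℝ) {n : ℕ} {p : XdT κ × XdT κ}
    (h : p.1.1.1 = n ∧ p.2.1.1 ≠ n ∨ p.1.1.1 ≠ n ∧ p.2.1.1 = n) :
    (Lseq n : ℝ) ≤ CdBlock a b κ p := by
  have hne : p.1.1.1 ≠ p.2.1.1 := by
    rcases h with ⟨h1, h2⟩ | ⟨h1, h2⟩ <;> omega
  rw [CdBlock, if_neg hne]
  have : ∀ k, (0 : ℝ) ≤ Lseq k := fun k => Nat.cast_nonneg _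
  rcases h with ⟨h1, -⟩ | ⟨-, h1⟩
  · rw [h1]; linarith [this p.2.1.1]
  · rw [h1]; linarith [this p.1.1.1]

/-- Transposing two points of one block preserves blocks. -/
lemma swap_block {κ : ℝ} {u v : XdT κ} (h : u.1.1 = v.1.1) (x : XdT κ) :
    (Equiv.swap u v x).1.1 = x.1.1 := by
  rw [Equiv.swap_apply_def]
  split_ifs with h1 h2
  · rw [h1, h]
  · rw [h2, h]
  · rfl

lemma swap_idx_eq_zero_iff {κ : ℝ} {u v : XdT κ} (hu : 1 ≤ u.1.2) (hv : 1 ≤ v.1.2) (x : XdT κ) :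
    (Equiv.swap u v x).1.2 = 0 ↔ x.1.2 = 0 := by
  rw [Equiv.swap_apply_def]
  split_ifs with h1 h2
  · subst h1; omega
  · subst h2; omega
  · rfl

lemma CdBlock_congr {a b κ : ℝ} {x y x' y' : XdT κ} (hx : x'.1.1 = x.1.1) (hy : y'.1.1 = y.1.1)
    (hx0 : x'.1.2 = 0 ↔ x.1.2 = 0) (hy0 : y'.1.2 = 0 ↔ y.1.2 = 0) (heq : x' = y' ↔ x = y) :
    CdBlock a b κ (x', y') = CdBlock a b κ (x, y) := by
  have key : ∀ u v : XdT κ, u.1.1 = v.1.1 → (u.1.2 = v.1.2 ↔ u = v) := fun u v h =>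
    ⟨fun h' => Subtype.ext (Prod.ext h h'), fun h' => by rw [h']⟩
  simp only [CdBlock, hx, hy, hx0, hy0]
  by_cases h : x.1.1 = y.1.1
  · have h' : x'.1.1 = y'.1.1 := by rw [hx, hy, h]
    simp only [key _ _ h, key _ _ h', heq]
  · simp only [h, if_false]

lemma CdBlock_swap {a b κ : ℝ} {u v : XdT κ} (h : u.1.1 = v.1.1) (hu : 1 ≤ u.1.2)
    (hv : 1 ≤ v.1.2) (x y : XdT κ) :
    CdBlock a b κ (Equiv.swap u v x, Equiv.swap u v y) = CdBlock a b κ (x, y) :=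
  CdBlock_congr (swap_block h x) (swap_block h y) (swap_idx_eq_zero_iff hu hv x)
    (swap_idx_eq_zero_iff hu hv y) (Equiv.swap u v).injective.eq_iff

lemma mseq_le (κ : ℝ) (hκ : 0 ≤ κ) (n : ℕ) : (mseq κ n : ℝ) ≤ 2 * Real.exp (κ * n) := by
  have h1 : 1 ≤ Real.exp (κ * n) := Real.one_le_exp (by positivity)
  rw [mseq, Nat.cast_max]
  refine max_le (by push_cast; linarith) ((Nat.floor_le (Real.exp_pos _).le).trans (by linarith))

/-- Spreading the terms of a summable sequence uniformly over the blocks gives a summable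
family. -/
lemma summable_of_block {κ : ℝ} {f : ℕ → ℝ} (hf : ∀ n, 0 ≤ f n) (hs : Summable f) :
    Summable fun x : XdT κ => f x.1.1 / ((mseq κ x.1.1 : ℝ) + 1) := by
  set g : ℕ × ℕ → ℝ := fun p =>
    if p.2 ∈ Finset.range (mseq κ p.1 + 1) then f p.1 / ((mseq κ p.1 : ℝ) + 1) else 0 with hg
  have hsum : ∀ n, HasSum (fun i => g (n, i)) (f n) := by
    intro n
    have h : HasSum (fun i => g (n, i)) (∑ i ∈ Finset.range (mseq κ n + 1), g (n, i)) :=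
      hasSum_sum_of_ne_finset_zero fun i hi => by simp only [hg, if_neg hi]
    have h2 : ∑ i ∈ Finset.range (mseq κ n + 1), g (n, i) = f n := by
      rw [Finset.sum_congr rfl fun i hi => (by simp only [hg, if_pos hi] :
        g (n, i) = f n / ((mseq κ n : ℝ) + 1)), Finset.sum_const, Finset.card_range, nsmul_eq_mul]
      push_cast
      field_simp
    rwa [h2] at h
  have hg0 : 0 ≤ g := fun p => by
    simp only [hg]
    split_ifs
    · exact div_nonneg (hf _) (by positivity)
    · exact le_rfl
  have hgs : Summable g := by
    rw [summable_prod_of_nonneg hg0]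
    refine ⟨fun n => (hsum n).summable, ?_⟩
    simpa only [(hsum _).tsum_eq] using hs
  refine (hgs.comp_injective (Subtype.val_injective (p := fun p : ℕ × ℕ =>
    1 ≤ p.1 ∧ p.2 ≤ mseq κ p.1))).congr fun x => ?_
  have : x.1.2 ∈ Finset.range (mseq κ x.1.1 + 1) := Finset.mem_range.2 (Nat.lt_succ_of_le x.2.2)
  simp only [hg, Function.comp, if_pos this]

lemma log_inv_mass_le {κ : ℝ} (hκ : 0 ≤ κ) {n : ℕ} (hn : 1 ≤ n) :
    Real.log (1 / (wseq n / ((mseq κ n : ℝ) + 1))) ≤ (3 * zeta3 + κ + 3) * n := by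
  have hz := zeta3_pos
  have hn' : (1 : ℝ) ≤ n := by exact_mod_cast hn
  have hn0 : (0 : ℝ) < n := by linarith
  have h1 : 1 ≤ Real.exp (κ * n) := Real.one_le_exp (by positivity)
  have hm := mseq_le κ hκ n
  have hle : 1 / (wseq n / ((mseq κ n : ℝ) + 1)) ≤
      (3 * zeta3) * Real.exp (κ * n) * (n : ℝ) ^ 3 := by
    rw [wseq, one_div_div, div_le_iff₀ (by positivity)]
    have : 3 * zeta3 * Real.exp (κ * n) * (n : ℝ) ^ 3 * (1 / zeta3 * ((n : ℝ) ^ 3)⁻¹) =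
        3 * Real.exp (κ * n) := by field_simp
    rw [this]
    linarith
  have hpos : 0 < 1 / (wseq n / ((mseq κ n : ℝ) + 1)) := by
    have := wseq_pos hn
    positivity
  refine (Real.log_le_log hpos hle).trans ?_
  rw [Real.log_mul (by positivity) (by positivity), Real.log_mul (by positivity) (by positivity),
    Real.log_exp, Real.log_pow]
  have l1 : Real.log (3 * zeta3) ≤ 3 * zeta3 := Real.log_le_self (by positivity)
  have l2 : Real.log (n : ℝ) ≤ n := Real.log_le_self (by positivity)
  push_cast
  nlinarith

lemma mass_le_one {κ : ℝ} [IsProbabilityMeasure (mud κ)] (x : XdT κ) :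
    wseq x.1.1 / ((mseq κ x.1.1 : ℝ) + 1) ≤ 1 := by
  rw [← toReal_mud_singleton]
  exact measureReal_le_one

lemma summable_entropy {κ : ℝ} (hκ : 0 ≤ κ) [IsProbabilityMeasure (mud κ)] :
    Summable fun x : XdT κ => (mud κ {x}).toReal * Real.log (1 / (mud κ {x}).toReal) := by
  have hz := zeta3_pos
  have hs : Summable fun n : ℕ => (3 * zeta3 + κ + 3) / zeta3 * ((n : ℝ) ^ 2)⁻¹ :=
    (Real.summable_nat_pow_inv (p := 2).2 (by norm_num)).mul_left _
  refine Summable.of_nonneg_of_le (fun x => ?_) (fun x => ?_)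
    (summable_of_block (κ := κ) (fun n => by positivity) hs)
  · rw [toReal_mud_singleton]
    refine mul_nonneg (mass_pos κ x).le (Real.log_nonneg ?_)
    rw [le_div_iff₀ (mass_pos κ x), one_mul]
    exact mass_le_one x
  · rw [toReal_mud_singleton]
    have hn : (0 : ℝ) < x.1.1 := by exact_mod_cast x.2.1
    refine (mul_le_mul_of_nonneg_left (log_inv_mass_le hκ x.2.1) (mass_pos κ x).le).trans
      (le_of_eq ?_)
    rw [wseq]
    field_simp

lemma Pdstar_mem_couplings (κ : ℝ) [IsProbabilityMeasure (mud κ)] :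
    Pdstar κ ∈ couplings (mud κ) (mud κ) := by
  have hm : Measurable fun x : XdT κ => (x, x) := measurable_of_countable _
  refine ⟨Measure.isProbabilityMeasure_map hm.aemeasurable, ?_, ?_⟩
  · rw [Pdstar, Measure.map_map measurable_fst hm]
    exact Measure.map_id
  · rw [Pdstar, Measure.map_map measurable_snd hm]
    exact Measure.map_id

lemma Jfun_Pdstar {a b κ : ℝ} (hκ : 0 ≤ κ) [IsProbabilityMeasure (mud κ)] (ε : ℝ) :
    Jfun (CdBlock a b κ) ((mud κ).prod (mud κ)) ε (Pdstar κ) = ((ε * Hd κ : ℝ) : EReal) := by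
  have hm : Measurable fun x : XdT κ => (x, x) := measurable_of_countable _
  have hprob : IsProbabilityMeasure (Pdstar κ) := (Pdstar_mem_couplings κ).1
  have hR : ∀ z, ((mud κ).prod (mud κ)) {z} ≠ 0 := fun z => by
    rw [prod_self_singleton z.1 z.2]
    exact mul_ne_zero (mud_singleton_ne_zero κ _) (mud_singleton_ne_zero κ _)
  have hinj : Function.Injective fun x : XdT κ => (x, x) := fun x y h => (Prod.ext_iff.1 h).1
  have hdiag : ∀ x, (Pdstar κ) {(x, x)} = mud κ {x} := fun x => by
    rw [Pdstar, Measure.map_apply hm (measurableSet_singleton _)]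
    congr 1
    ext y
    simp
  have hterm : ∀ x, entropyTerm (Pdstar κ) ((mud κ).prod (mud κ)) (x, x) =
      (mud κ {x}).toReal * Real.log (1 / (mud κ {x}).toReal) := fun x => by
    have h0 : (mud κ {x}).toReal ≠ 0 := by
      rw [toReal_mud_singleton]
      exact (mass_pos κ x).ne'
    rw [entropyTerm, measureReal_def, measureReal_def, hdiag, prod_self_singleton,
      ENNReal.toReal_mul]
    congr 2
    field_simp
  have hzero : ∀ z ∉ Set.range (fun x : XdT κ => (x, x)),
      entropyTerm (Pdstar κ) ((mud κ).prod (mud κ)) z = 0 := fun z hz => by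
    have : Pdstar κ {z} = 0 := by
      rw [Pdstar, Measure.map_apply hm (measurableSet_singleton _),
        show (fun x : XdT κ => (x, x)) ⁻¹' {z} = ∅ from ?_, measure_empty]
      ext y
      simp only [Set.mem_preimage, Set.mem_singleton_iff, Set.mem_empty_iff_false, iff_false]
      exact fun h => hz ⟨y, h⟩
    simp [entropyTerm, measureReal_def, this]
  have hsum : Summable (entropyTerm (Pdstar κ) ((mud κ).prod (mud κ))) := by
    rw [← hinj.summable_iff hzero]
    exact (summable_entropy hκ).congr fun x => (hterm x).symm
  have hcost : ∫⁻ z, ENNReal.ofReal (CdBlock a b κ z) ∂(Pdstar κ) = 0 := by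
    rw [Pdstar, lintegral_map (measurable_of_countable _) hm]
    simp [CdBlock_self]
  have hval : ∑' z, entropyTerm (Pdstar κ) ((mud κ).prod (mud κ)) z = Hd κ := by
    rw [← hinj.tsum_eq (Function.support_subset_iff'.2 hzero)]
    exact tsum_congr hterm
  rw [Jfun, hcost, KL_eq_of_summable hR hsum, hval, EReal.coe_ennreal_zero, zero_add,
    EReal.coe_mul]

/-- Both crossings of the boundary of a set have the same mass under a self-coupling. -/
lemma coupling_prod_compl_comm {X : Type*} [MeasurableSpace X] {μ : Measure X}
    {P : Measure (X × X)} (hP : P ∈ couplings μ μ) {B : Set X} (hB : MeasurableSet B) :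
    P (Bᶜ ×ˢ B) = P (B ×ˢ Bᶜ) := by
  obtain ⟨hprob, hfst, hsnd⟩ := hP
  have h1 : μ B = P (B ×ˢ B) + P (B ×ˢ Bᶜ) := by
    rw [← hfst, Measure.map_apply measurable_fst hB,
      ← measure_inter_add_sdiff (Prod.fst ⁻¹' B) (measurable_snd hB)]
    rfl
  have h2 : μ B = P (B ×ˢ B) + P (Bᶜ ×ˢ B) := by
    rw [← hsnd, Measure.map_apply measurable_snd hB,
      ← measure_inter_add_sdiff (Prod.snd ⁻¹' B) (measurable_fst hB)]
    congr 2
    · ext z; simp [and_comm]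
    · ext z; simp [and_comm]
  exact (ENNReal.add_right_inj (measure_ne_top P _)).1 (h2.symm.trans h1)

lemma measure_block_crossing_le {a b κ : ℝ} {n : ℕ} (hn : 1 ≤ n) [IsProbabilityMeasure (mud κ)]
    {ε : ℝ} (hε : 0 ≤ ε) {P : Measure (XdT κ × XdT κ)} (hP : P ∈ couplings (mud κ) (mud κ))
    (hJ : Jfun (CdBlock a b κ) ((mud κ).prod (mud κ)) ε P ≤ ((ε * Hd κ : ℝ) : EReal)) :
    P ((Bset κ n) ×ˢ (Bset κ n)ᶜ) ≤ ENNReal.ofReal (ε * Hd κ / (2 * (Lseq n : ℝ))) := by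
  have hprob : IsProbabilityMeasure P := hP.1
  have hL : (0 : ℝ) < Lseq n := by
    have : 0 < Lseq n := pow_pos hn 4
    exact_mod_cast this
  have hcost : ∫⁻ z, ENNReal.ofReal (CdBlock a b κ z) ∂P ≤ ENNReal.ofReal (ε * Hd κ) := by
    have h1 : ((∫⁻ z, ENNReal.ofReal (CdBlock a b κ z) ∂P : ℝ≥0∞) : EReal) ≤
        ((ε * Hd κ : ℝ) : EReal) := by
      refine le_trans ?_ hJ
      exact le_add_of_nonneg_right (mul_nonneg (by exact_mod_cast hε) KL_nonneg)
    rw [← EReal.coe_ennreal_le_coe_ennreal_iff, EReal.coe_ennreal_ofReal]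
    exact h1.trans (by exact_mod_cast le_max_left _ _)
  have hBm : MeasurableSet (Bset κ n) := (Bset κ n).to_countable.measurableSet
  have hmarkov := mul_meas_ge_le_lintegral (μ := P)
    (measurable_of_countable fun z => ENNReal.ofReal (CdBlock a b κ z)) (ENNReal.ofReal (Lseq n))
  have hsub : (Bset κ n) ×ˢ (Bset κ n)ᶜ ∪ (Bset κ n)ᶜ ×ˢ (Bset κ n) ⊆
      {z | ENNReal.ofReal (Lseq n) ≤ ENNReal.ofReal (CdBlock a b κ z)} := by
    intro z hz
    exact ENNReal.ofReal_le_ofReal (Lseq_le_CdBlock_of_block_ne a b κ hz)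
  have hdisj : Disjoint ((Bset κ n) ×ˢ (Bset κ n)ᶜ) ((Bset κ n)ᶜ ×ˢ (Bset κ n)) :=
    Set.disjoint_left.2 fun z h1 h2 => h2.1 h1.1
  have hle := measure_mono (μ := P) hsub
  rw [measure_union hdisj (hBm.compl.prod hBm), coupling_prod_compl_comm hP hBm,
    ← two_mul] at hle
  have hfin := (mul_le_mul_right hle (ENNReal.ofReal (Lseq n))).trans (hmarkov.trans hcost)
  have h2 : ENNReal.ofReal (2 * (Lseq n : ℝ)) * P ((Bset κ n) ×ˢ (Bset κ n)ᶜ) ≤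
      ENNReal.ofReal (ε * Hd κ) := by
    rw [ENNReal.ofReal_mul zero_le_two, ENNReal.ofReal_ofNat, mul_comm 2, mul_assoc]
    exact hfin
  rw [ENNReal.ofReal_div_of_pos (by positivity),
    ENNReal.le_div_iff_mul_le (Or.inl (ENNReal.ofReal_pos.2 (by positivity)).ne')
      (Or.inl ENNReal.ofReal_ne_top), mul_comm]
  exact h2

/-- The enumeration of the non-hub points of the `n`-th block. -/
def nonhubPoint (κ : ℝ) (n : ℕ) (hn : 1 ≤ n) (i : Fin (mseq κ n)) : XdT κ :=
  ⟨(n, i + 1), hn, i.2⟩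

lemma nonhubPoint_injective (κ : ℝ) (n : ℕ) (hn : 1 ≤ n) :
    Function.Injective (nonhubPoint κ n hn) := fun i j h => by
  simpa [nonhubPoint, Fin.ext_iff] using h

/-- The non-hub points of the `n`-th block. -/
def nonhub (κ : ℝ) (n : ℕ) (hn : 1 ≤ n) : Finset (XdT κ) :=
  Finset.univ.map ⟨nonhubPoint κ n hn, nonhubPoint_injective κ n hn⟩

lemma card_nonhub (κ : ℝ) (n : ℕ) (hn : 1 ≤ n) : (nonhub κ n hn).card = mseq κ n := by
  simp [nonhub]

lemma mem_nonhub {κ : ℝ} {n : ℕ} (hn : 1 ≤ n) (x : XdT κ) :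
    x ∈ nonhub κ n hn ↔ x.1.1 = n ∧ 1 ≤ x.1.2 := by
  simp only [nonhub, Finset.mem_map, Finset.mem_univ, true_and, Function.Embedding.coeFn_mk]
  constructor
  · rintro ⟨i, rfl⟩
    exact ⟨rfl, Nat.succ_le_succ (Nat.zero_le _)⟩
  · rintro ⟨rfl, h⟩
    have hx := x.2.2
    refine ⟨⟨x.1.2 - 1, by omega⟩, Subtype.ext (Prod.ext rfl ?_)⟩
    change x.1.2 - 1 + 1 = x.1.2
    omega

lemma FnSet_eq_offDiag (κ : ℝ) (n : ℕ) (hn : 1 ≤ n) :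
    FnSet κ n = ↑(nonhub κ n hn).offDiag := by
  ext ⟨x, y⟩
  simp only [FnSet, Set.mem_ofPred_eq, Finset.coe_offDiag, Set.mem_offDiag, Finset.mem_coe,
    mem_nonhub]
  constructor
  · rintro ⟨h1, h2, h3, h4, h5⟩
    exact ⟨⟨h1, h3⟩, ⟨h2, h4⟩, fun h => h5 (by rw [h])⟩
  · rintro ⟨⟨h1, h3⟩, ⟨h2, h4⟩, h5⟩
    exact ⟨h1, h2, h3, h4, fun h => h5 (Subtype.ext (Prod.ext (h1.trans h2.symm) h))⟩

section Symmetric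

variable {κ : ℝ} {n : ℕ} {P : Measure (XdT κ × XdT κ)}

/-- Invariance of a measure under transpositions of the non-hub points of the `n`-th block. -/
def SwapInvariant (hn : 1 ≤ n) (P : Measure (XdT κ × XdT κ)) : Prop :=
  ∀ u ∈ nonhub κ n hn, ∀ v ∈ nonhub κ n hn,
    P.map ((Equiv.swap u v).prodCongr (Equiv.swap u v)) = P

lemma SwapInvariant.prod_apply {hn : 1 ≤ n} (hinv : SwapInvariant hn P) {u v : XdT κ}
    (hu : u ∈ nonhub κ n hn) (hv : v ∈ nonhub κ n hn) (A B : Set (XdT κ)) :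
    P ((Equiv.swap u v ⁻¹' A) ×ˢ (Equiv.swap u v ⁻¹' B)) = P (A ×ˢ B) := by
  conv_rhs => rw [← hinv u hu v hv]
  rw [Measure.map_apply (measurable_of_countable _) (A ×ˢ B).to_countable.measurableSet]
  rfl

lemma SwapInvariant.singleton_apply {hn : 1 ≤ n} (hinv : SwapInvariant hn P) {u v : XdT κ}
    (hu : u ∈ nonhub κ n hn) (hv : v ∈ nonhub κ n hn) (x y : XdT κ) :
    P {(Equiv.swap u v x, Equiv.swap u v y)} = P {(x, y)} := by
  have h := hinv.prod_apply hu hv {Equiv.swap u v x} {Equiv.swap u v y}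
  have hp : ∀ z, Equiv.swap u v ⁻¹' {Equiv.swap u v z} = {z} := fun z => by ext w; simp
  rw [hp, hp, Set.singleton_prod_singleton, Set.singleton_prod_singleton] at h
  exact h.symm

lemma SwapInvariant.diag {hn : 1 ≤ n} (hinv : SwapInvariant hn P) {u v : XdT κ}
    (hu : u ∈ nonhub κ n hn) (hv : v ∈ nonhub κ n hn) : P {(v, v)} = P {(u, u)} := by
  simpa using hinv.singleton_apply hu hv u u

lemma SwapInvariant.offDiag {hn : 1 ≤ n} (hinv : SwapInvariant hn P) {u v x y : XdT κ}
    (hu : u ∈ nonhub κ n hn) (hv : v ∈ nonhub κ n hn) (hx : x ∈ nonhub κ n hn)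
    (hy : y ∈ nonhub κ n hn) (huv : u ≠ v) (hxy : x ≠ y) : P {(x, y)} = P {(u, v)} := by
  have h1 := hinv.singleton_apply hu hx u v
  rw [Equiv.swap_apply_left] at h1
  set v' := Equiv.swap u x v with hv'
  have hxv' : x ≠ v' := by
    rw [hv', ← Equiv.swap_apply_left u x]
    exact fun h => huv ((Equiv.swap u x).injective (by simpa using h))
  have hv'm : v' ∈ nonhub κ n hn := by
    rw [hv', Equiv.swap_apply_def]
    split_ifs <;> assumption
  have h2 := hinv.singleton_apply hv'm hy x v'
  rw [Equiv.swap_apply_left, Equiv.swap_apply_of_ne_of_ne hxv' hxy] at h2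
  rw [h2, h1]

lemma measure_FnSet_of_swapInvariant {hn : 1 ≤ n} (hinv : SwapInvariant hn P) {u v : XdT κ}
    (hu : u ∈ nonhub κ n hn) (hv : v ∈ nonhub κ n hn) (huv : u ≠ v) :
    P (FnSet κ n) = ((mseq κ n * (mseq κ n - 1) : ℕ) : ℝ≥0∞) * P {(u, v)} := by
  rw [FnSet_eq_offDiag κ n hn, ← sum_measure_singleton, Finset.sum_congr rfl
    (g := fun _ => P {(u, v)}), Finset.sum_const, Finset.offDiag_card, card_nonhub, nsmul_eq_mul,
    Nat.mul_sub, mul_one]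
  rintro ⟨x, y⟩ hxy
  rw [Finset.mem_offDiag] at hxy
  exact hinv.offDiag hu hv hxy.1 hxy.2.1 huv hxy.2.2

/-- Mass balance of a swap invariant self-coupling over the rows of the non-hub points. -/
lemma row_balance_of_swapInvariant {hn : 1 ≤ n} (hinv : SwapInvariant hn P)
    (hP : P ∈ couplings (mud κ) (mud κ)) {u v : XdT κ}
    (hu : u ∈ nonhub κ n hn) (hv : v ∈ nonhub κ n hn) (huv : u ≠ v) :
    (mseq κ n : ℝ) * (mud κ {u}).toReal ≤ (mud κ {u}).toReal + (mseq κ n * P.real {(u, u)} +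
      (mseq κ n * ((mseq κ n - 1) * P.real {(u, v)}) + P.real ((Bset κ n) ×ˢ (Bset κ n)ᶜ))) := by
  obtain ⟨hprob, hfst, hsnd⟩ := hP
  set I := nonhub κ n hn with hI
  set hub : XdT κ := ⟨(n, 0), hn, Nat.zero_le _⟩ with hhub
  have hu' := (mem_nonhub hn u).1 hu
  have hhubI : hub ∉ I := fun h => by
    have := ((mem_nonhub hn hub).1 h).2
    simp [hhub] at this
  have hfstI : ∀ s : Finset (XdT κ), ∀ T : Set (XdT κ × XdT κ),
      ∑ x ∈ s, P ((Prod.fst ⁻¹' {x}) ∩ T) = P ((Prod.fst ⁻¹' (s : Set (XdT κ))) ∩ T) :=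
    fun s T => by
    have h := sum_measure_preimage_singleton (μ := P.restrict T) s (f := Prod.fst)
      (fun y _ => (Set.to_countable _).measurableSet)
    simpa only [Measure.restrict_apply (Set.to_countable _).measurableSet] using h
  have hubMass : (mseq κ n : ℝ) * P.real {(u, hub)} ≤ (mud κ {u}).toReal := by
    have hc : ∑ x ∈ I, P {(x, hub)} = (mseq κ n : ℝ≥0∞) * P {(u, hub)} := by
      rw [Finset.sum_congr rfl (g := fun _ => P {(u, hub)}), Finset.sum_const, card_nonhub,
        nsmul_eq_mul]
      intro x hx
      have h := hinv.singleton_apply hu hx u hub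
      rwa [Equiv.swap_apply_left, Equiv.swap_apply_of_ne_of_ne (ne_of_mem_of_not_mem hu hhubI).symm
        (ne_of_mem_of_not_mem hx hhubI).symm] at h
    have hle : ∑ x ∈ I, P {(x, hub)} ≤ mud κ {u} := by
      have hs : ∀ x : XdT κ, ({(x, hub)} : Set (XdT κ × XdT κ)) =
          (Prod.fst ⁻¹' {x}) ∩ (Prod.snd ⁻¹' {hub}) := fun x => by
        ext z; simp [Prod.ext_iff]
      simp only [hs, hfstI]
      rw [mud_singleton_congr (y := hub) hu'.1, ← hsnd,
        Measure.map_apply measurable_snd (measurableSet_singleton _)]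
      exact measure_mono Set.inter_subset_right
    rw [hc] at hle
    have := ENNReal.toReal_mono (by rw [mud_singleton]; exact ENNReal.ofReal_ne_top) hle
    rwa [ENNReal.toReal_mul, ENNReal.toReal_natCast] at this
  have crossMass : (mseq κ n : ℝ) * P.real ({u} ×ˢ (Bset κ n)ᶜ) ≤
      P.real ((Bset κ n) ×ˢ (Bset κ n)ᶜ) := by
    have hc : ∑ x ∈ I, P ({x} ×ˢ (Bset κ n)ᶜ) =
        (mseq κ n : ℝ≥0∞) * P ({u} ×ˢ (Bset κ n)ᶜ) := by
      rw [Finset.sum_congr rfl (g := fun _ => P ({u} ×ˢ (Bset κ n)ᶜ)), Finset.sum_const,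
        card_nonhub, nsmul_eq_mul]
      intro x hx
      have h := hinv.prod_apply hu hx {x} (Bset κ n)ᶜ
      have hx' := (mem_nonhub hn x).1 hx
      have h1 : Equiv.swap u x ⁻¹' {x} = {u} := by
        ext w
        simp [Equiv.swap_apply_eq_iff]
      have h2 : Equiv.swap u x ⁻¹' (Bset κ n)ᶜ = (Bset κ n)ᶜ := by
        ext w
        simp [Bset, swap_block (hu'.1.trans hx'.1.symm) w]
      rw [h1, h2] at h
      exact h.symm
    have hle : ∑ x ∈ I, P ({x} ×ˢ (Bset κ n)ᶜ) ≤ P ((Bset κ n) ×ˢ (Bset κ n)ᶜ) := by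
      have hs : ∀ x : XdT κ, {x} ×ˢ (Bset κ n)ᶜ =
        (Prod.fst ⁻¹' {x}) ∩ (Prod.snd ⁻¹' (Bset κ n)ᶜ) := fun x => rfl
      simp only [hs, hfstI]
      refine measure_mono fun z hz => ⟨((mem_nonhub hn z.1).1 hz.1).1, hz.2⟩
    rw [hc] at hle
    have := ENNReal.toReal_mono (measure_ne_top P _) hle
    rwa [ENNReal.toReal_mul, ENNReal.toReal_natCast] at this
  set J : Finset (XdT κ × XdT κ) := (I.erase u).map ⟨Prod.mk u, Prod.mk_right_injective u⟩ with hJ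
  have hJsum : P.real (J : Set (XdT κ × XdT κ)) = ((mseq κ n : ℝ) - 1) * P.real {(u, v)} := by
    rw [measureReal_def, ← sum_measure_singleton, hJ, Finset.sum_map,
      Finset.sum_congr rfl (g := fun _ => P {(u, v)}), Finset.sum_const,
      Finset.card_erase_of_mem hu, card_nonhub, nsmul_eq_mul, ENNReal.toReal_mul,
      ENNReal.toReal_natCast, Nat.cast_sub (one_le_mseq κ n), Nat.cast_one, measureReal_def]
    intro x hx
    rw [Finset.mem_erase] at hx
    exact hinv.offDiag hu hv hu hx.2 huv hx.1.symm
  have hrow : (mud κ {u}).toReal ≤ P.real {(u, hub)} + (P.real {(u, u)} +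
      (P.real (J : Set (XdT κ × XdT κ)) + P.real ({u} ×ˢ (Bset κ n)ᶜ))) := by
    have hcover : Prod.fst ⁻¹' {u} ⊆ {(u, hub)} ∪ ({(u, u)} ∪
        ((J : Set (XdT κ × XdT κ)) ∪ {u} ×ˢ (Bset κ n)ᶜ)) := by
      rintro ⟨x, y⟩ rfl
      by_cases hy : y.1.1 = n
      · by_cases hy0 : y.1.2 = 0
        · exact Or.inl (Prod.ext rfl (Subtype.ext (Prod.ext hy hy0)))
        · by_cases hxy : y = x
          · exact Or.inr (Or.inl (by rw [hxy]; rfl))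
          · refine Or.inr (Or.inr (Or.inl ?_))
            simp only [hJ, Finset.mem_coe, Finset.mem_map, Function.Embedding.coeFn_mk]
            exact ⟨y, Finset.mem_erase.2 ⟨hxy, (mem_nonhub hn y).2 ⟨hy, by omega⟩⟩, rfl⟩
      · exact Or.inr (Or.inr (Or.inr ⟨rfl, hy⟩))
    rw [← hfst, Measure.map_apply measurable_fst (measurableSet_singleton _)]
    refine (measureReal_mono hcover (measure_ne_top P _)).trans ?_
    refine (measureReal_union_le _ _).trans (add_le_add_right ?_ _)
    refine (measureReal_union_le _ _).trans (add_le_add_right ?_ _)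
    exact measureReal_union_le _ _
  rw [hJsum] at hrow
  have := mul_le_mul_of_nonneg_left hrow (Nat.cast_nonneg (α := ℝ) (mseq κ n))
  linarith

end Symmetric

lemma Hd_nonneg (κ : ℝ) [IsProbabilityMeasure (mud κ)] : 0 ≤ Hd κ := by
  refine tsum_nonneg fun x => ?_
  rw [toReal_mud_singleton]
  refine mul_nonneg (mass_pos κ x).le (Real.log_nonneg ?_)
  rw [le_div_iff₀ (mass_pos κ x), one_mul]
  exact mass_le_one x

end BlockModel

/-- The mass balance bounds the diagonal mass below once blocks are large. -/
lemma diag_lower_bound {m w d o r Δ : ℝ} (hm : 4 ≤ m) (hw : 0 < w) (hd : 0 ≤ d)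
    (ho : o = r * d) (hr : m * r ≤ 1) (hr0 : 0 ≤ r) (hΔ : Δ ≤ w / 8)
    (hbal : m * (w / (m + 1)) ≤ w / (m + 1) + (m * d + (m * ((m - 1) * o) + Δ))) :
    w / (4 * (m + 1)) ≤ d := by
  set q := w / (m + 1) with hq
  have hm1 : 0 < m + 1 := by linarith
  have hq0 : 0 < q := by positivity
  have hwq : w = q * (m + 1) := by rw [hq]; field_simp
  have h1 : (m - 1) * o ≤ d := by
    rw [ho]
    nlinarith [mul_nonneg hr0 hd, mul_le_mul_of_nonneg_right hr hd]
  have h2 : m * ((m - 1) * o) ≤ m * d := mul_le_mul_of_nonneg_left h1 (by linarith)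
  have h3 : w / (4 * (m + 1)) = q / 4 := by rw [hq]; field_simp
  rw [h3]
  by_contra! hlt
  nlinarith [mul_lt_mul_of_pos_left hlt (by linarith : 0 < m)]

/-- The resulting lower bound for the off-diagonal mass. -/
lemma offDiag_lower_bound {m w d x y : ℝ} (hm : 4 ≤ m) (hw : 0 < w) (hx : x ≤ m + 1)
    (hy : 0 ≤ y) (hd : w / (4 * (m + 1)) ≤ d) :
    w / 16 * (y * x) ≤ m * (m - 1) * (y * d) := by
  have hm1 : 0 < m + 1 := by linarith
  have h1 : w * x / 16 ≤ m * (m - 1) * (w / (4 * (m + 1))) := by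
    rw [mul_div_assoc', div_le_div_iff₀ (by norm_num) (by positivity)]
    have h2 : (m + 1) * (m + 1) ≤ 4 * (m * (m - 1)) := by nlinarith
    have h3 : x * (m + 1) ≤ (m + 1) * (m + 1) := mul_le_mul_of_nonneg_right hx hm1.le
    nlinarith [mul_le_mul_of_nonneg_left (h3.trans h2) hw.le]
  have h4 : m * (m - 1) * (w / (4 * (m + 1))) ≤ m * (m - 1) * d :=
    mul_le_mul_of_nonneg_left hd (by nlinarith)
  nlinarith [mul_le_mul_of_nonneg_left (h1.trans h4) hy]

/-- **Block estimates** (Proposition 3.4): for the entropic minimisers `P_n^d` at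
`ε_n = 1/n`: (a) `Δ_n ≤ ε_n H(μ^d)/(2 L_n)`; (b) `d_n ≥ w_n/(4(m_n+1))` for large `n`;
(c) `P_n^d(F_n) = m_n(m_n−1) o_n ≥ (w_n/16) e^{−(b−κ)n}` for large `n`. -/
theorem discrete_block_estimates
    (a b κ : ℝ) (ha : 0 < a) (haκ : 2 * a < κ) (hκb : κ < b)
    (P : ℕ → Measure (XdT κ × XdT κ))
    (hPmem : ∀ n : ℕ, 1 ≤ n → P n ∈ couplings (mud κ) (mud κ))
    (hPmin : ∀ n : ℕ, 1 ≤ n → ∀ Q ∈ couplings (mud κ) (mud κ),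
      Jfun (CdBlock a b κ) ((mud κ).prod (mud κ)) ((n : ℝ)⁻¹) (P n) ≤
        Jfun (CdBlock a b κ) ((mud κ).prod (mud κ)) ((n : ℝ)⁻¹) Q)
    (hPuniq : ∀ n : ℕ, 1 ≤ n → ∀ Q ∈ couplings (mud κ) (mud κ),
      (∀ R ∈ couplings (mud κ) (mud κ),
        Jfun (CdBlock a b κ) ((mud κ).prod (mud κ)) ((n : ℝ)⁻¹) Q ≤
          Jfun (CdBlock a b κ) ((mud κ).prod (mud κ)) ((n : ℝ)⁻¹) R) → Q = P n) :
    (∀ n : ℕ, 1 ≤ n →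
      P n ((Bset κ n) ×ˢ (Bset κ n)ᶜ) ≤
        ENNReal.ofReal ((n : ℝ)⁻¹ * Hd κ / (2 * (Lseq n : ℝ)))) ∧
    (∃ N : ℕ, ∀ n : ℕ, ∀ hn : 1 ≤ n, N ≤ n →
      ENNReal.ofReal (wseq n / (4 * ((mseq κ n : ℝ) + 1))) ≤
        P n {(⟨(n, 1), hn, one_le_mseq κ n⟩, ⟨(n, 1), hn, one_le_mseq κ n⟩)}) ∧
    (∃ N : ℕ, ∀ n : ℕ, ∀ hn : 1 ≤ n, N ≤ n →
      P n (FnSet κ n) =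
        ((mseq κ n * (mseq κ n - 1) : ℕ) : ℝ≥0∞) *
          P n {(⟨(n, 1), hn, one_le_mseq κ n⟩,
                ⟨(n, 2), hn, two_le_mseq κ n⟩)} ∧
      ENNReal.ofReal (wseq n / 16 * Real.exp (-(b - κ) * (n : ℝ))) ≤ P n (FnSet κ n)) := by
  have hb : 0 < b := by linarith
  have hκ : 0 < κ := by linarith
  have hprob : IsProbabilityMeasure (mud κ) := by
    obtain ⟨h1, h2, -⟩ := hPmem 1 le_rfl
    rw [← h2]
    exact Measure.isProbabilityMeasure_map measurable_fst.aemeasurable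
  have hC : ∀ z, 0 ≤ CdBlock a b κ z := CdBlock_nonneg ha.le hb.le κ
  have hJ : ∀ n : ℕ, 1 ≤ n → Jfun (CdBlock a b κ) ((mud κ).prod (mud κ)) ((n : ℝ)⁻¹) (P n) ≤
      (((n : ℝ)⁻¹ * Hd κ : ℝ) : EReal) := fun n hn =>
    (hPmin n hn _ (Pdstar_mem_couplings κ)).trans_eq (Jfun_Pdstar hκ.le _)
  have hcross : ∀ n : ℕ, 1 ≤ n → P n ((Bset κ n) ×ˢ (Bset κ n)ᶜ) ≤
      ENNReal.ofReal ((n : ℝ)⁻¹ * Hd κ / (2 * (Lseq n : ℝ))) := fun n hn =>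
    measure_block_crossing_le hn (by positivity) (hPmem n hn) (hJ n hn)
  have hinv : ∀ n : ℕ, ∀ hn : 1 ≤ n, SwapInvariant hn (P n) := fun n hn u hu v hv => by
    obtain ⟨hu1, hu2⟩ := (mem_nonhub hn u).1 hu
    obtain ⟨hv1, hv2⟩ := (mem_nonhub hn v).1 hv
    exact minimiser_map_eq (mud_singleton_ne_zero κ) (hPmem n hn) (hPmin n hn) (hPuniq n hn) _
      (fun x => mud_singleton_congr (swap_block (hu1.trans hv1.symm) x))
      (CdBlock_swap (hu1.trans hv1.symm) hu2 hv2)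
  have h1mem : ∀ n : ℕ, ∀ hn : 1 ≤ n, (⟨(n, 1), hn, one_le_mseq κ n⟩ : XdT κ) ∈ nonhub κ n hn :=
    fun n hn => (mem_nonhub hn _).2 ⟨rfl, le_rfl⟩
  have h2mem : ∀ n : ℕ, ∀ hn : 1 ≤ n, (⟨(n, 2), hn, two_le_mseq κ n⟩ : XdT κ) ∈ nonhub κ n hn :=
    fun n hn => (mem_nonhub hn _).2 ⟨rfl, one_le_two⟩
  have h12 : ∀ n : ℕ, ∀ hn : 1 ≤ n, (⟨(n, 1), hn, one_le_mseq κ n⟩ : XdT κ) ≠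
      ⟨(n, 2), hn, two_le_mseq κ n⟩ := fun n hn h => by simp at h
  have hopt : ∀ n : ℕ, ∀ hn : 1 ≤ n,
      (P n).real {(⟨(n, 1), hn, one_le_mseq κ n⟩, ⟨(n, 2), hn, two_le_mseq κ n⟩)} =
      Real.exp (-(b * n)) *
        (P n).real {(⟨(n, 1), hn, one_le_mseq κ n⟩, ⟨(n, 1), hn, one_le_mseq κ n⟩)} :=
    fun n hn => by
    have hn0 : (0 : ℝ) < n := by exact_mod_cast hn
    have h := real_offDiag_eq_exp_mul_real_diag hC (mud_singleton_ne_zero κ) (inv_pos.2 hn0)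
      (hPmem n hn) (hPmin n hn) (ne_top_of_le_ne_top (EReal.coe_ne_top _) (hJ n hn)) (h12 n hn)
      (mud_singleton_congr rfl) (CdBlock_self a b κ _) (CdBlock_self a b κ _)
      (CdBlock_of_ne (h12 n hn) rfl le_rfl one_le_two)
      (CdBlock_of_ne (h12 n hn).symm rfl one_le_two le_rfl)
      ((hinv n hn).diag (h1mem n hn) (h2mem n hn))
      ((hinv n hn).offDiag (h1mem n hn) (h2mem n hn) (h2mem n hn) (h1mem n hn) (h12 n hn)
        (h12 n hn).symm)
    rwa [div_inv_eq_mul] at h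
  set N : ℕ := max ⌈4 / κ⌉₊ ⌈4 * Hd κ * zeta3⌉₊ with hN
  have hexp : ∀ n : ℕ, N ≤ n → 5 ≤ Real.exp (κ * n) := fun n hn => by
    have h1 : 4 / κ ≤ n := (Nat.le_ceil _).trans (by exact_mod_cast (le_max_left _ _).trans hn)
    rw [div_le_iff₀' hκ] at h1
    linarith [Real.add_one_le_exp (κ * n)]
  have hfloor : ∀ n : ℕ, N ≤ n → 4 ≤ (mseq κ n : ℝ) ∧ (mseq κ n : ℝ) ≤ Real.exp (κ * n) ∧
      Real.exp (κ * n) ≤ mseq κ n + 1 := fun n hn => by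
    have h5 := hexp n hn
    have hfl := Nat.floor_le (Real.exp_pos (κ * n)).le
    have hlt := Nat.lt_floor_add_one (Real.exp (κ * n))
    have h2 : mseq κ n = ⌊Real.exp (κ * n)⌋₊ := max_eq_right (Nat.le_floor (by push_cast; linarith))
    rw [h2]
    exact ⟨by linarith, hfl, hlt.le⟩
  have hdiag : ∀ n : ℕ, ∀ hn : 1 ≤ n, N ≤ n → wseq n / (4 * ((mseq κ n : ℝ) + 1)) ≤
      (P n).real {(⟨(n, 1), hn, one_le_mseq κ n⟩, ⟨(n, 1), hn, one_le_mseq κ n⟩)} :=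
    fun n hn hNn => by
    have hn1 : (1 : ℝ) ≤ n := by exact_mod_cast hn
    have hz := zeta3_pos
    obtain ⟨hm4, hme, -⟩ := hfloor n hNn
    have hbal := row_balance_of_swapInvariant (hinv n hn) (hPmem n hn) (h1mem n hn) (h2mem n hn)
      (h12 n hn)
    rw [toReal_mud_singleton] at hbal
    refine diag_lower_bound hm4 (wseq_pos hn) measureReal_nonneg (hopt n hn) ?_
      (Real.exp_pos _).le ?_ hbal
    · calc (mseq κ n : ℝ) * Real.exp (-(b * n)) ≤ Real.exp (κ * n) * Real.exp (-(b * n)) :=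
            mul_le_mul_of_nonneg_right hme (Real.exp_pos _).le
        _ ≤ 1 := by
            rw [← Real.exp_add, Real.exp_le_one_iff]
            nlinarith
    · have hH := Hd_nonneg κ
      refine (ENNReal.toReal_le_of_le_ofReal (by positivity) (hcross n hn)).trans ?_
      have hbig : 4 * Hd κ * zeta3 ≤ n :=
        (Nat.le_ceil _).trans (by exact_mod_cast (le_max_right _ _).trans hNn)
      have hbig2 : 4 * Hd κ * zeta3 ≤ (n : ℝ) ^ 2 := by nlinarith
      have hn0 : (0 : ℝ) < n := by linarith
      have e1 : (n : ℝ)⁻¹ * Hd κ / (2 * (Lseq n : ℝ)) =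
          4 * Hd κ * zeta3 * (8 * zeta3 * (n : ℝ) ^ 5)⁻¹ := by
        rw [Lseq]
        push_cast
        field_simp
        ring
      have e2 : wseq n / 8 = (n : ℝ) ^ 2 * (8 * zeta3 * (n : ℝ) ^ 5)⁻¹ := by
        rw [wseq]
        field_simp
      rw [e1, e2]
      exact mul_le_mul_of_nonneg_right hbig2 (by positivity)
  refine ⟨hcross, ⟨N, fun n hn hNn => ?_⟩, ⟨N, fun n hn hNn => ?_⟩⟩
  · have hPn : IsProbabilityMeasure (P n) := (hPmem n hn).1
    rw [← ofReal_measureReal]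
    exact ENNReal.ofReal_le_ofReal (hdiag n hn hNn)
  · have hPn : IsProbabilityMeasure (P n) := (hPmem n hn).1
    have hF := measure_FnSet_of_swapInvariant (hinv n hn) (h1mem n hn) (h2mem n hn) (h12 n hn)
    refine ⟨hF, ?_⟩
    obtain ⟨hm4, -, hex⟩ := hfloor n hNn
    have hlow := offDiag_lower_bound hm4 (wseq_pos hn) hex (Real.exp_pos (-(b * n))).le
      (hdiag n hn hNn)
    rw [hF, ← ofReal_measureReal, ← ENNReal.ofReal_natCast,
      ← ENNReal.ofReal_mul (Nat.cast_nonneg _)]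
    refine ENNReal.ofReal_le_ofReal ?_
    rw [hopt n hn, Nat.cast_mul, Nat.cast_sub (one_le_mseq κ n), Nat.cast_one]
    rw [← Real.exp_add] at hlow
    rwa [show -(b - κ) * (n : ℝ) = -(b * n) + κ * n by ring]

end
end
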